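/- arXiv:2412.03094 — 4 statements merged into one kernel-verified Lean document; each statement's English description precedes it below -/
import Mathlib

section
/- Let 𝒜 and ℬ be unital C*-algebras and let ψ : 𝒜⁺ → ℬ⁺ be a surjective order isomorphism with ψ(t·1) = t·1 for all t > 0. Then an element P ∈ 𝒜⁺ is a projection if and only if ψ(P) is a projection. -/
/-- A positive element dominated by `y` and by `t • 1` is dominated by `t • h ^ 2` for every
self-adjoint `h` which is a unit for `y`. -/
lemma le_smul_mul_self_of_le {A : Type*} [CStarAlgebra A] [PartialOrder A] [StarOrderedRing A]
    {x y h : A} {t : ℝ} (hx : 0 ≤ x) (hxy : x ≤ y) (hxt : x ≤ t • (1 : A))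
    (hh : IsSelfAdjoint h) (hyh : y * h = y) : x ≤ t • (h * h) := by
  have hk : star (1 - h) = 1 - h := by simp [hh.star_eq]
  have hyk : y * (1 - h) = 0 := by rw [mul_sub, mul_one, hyh, sub_self]
  have hkxk : star (1 - h) * x * (1 - h) = 0 := by
    refine le_antisymm ?_ (star_left_conjugate_nonneg hx _)
    calc star (1 - h) * x * (1 - h) ≤ star (1 - h) * y * (1 - h) :=
          star_left_conjugate_le_conjugate hxy _
      _ = 0 := by rw [mul_assoc, hyk, mul_zero]
  have hsq : CFC.sqrt x * CFC.sqrt x = x := CFC.sqrt_mul_sqrt_self x hx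
  have hsk : CFC.sqrt x * (1 - h) = 0 := by
    rw [← CStarRing.star_mul_self_eq_zero_iff, star_mul,
      (IsSelfAdjoint.of_nonneg (CFC.sqrt_nonneg x)).star_eq, mul_assoc, ← mul_assoc (CFC.sqrt x),
      hsq, ← mul_assoc, hkxk]
  have hxk : x * (1 - h) = 0 := by
    rw [← hsq, mul_assoc, hsk, mul_zero]
  have hxh : x * h = x := by
    rw [mul_sub, mul_one, sub_eq_zero] at hxk
    exact hxk.symm
  have hhx : h * x = x := by
    simpa [hh.star_eq, (IsSelfAdjoint.of_nonneg hx).star_eq] using congrArg star hxh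
  calc x = star h * x * h := by rw [hh.star_eq, hhx, hxh]
    _ ≤ star h * (t • (1 : A)) * h := star_left_conjugate_le_conjugate hxt _
    _ = t • (h * h) := by simp [hh.star_eq]

/-- An order-theoretic characterization of projections among the positive elements, in terms of
the scalar multiples of the unit. -/
lemma isSelfAdjoint_and_isIdempotentElem_iff_order {A : Type*} [CStarAlgebra A] [PartialOrder A]
    [StarOrderedRing A] {P : A} (hP : 0 ≤ P) :
    (IsSelfAdjoint P ∧ IsIdempotentElem P) ↔
      P ≤ 1 ∧ ∀ t : ℝ, 0 < t → ∀ q : A, 0 ≤ q → q ≤ 1 → t ≤ 1 →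
        (∀ x : A, 0 ≤ x → x ≤ q → x ≤ t • (1 : A) → x ≤ P) → q ≤ P := by
  constructor
  · rintro ⟨hsa, hid⟩
    refine ⟨(IsStarProjection.mk hid hsa).le_one, fun t ht q hq hq1 ht1 H ↦ ?_⟩
    have h1 : t • q ≤ t • (1 : A) := smul_le_smul_of_nonneg_left hq1 ht.le
    have h2 : t • q ≤ P := H _ (smul_nonneg ht.le hq) (smul_le_of_le_one_left hq ht1) h1
    have h3 := le_smul_mul_self_of_le (smul_nonneg ht.le hq) h2 h1 hsa hid
    rw [hid.eq] at h3
    exact (smul_le_smul_iff_of_pos_left ht).1 h3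
  · rintro ⟨hP1, H⟩
    have hsa : IsSelfAdjoint P := .of_nonneg hP
    have hspec : ∀ c ∈ spectrum ℝ P, 0 < c → c = 1 := by
      intro c hc hc0
      have hc1 : c ≤ 1 := (CFC.le_one_iff P).1 hP1 c hc
      refine le_antisymm hc1 ?_
      let g : ℝ → ℝ := fun r ↦ min 1 (max 0 ((2 * r - c) / c))
      let h : ℝ → ℝ := fun r ↦ min 1 (2 * r / c)
      have hg : Continuous g := by fun_prop
      have hh : Continuous h := by fun_prop
      have hgP : cfc g P ≤ P := by
        refine H (c / 2) (by positivity) _ (cfc_nonneg fun r _ ↦ by positivity)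
          (cfc_le_one g P fun r _ ↦ min_le_left _ _) (by linarith) fun x hx hxg hxt ↦ ?_
        have hgh : cfc g P * cfc h P = cfc g P := by
          rw [← cfc_mul g h P hg.continuousOn hh.continuousOn]
          congr 1
          ext r
          rcases le_total (2 * r) c with hr | hr
          · have : (2 * r - c) / c ≤ 0 := div_nonpos_of_nonpos_of_nonneg (by linarith) hc0.le
            simp [g, this]
          · have : 1 ≤ 2 * r / c := (one_le_div hc0).2 hr
            simp [h, this]
        refine (le_smul_mul_self_of_le hx hxg hxt (cfc_predicate h P) hgh).trans ?_
        rw [← cfc_mul h h P hh.continuousOn hh.continuousOn,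
          ← cfc_smul (c / 2) (fun r ↦ h r * h r) P (hh.mul hh).continuousOn]
        conv_rhs => rw [← cfc_id' ℝ P]
        have hcont : Continuous fun r ↦ (c / 2) • (h r * h r) := by fun_prop
        refine cfc_mono (fun r hr ↦ ?_) hcont.continuousOn continuousOn_id
        have hr0 : 0 ≤ r := spectrum_nonneg_of_nonneg hP hr
        have h0 : 0 ≤ h r := by positivity
        have h1 : h r ≤ 1 := min_le_left _ _
        have h2 : c * h r ≤ 2 * r := by
          have : h r ≤ 2 * r / c := min_le_right _ _
          rwa [le_div_iff₀ hc0, mul_comm] at this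
        simp only [smul_eq_mul]
        nlinarith [mul_le_mul_of_nonneg_right h2 h0]
      conv_rhs at hgP => rw [← cfc_id' ℝ P]
      have := (cfc_le_iff g (fun r ↦ r) P hg.continuousOn continuousOn_id).1 hgP c hc
      have hgc : g c = 1 := by
        have : (2 * c - c) / c = 1 := by field_simp; ring
        simp [g, this]
      rwa [hgc] at this
    refine ⟨hsa, ?_⟩
    have : cfc (fun r : ℝ ↦ r * r) P = cfc (fun r : ℝ ↦ r) P := by
      refine cfc_congr fun c hc ↦ ?_
      rcases (spectrum_nonneg_of_nonneg hP hc).eq_or_lt with h0 | h0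
      · simp [← h0]
      · simp [hspec c hc h0]
    rwa [cfc_mul (fun r : ℝ ↦ r) (fun r ↦ r) P, cfc_id' ℝ P] at this

/-- Let `ψ : 𝒜⁺ → ℬ⁺` be a surjective order isomorphism between the positive
cones of unital C*-algebras with `ψ (t • 1) = t • 1` for all `t > 0`.  Then an element
`P ∈ 𝒜⁺` is a projection if and only if `ψ P` is a projection. -/
theorem stmt6 {A B : Type*} [CStarAlgebra A] [PartialOrder A] [StarOrderedRing A]
    [CStarAlgebra B] [PartialOrder B] [StarOrderedRing B]
    (ψ : A → B)
    (hmap : ∀ a : A, 0 ≤ a → 0 ≤ ψ a)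
    (hsurj : ∀ b : B, 0 ≤ b → ∃ a : A, 0 ≤ a ∧ ψ a = b)
    (horder : ∀ a b : A, 0 ≤ a → 0 ≤ b → (a ≤ b ↔ ψ a ≤ ψ b))
    (hunit : ∀ t : ℝ, 0 < t → ψ (t • (1 : A)) = t • (1 : B)) :
    ∀ P : A, 0 ≤ P →
      ((IsSelfAdjoint P ∧ IsIdempotentElem P) ↔
        (IsSelfAdjoint (ψ P) ∧ IsIdempotentElem (ψ P))) := by
  intro P hP
  have h1 : ψ 1 = 1 := by simpa using hunit 1 one_pos
  rw [isSelfAdjoint_and_isIdempotentElem_iff_order hP,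
    isSelfAdjoint_and_isIdempotentElem_iff_order (hmap P hP)]
  refine and_congr (by rw [horder P 1 hP zero_le_one, h1]) ?_
  refine forall₂_congr fun t ht ↦ ⟨fun H q hq hq1 ht1 Hq ↦ ?_, fun H q hq hq1 ht1 Hq ↦ ?_⟩
  · obtain ⟨q, hq', rfl⟩ := hsurj q hq
    rw [← horder q P hq' hP]
    refine H q hq' (by rwa [horder q 1 hq' zero_le_one, h1]) ht1 fun x hx hxq hxt ↦ ?_
    rw [horder x P hx hP]
    refine Hq _ (hmap x hx) ((horder x q hx hq').1 hxq) ?_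
    rwa [← hunit t ht, ← horder x _ hx (smul_nonneg ht.le zero_le_one)]
  · rw [horder q P hq hP]
    refine H _ (hmap q hq) (by rwa [← h1, ← horder q 1 hq zero_le_one]) ht1 fun x hx hxq hxt ↦ ?_
    obtain ⟨x, hx', rfl⟩ := hsurj x hx
    rw [← horder x P hx' hP]
    refine Hq x hx' ((horder x q hx' hq).2 hxq) ?_
    rwa [horder x _ hx' (smul_nonneg ht.le zero_le_one), hunit t ht]
end

section
/- Let 𝒜 and ℬ be unital C*-algebras and let φ : 𝒜⁺⁺ → ℬ⁺⁺ be a surjective norm preserving order isomorphism with φ(t·1) = t·1 for all t > 0. Then for every projection P ∈ 𝒜 and all 0 < ε₁ < ε₂ one has φ(P + ε₁·1) − ε₁·1 = φ(P + ε₂·1) − ε₂·1; that is, the maps ψ_ε(A) = φ(A + ε·1) − ε·1 all agree on projections. -/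
lemma smul_one_sub_negPart {A : Type*} [CStarAlgebra A] {x : A} (hx : IsSelfAdjoint x) (r : ℝ) :
    r • 1 - (x - r • 1)⁻ = cfc (fun y : ℝ => min y r) x := by
  have h1 : x - r • 1 = cfc (fun y : ℝ => y - r) x := by
    rw [cfc_sub (fun y => y) (fun _ => r) x, cfc_const r x, cfc_id' ℝ x,
      Algebra.algebraMap_eq_smul_one]
  have h2 : (r • 1 : A) = cfc (fun _ : ℝ => r) x := by
    rw [cfc_const r x, Algebra.algebraMap_eq_smul_one]
  rw [h1, CFC.negPart_def, cfcₙ_eq_cfc, ← cfc_comp' (fun y : ℝ => y⁻) (fun y : ℝ => y - r) x,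
    h2, ← cfc_sub ..]
  refine cfc_congr fun y _ => ?_
  rcases le_total y r with h | h
  · simp [h]
  · simp [h]

section

variable {A : Type*} [CStarAlgebra A] [PartialOrder A] [StarOrderedRing A]

lemma mul_eq_of_nonneg_of_le_smul {x e : A} {s : ℝ} (he : IsStarProjection e) (hs : 0 < s)
    (hx : 0 ≤ x) (hxe : x ≤ s • e) : x * e = x ∧ e * x = x := by
  have h := he.mul_right_and_mul_left_of_nonneg_of_le (a := s⁻¹ • x)
    (smul_nonneg (by positivity) hx) (by
      have := smul_le_smul_of_nonneg_left hxe (inv_nonneg.2 hs.le)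
      rwa [smul_smul, inv_mul_cancel₀ hs.ne', one_smul] at this)
  have hs' : s⁻¹ ≠ 0 := inv_ne_zero hs.ne'
  constructor
  · have := h.1
    rw [smul_mul_assoc] at this
    exact smul_right_injective A hs' this
  · have := h.2
    rw [mul_smul_comm] at this
    exact smul_right_injective A hs' this

lemma le_smul_of_le_smul_of_le {x e : A} {s t : ℝ} (he : IsStarProjection e) (hs : 0 < s)
    (hx : 0 ≤ x) (hxe : x ≤ s • e) (hxt : x ≤ t • 1) : x ≤ t • e := by
  obtain ⟨h1, h2⟩ := mul_eq_of_nonneg_of_le_smul he hs hx hxe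
  have := he.isSelfAdjoint.conjugate_le_conjugate hxt
  rw [h2, h1] at this
  simpa [he.isIdempotentElem.eq] using this

lemma eq_zero_of_le_smul_of_le_smul_one_sub {x e : A} {t : ℝ} (he : IsStarProjection e)
    (ht : 0 < t) (hx : 0 ≤ x) (h1 : x ≤ t • e) (h2 : x ≤ t • (1 - e)) : x = 0 := by
  have h3 := (mul_eq_of_nonneg_of_le_smul he ht hx h1).1
  have h4 := (mul_eq_of_nonneg_of_le_smul he.one_sub ht hx h2).1
  rw [← h4, mul_sub, mul_one, h3, sub_self]

lemma negPart_le_of_commute {a d : A} (hd : IsSelfAdjoint d) (h : Commute a d) (ha : 0 ≤ a)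
    (had : 0 ≤ a + d) : d⁻ ≤ a := by
  have hcn : Commute d⁻ a := by
    rw [CFC.negPart_def]; exact h.symm.cfcₙ_real _
  have hcd : Commute d⁻ d := by
    rw [CFC.negPart_def]; exact (Commute.refl d).cfcₙ_real _
  have hdd : d = d⁺ - d⁻ := (CFC.posPart_sub_negPart d).symm
  have hy : IsSelfAdjoint (a - d⁻) := ha.isSelfAdjoint.sub (CFC.negPart_nonneg d).isSelfAdjoint
  set y := a - d⁻ with hydef
  have hya : Commute y⁻ a := by
    rw [CFC.negPart_def]
    exact ((Commute.refl a).sub_left hcn).cfcₙ_real _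
  have hyd : Commute y⁻ d := by
    rw [CFC.negPart_def]
    exact (h.sub_left hcd).cfcₙ_real _
  have hyn : Commute y⁻ d⁻ := by
    rw [CFC.negPart_def]
    exact (hcn.symm.sub_left (Commute.refl _)).cfcₙ_real _
  have hyy : y * y⁻ = - (y⁻ * y⁻) := by
    nth_rw 1 [← CFC.posPart_sub_negPart y]
    rw [sub_mul, CFC.posPart_mul_negPart, zero_sub]
  have h1 : 0 ≤ d⁻ * y := by
    have h0 : d⁻ * d = -(d⁻ * d⁻) := by
      conv_lhs => enter [2]; rw [hdd]
      rw [mul_sub, CFC.negPart_mul_posPart, zero_sub]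
    have : d⁻ * y = d⁻ * (a + d) := by
      rw [hydef, mul_sub, mul_add, h0, sub_eq_add_neg]
    rw [this]
    exact (hcn.add_right hcd).mul_nonneg (CFC.negPart_nonneg d) had
  have hn0 := CFC.negPart_nonneg y
  have h2 : d⁻ * (y⁻ * y⁻) = 0 := by
    apply le_antisymm
    · have : 0 ≤ d⁻ * y * y⁻ :=
        Commute.mul_nonneg h1 hn0 (hyn.mul_right (hya.sub_right hyn)).symm
      rw [mul_assoc, hyy, mul_neg] at this
      exact neg_nonneg.1 this
    · exact (hyn.symm.mul_right hyn.symm).mul_nonneg (CFC.negPart_nonneg d)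
        ((Commute.refl _).mul_nonneg hn0 hn0)
  have h3 : y⁻ * d⁻ * y⁻ = 0 := by
    rw [hyn.eq, mul_assoc, h2]
  have h4 : y⁻ * y⁻ * y⁻ = 0 := by
    apply le_antisymm
    · have : 0 ≤ y⁻ * a * y⁻ := conjugate_nonneg_of_nonneg ha hn0
      have h5 : a = y + d⁻ := by simp [hydef]
      rw [h5, mul_add, add_mul, h3, add_zero, mul_assoc, hyy, mul_neg, ← mul_assoc] at this
      exact neg_nonneg.1 this
    · exact conjugate_nonneg_of_nonneg hn0 hn0
  have h5 : y⁻ = 0 := by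
    have h6 : star (y⁻ * y⁻) * (y⁻ * y⁻) = 0 := by
      rw [star_mul, hn0.star_eq, ← mul_assoc, h4, zero_mul]
    have h7 : star y⁻ * y⁻ = 0 := by
      rw [hn0.star_eq]
      exact CStarRing.star_mul_self_eq_zero_iff _ |>.1 h6
    exact CStarRing.star_mul_self_eq_zero_iff _ |>.1 h7
  have := (CFC.negPart_eq_zero_iff y hy).1 h5
  exact sub_nonneg.1 this

lemma commute_of_forall_unitary_conjugate_le {m x : A} (hx : IsSelfAdjoint x)
    (h : ∀ u ∈ unitary A, Commute u x → u * m * star u ≤ m) : Commute m x := by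
  have key : ∀ u ∈ unitary A, Commute u x → Commute u m := by
    intro u hu hux
    have hsx : Commute (star u) x := by
      have := hux.star_star
      rwa [hx.star_eq] at this
    have h1 := h u hu hux
    have h2 := h (star u) (Unitary.star_mem hu) hsx
    rw [star_star] at h2
    have h3 := star_right_conjugate_le_conjugate h2 u
    have hu2 : u * star u = 1 := hu.2
    have h4 : u * (star u * m * u) * star u = m := by
      simp only [← mul_assoc, hu2, one_mul]
      rw [mul_assoc, hu2, mul_one]
    rw [h4] at h3
    have h5 : u * m * star u = m := le_antisymm h1 h3
    have h6 := congrArg (· * u) h5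
    simp only [mul_assoc, hu.1, mul_one] at h6
    exact h6
  rcases eq_or_ne x 0 with rfl | hx0
  · exact Commute.zero_right m
  have hn : ‖x‖ ≠ 0 := norm_ne_zero_iff.2 hx0
  let a : selfAdjoint A := ⟨‖x‖⁻¹ • x, (IsSelfAdjoint.all _).smul hx⟩
  have han : ‖a‖ ≤ 1 := by
    change ‖‖x‖⁻¹ • x‖ ≤ 1
    rw [norm_smul, norm_inv, norm_norm, inv_mul_cancel₀ hn]
  set u := selfAdjoint.unitarySelfAddISMul a han with hu
  have hax : Commute (a : A) x := (Commute.refl x).smul_left _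
  have hux : Commute (u : A) x := by
    rw [hu, selfAdjoint.unitarySelfAddISMul_coe]
    refine hax.add_left (Commute.smul_left ?_ _)
    rw [CFC.sqrt]
    exact ((Commute.one_left x).sub_left (hax.pow_left 2)).cfcₙ_nnreal _
  have h1 := key u u.2 hux
  have hsx : Commute (star (u : A)) x := by
    have := hux.star_star
    rwa [hx.star_eq] at this
  have h2 := key (star u) (Unitary.star_mem u.2) hsx
  have h3 : (u : A) + star (u : A) = (2 * ‖x‖⁻¹) • x := by
    have := selfAdjoint.star_coe_unitarySelfAddISMul a han
    rw [← hu] at this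
    rw [this, hu, selfAdjoint.unitarySelfAddISMul_coe]
    change ‖x‖⁻¹ • x + _ + (‖x‖⁻¹ • x - _) = _
    rw [mul_smul, two_smul]
    abel
  have h4 : x = (2 * ‖x‖⁻¹)⁻¹ • ((u : A) + star (u : A)) := by
    rw [h3, smul_smul, inv_mul_cancel₀ (by positivity), one_smul]
  rw [h4]
  exact (h1.add_left h2).symm.smul_right _

lemma le_cfc_min_of_forall_le {m x : A} {r : ℝ} (hx : 0 ≤ x) (hm0 : 0 ≤ m) (hmx : m ≤ x)
    (hmr : m ≤ r • 1) (h : ∀ n : A, 0 ≤ n → n ≤ x → n ≤ r • 1 → n ≤ m) :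
    m ≤ cfc (fun y : ℝ => min y r) x := by
  rw [← smul_one_sub_negPart hx.isSelfAdjoint r]
  have hc : Commute m x := by
    refine commute_of_forall_unitary_conjugate_le hx.isSelfAdjoint fun u hu hux => ?_
    refine h _ (star_right_conjugate_nonneg hm0 u) ?_ ?_
    · have := star_right_conjugate_le_conjugate hmx u
      rwa [hux.eq, mul_assoc x, hu.2, mul_one] at this
    · have := star_right_conjugate_le_conjugate hmr u
      rwa [mul_smul_comm, smul_mul_assoc, mul_one, hu.2] at this
  have hr : IsSelfAdjoint (r • 1 : A) := (IsSelfAdjoint.all _).smul (IsSelfAdjoint.one A)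
  have hr1 : ∀ y : A, Commute (r • 1) y := fun y => (Commute.one_left y).smul_left _
  have := negPart_le_of_commute (a := r • 1 - m) (d := x - r • 1) (hx.isSelfAdjoint.sub hr)
    ((hr1 _).sub_left (hc.sub_right (hr1 m).symm)) (sub_nonneg.2 hmr)
    (by simpa using hmx)
  exact le_sub_comm.1 this

lemma mul_mul_eq_zero_of_forall_le {m x e d : A} {r : ℝ} (he : IsSelfAdjoint e)
    (hd : IsSelfAdjoint d) (hed : e * d = 0) (h1 : e * e ≤ r • 1 - m) (h2 : d * d ≤ x - m)
    (h3 : e * e + d * d ≤ m) (h : ∀ n : A, 0 ≤ n → n ≤ x → n ≤ r • 1 → n ≤ m) (b : A) :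
    e * b * d = 0 := by
  have key : ∀ b : A, e * b * d + d * star b * e ≤ 0 := by
    intro b
    set k := e * b * d + d * star b * e with hk
    set s₁ := d * star b * (b * d) with hs₁
    set s₂ := e * b * (star b * e) with hs₂
    set β := ‖star b * b‖ with hβ
    have hβ0 : 0 ≤ β := norm_nonneg _
    have hee : 0 ≤ e * e := he.mul_self_nonneg
    have hdd : 0 ≤ d * d := hd.mul_self_nonneg
    have hs₁0 : 0 ≤ s₁ := by
      have := star_mul_self_nonneg (b * d)
      rwa [star_mul, hd.star_eq] at this
    have hs₂0 : 0 ≤ s₂ := by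
      have := star_mul_self_nonneg (star b * e)
      rwa [star_mul, he.star_eq, star_star] at this
    have hs₁' : s₁ ≤ β • (d * d) := by
      have := hd.conjugate_le_conjugate
        (IsSelfAdjoint.star_mul_self b).le_algebraMap_norm_self
      rw [Algebra.algebraMap_eq_smul_one] at this
      simpa [hs₁, hβ, mul_assoc] using this
    have hs₂' : s₂ ≤ β • (e * e) := by
      have hn : ‖b * star b‖ = β := by
        rw [hβ, CStarRing.norm_self_mul_star, CStarRing.norm_star_mul_self]
      have := he.conjugate_le_conjugate
        (IsSelfAdjoint.mul_star_self b).le_algebraMap_norm_self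
      rw [Algebra.algebraMap_eq_smul_one, hn] at this
      simpa [hs₂, mul_assoc] using this
    have c1 : ∀ γ : ℝ, 0 ≤ e * e + γ ^ 2 • s₁ - γ • k := by
      intro γ
      have := star_mul_self_nonneg (e - γ • (b * d))
      simp only [star_sub, star_smul, star_mul, he.star_eq, hd.star_eq, star_trivial] at this
      convert this using 1
      simp only [hs₁, hk, sub_mul, mul_sub, smul_mul_assoc, mul_smul_comm, mul_assoc]
      module
    have c2 : ∀ γ : ℝ, 0 ≤ d * d + γ ^ 2 • s₂ - γ • k := by
      intro γ
      have := star_mul_self_nonneg (d - γ • (star b * e))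
      simp only [star_sub, star_smul, star_mul, he.star_eq, hd.star_eq, star_trivial,
        star_star] at this
      convert this using 1
      simp only [hs₂, hk, sub_mul, mul_sub, smul_mul_assoc, mul_smul_comm, mul_assoc]
      module
    have c3 : 0 ≤ e * e + s₁ + k := by
      have := c1 (-1)
      simpa using this
    have hle : ∀ γ : ℝ, 0 < γ → γ * (1 + 2 * β) ≤ 1 → k ≤ γ • (s₁ + s₂) := by
      intro γ hγ hγ1
      have hγ2 : γ ≤ 1 := by nlinarith
      have hn := h (m + γ • k - γ ^ 2 • (s₁ + s₂)) ?_ ?_ ?_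
      · have h5 : 0 ≤ γ⁻¹ • (m - (m + γ • k - γ ^ 2 • (s₁ + s₂))) :=
          smul_nonneg (by positivity) (sub_nonneg.2 hn)
        have h6 : γ⁻¹ • (m - (m + γ • k - γ ^ 2 • (s₁ + s₂))) = γ • (s₁ + s₂) - k := by
          match_scalars <;> field_simp <;> ring_nf
        rw [h6] at h5
        exact sub_nonneg.1 h5
      · have t1 := smul_nonneg hγ.le c3
        have t2 := smul_nonneg (show 0 ≤ γ + γ ^ 2 by positivity) (sub_nonneg.2 hs₁')
        have t3 := smul_nonneg (show 0 ≤ γ ^ 2 by positivity) (sub_nonneg.2 hs₂')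
        have t4 := smul_nonneg (show 0 ≤ 1 - γ - γ ^ 2 * β by nlinarith) hee
        have t5 := smul_nonneg (show 0 ≤ 1 - (γ + γ ^ 2) * β by nlinarith) hdd
        have t6 := sub_nonneg.2 h3
        have := add_nonneg (add_nonneg (add_nonneg t1 t2) (add_nonneg t3 t4)) (add_nonneg t5 t6)
        convert this using 1
        module
      · have := add_nonneg (add_nonneg (sub_nonneg.2 h2) (c2 γ))
          (smul_nonneg (show 0 ≤ γ ^ 2 by positivity) hs₁0)
        rw [← sub_nonneg]
        convert this using 1
        module
      · have := add_nonneg (add_nonneg (sub_nonneg.2 h1) (c1 γ))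
          (smul_nonneg (show 0 ≤ γ ^ 2 by positivity) hs₂0)
        rw [← sub_nonneg]
        convert this using 1
        module
    have ht : Filter.Tendsto (fun γ : ℝ => γ • (s₁ + s₂)) (nhdsWithin 0 (Set.Ioi 0))
        (nhds 0) := by
      have : Filter.Tendsto (fun γ : ℝ => γ • (s₁ + s₂)) (nhds 0) (nhds ((0 : ℝ) • (s₁ + s₂))) :=
        (continuous_id.smul continuous_const).tendsto 0
      rw [zero_smul] at this
      exact this.mono_left nhdsWithin_le_nhds
    refine ge_of_tendsto ht ?_
    have hpos : 0 < (1 + 2 * β)⁻¹ := by positivity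
    filter_upwards [Ioc_mem_nhdsGT hpos] with γ hγ
    refine hle γ hγ.1 ?_
    have := hγ.2
    rwa [le_inv_comm₀ hγ.1 (by positivity), ← one_div, le_div_iff₀ hγ.1, mul_comm] at this
  have k1 := key b
  have k2 := key (-b)
  have k3 : e * b * d + d * star b * e = 0 := by
    refine le_antisymm k1 ?_
    simp only [star_neg, mul_neg, neg_mul] at k2
    rwa [← neg_add, neg_nonpos] at k2
  have k4 : e * (e * b * d) = 0 := by
    rw [eq_neg_of_add_eq_zero_left k3, mul_neg, mul_assoc, ← mul_assoc e d, hed, zero_mul,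
      neg_zero]
  refine CStarRing.star_mul_self_eq_zero_iff _ |>.1 ?_
  rw [star_mul, star_mul, he.star_eq, hd.star_eq, mul_assoc, mul_assoc (star b), k4, mul_zero,
    mul_zero]

lemma add_le_of_mul_eq_zero {w z : A} {s : ℝ} (hs : 0 < s) (hw : w ≤ s • 1) (hz : z ≤ s • 1)
    (hwz : w * z = 0) (hzw : z * w = 0) : w + z ≤ s • 1 := by
  have hc : Commute (s • 1 - w) (s • 1 - z) := by
    have h1 : ∀ y : A, Commute (s • 1) y := fun y => (Commute.one_left y).smul_left _
    exact ((h1 _).sub_left (((h1 w).symm).sub_right (hwz.trans hzw.symm)))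
  have := smul_nonneg (inv_nonneg.2 hs.le)
    (hc.mul_nonneg (sub_nonneg.2 hw) (sub_nonneg.2 hz))
  have h2 : s⁻¹ • ((s • 1 - w) * (s • 1 - z)) = s • 1 - (w + z) := by
    simp only [sub_mul, mul_sub, smul_mul_assoc, mul_smul_comm, one_mul, mul_one, hwz]
    match_scalars <;> field_simp
  rw [h2] at this
  exact sub_nonneg.1 this

lemma mul_self_eq_zero_of_compl {q p e d : A} {r t : ℝ} (hr0 : 0 < r) (hrt : r < t)
    (hp : 0 ≤ p) (hpt : p ≤ t • 1) (hbot : ∀ x : A, 0 ≤ x → x ≤ q → x ≤ p → x = 0)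
    (htop : ∀ y : A, y ≤ t • 1 → q ≤ y → p ≤ y → y = t • 1)
    (hes : IsSelfAdjoint e) (hds : IsSelfAdjoint d) (hzero : ∀ b : A, e * b * d = 0)
    (heer : e * e ≤ r • 1) (hleq : e * e ≤ q) (hw : d * d ≤ (t - r) • 1)
    (h2 : q ≤ r • 1 + d * d) : e * e = 0 := by
  have ht : 0 < t := hr0.trans hrt
  set g := CFC.sqrt (t • 1 - p) with hg
  have hgg : g * g = t • 1 - p := CFC.sqrt_mul_sqrt_self _ (sub_nonneg.2 hpt)
  have hgs : IsSelfAdjoint g := (CFC.sqrt_nonneg _).isSelfAdjoint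
  have hee0 : 0 ≤ e * e := hes.mul_self_nonneg
  set c := (t - r) / (r * t) with hc
  have hc0 : 0 < c := div_pos (sub_pos.2 hrt) (by positivity)
  have hcr : c * r ≤ 1 := by
    rw [hc, div_mul_eq_mul_div, div_le_one (by positivity)]
    nlinarith
  have hcrt : c * r * t = t - r := by rw [hc]; field_simp
  set z := c • (g * (e * e) * g) with hz
  have hz0 : 0 ≤ z := smul_nonneg hc0.le (hgs.conjugate_nonneg hee0)
  have hz1 : z ≤ (c * r) • (t • 1 - p) := by
    have := smul_le_smul_of_nonneg_left (hgs.conjugate_le_conjugate heer) hc0.le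
    rwa [mul_smul_comm, mul_one, smul_mul_assoc, hgg, smul_smul] at this
  have hz2 : z ≤ t • 1 - p := by
    refine hz1.trans ?_
    have := smul_nonneg (sub_nonneg.2 hcr) (sub_nonneg.2 hpt)
    rw [sub_smul, one_smul] at this
    exact sub_nonneg.1 this
  have hz3 : z ≤ (t - r) • 1 := by
    refine hz1.trans ?_
    have := smul_nonneg (by positivity : 0 ≤ c * r) hp
    rw [← hcrt, mul_smul (c * r), smul_sub]
    exact sub_le_self _ this
  have hzw : z * (d * d) = 0 := by
    have := hzero g
    rw [hz, smul_mul_assoc]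
    have h2 : g * (e * e) * g * (d * d) = g * e * (e * g * d) * d := by
      simp only [mul_assoc]
    rw [h2, this]
    simp
  have hwz : d * d * z = 0 := by
    have := congrArg star hzw
    rwa [star_zero, star_mul, star_mul, hds.star_eq, hz0.star_eq] at this
  have hqz : q + z ≤ t • 1 := by
    have h1 := add_le_of_mul_eq_zero (sub_pos.2 hrt) hw hz3 hwz hzw
    calc q + z ≤ r • 1 + d * d + z := by gcongr
      _ = r • 1 + (d * d + z) := add_assoc _ _ _
      _ ≤ r • 1 + (t - r) • 1 := by gcongr
      _ = t • 1 := by rw [← add_smul]; congr 1; ring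
  have hz4 : z = 0 := by
    have := htop (t • 1 - z) (sub_le_self _ hz0) (le_sub_iff_add_le.2 hqz) (le_sub_comm.1 hz2)
    simpa using this
  have heg : e * g = 0 := by
    rw [hz, smul_eq_zero_iff_right hc0.ne'] at hz4
    refine CStarRing.star_mul_self_eq_zero_iff _ |>.1 ?_
    rw [star_mul, hes.star_eq, hgs.star_eq, ← hz4]
    simp only [mul_assoc]
  have hep : e * p = t • e := by
    have : e * (g * g) = 0 := by rw [← mul_assoc, heg, zero_mul]
    rw [hgg, mul_sub, mul_smul_comm, mul_one, sub_eq_zero] at this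
    exact this.symm
  have hpe : p * e = t • e := by
    have := congrArg star hep
    rwa [star_mul, star_smul, hes.star_eq, hp.star_eq, star_trivial] at this
  have hpee : p * (e * e) = t • (e * e) := by rw [← mul_assoc, hpe, smul_mul_assoc]
  have heep : e * e * p = t • (e * e) := by rw [mul_assoc, hep, mul_smul_comm]
  have hle : e * e ≤ p := by
    have h1 : Commute p (t • 1 - e * e) :=
      ((Commute.one_right p).smul_right _).sub_right (hpee.trans heep.symm)
    have h2 : e * e ≤ t • 1 := by
      refine heer.trans ?_
      have := smul_nonneg (sub_nonneg.2 hrt.le) (zero_le_one (α := A))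
      rw [sub_smul] at this
      exact sub_nonneg.1 this
    have h3 := smul_nonneg (inv_nonneg.2 ht.le) (h1.mul_nonneg hp (sub_nonneg.2 h2))
    rw [mul_sub, mul_smul_comm, mul_one, hpee, ← smul_sub, smul_smul, inv_mul_cancel₀ ht.ne',
      one_smul] at h3
    exact sub_nonneg.1 h3
  exact hbot _ hee0 hleq hle

set_option maxHeartbeats 800000 in
lemma mul_self_eq_smul_of_inf_of_compl {q p : A} {t : ℝ} (ht : 0 < t) (hq : 0 ≤ q)
    (hqt : q ≤ t • 1) (hp : 0 ≤ p) (hpt : p ≤ t • 1)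
    (hinf : ∀ r : ℝ, 0 < r → r < t → ∃ m : A, 0 ≤ m ∧ m ≤ q ∧ m ≤ r • 1 ∧
      ∀ n : A, 0 ≤ n → n ≤ q → n ≤ r • 1 → n ≤ m)
    (hbot : ∀ x : A, 0 ≤ x → x ≤ q → x ≤ p → x = 0)
    (htop : ∀ y : A, y ≤ t • 1 → q ≤ y → p ≤ y → y = t • 1) :
    q * q = t • q := by
  have hspec0 : ∀ x ∈ spectrum ℝ q, 0 ≤ x := fun x hx => spectrum_nonneg_of_nonneg hq hx
  have hspect : ∀ x ∈ spectrum ℝ q, x ≤ t := by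
    rw [← Algebra.algebraMap_eq_smul_one] at hqt
    exact (le_algebraMap_iff_spectrum_le (ha := hq.isSelfAdjoint)).1 hqt
  have hconst : ∀ r : ℝ, (r • 1 : A) = cfc (fun _ : ℝ => r) q := fun r => by
    rw [cfc_const r q hq.isSelfAdjoint, Algebra.algebraMap_eq_smul_one]
  have hid : q = cfc (fun x : ℝ => x) q := (cfc_id' ℝ q hq.isSelfAdjoint).symm
  have key : ∀ r : ℝ, t / 2 ≤ r → r < t → ∀ x ∈ spectrum ℝ q, max 0 (min x (r - x)) = 0 := by
    intro r hr hrt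
    have hr0 : 0 < r := by linarith
    set e := cfc (fun x : ℝ => √(max 0 (min x (r - x)))) q with he
    set d := cfc (fun x : ℝ => √(max 0 (x - r))) q with hd
    set m := cfc (fun x : ℝ => min x r) q with hm
    have hee : e * e = cfc (fun x : ℝ => max 0 (min x (r - x))) q := by
      rw [he, ← cfc_mul ..]
      exact cfc_congr fun x _ => Real.mul_self_sqrt (le_max_left _ _)
    have hdd : d * d = cfc (fun x : ℝ => max 0 (x - r)) q := by
      rw [hd, ← cfc_mul ..]
      exact cfc_congr fun x _ => Real.mul_self_sqrt (le_max_left _ _)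
    have hes : IsSelfAdjoint e := cfc_predicate _ _
    have hds : IsSelfAdjoint d := cfc_predicate _ _
    have hed : e * d = 0 := by
      rw [he, hd, ← cfc_mul .., ← cfc_const_zero ℝ q]
      refine cfc_congr fun x _ => ?_
      rcases le_total x r with h | h
      · simp [max_eq_left (sub_nonpos.2 h)]
      · have : min x (r - x) ≤ 0 := (min_le_right _ _).trans (sub_nonpos.2 h)
        simp [max_eq_left this]
    have hzero : ∀ b : A, e * b * d = 0 := by
      refine mul_mul_eq_zero_of_forall_le (m := m) (x := q) (r := r) hes hds hed ?_ ?_ ?_ ?_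
      · rw [hee, hconst r, hm, ← cfc_sub ..]
        refine cfc_mono fun x hx => ?_
        have := hspec0 x hx
        grind
      · conv_rhs => rw [hid]
        rw [hdd, hm, ← cfc_sub ..]
        refine cfc_mono fun x hx => ?_
        grind
      · rw [hee, hdd, hm, ← cfc_add ..]
        refine cfc_mono fun x hx => ?_
        have := hspec0 x hx
        have := hspect x hx
        grind
      · obtain ⟨M, hM0, hMq, hMr, hM⟩ := hinf r hr0 hrt
        intro n h1 h2 h3
        exact (hM n h1 h2 h3).trans (le_cfc_min_of_forall_le hq hM0 hMq hMr hM)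
    have h0 : e * e = 0 := by
      refine mul_self_eq_zero_of_compl hr0 hrt hp hpt hbot htop hes hds hzero ?_ ?_ ?_ ?_
      · rw [hee, hconst r]
        refine cfc_mono fun x hx => ?_
        have := hspec0 x hx
        grind
      · conv_rhs => rw [hid]
        rw [hee]
        refine cfc_mono fun x hx => ?_
        have := hspec0 x hx
        grind
      · rw [hdd, hconst]
        refine cfc_mono fun x hx => ?_
        have := hspect x hx
        grind
      · conv_lhs => rw [hid]
        rw [hdd, hconst, ← cfc_add ..]
        refine cfc_mono fun x hx => ?_
        grind
    rw [hee, ← cfc_const_zero ℝ q, cfc_eq_cfc_iff_eqOn (ha := hq.isSelfAdjoint)] at h0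
    exact fun x hx => h0 hx
  have hxt : ∀ x ∈ spectrum ℝ q, x * x = t * x := by
    intro x hx
    have h0 := hspec0 x hx
    have h1 := hspect x hx
    rcases h0.eq_or_lt with h | h
    · simp [← h]
    rcases h1.eq_or_lt with h' | h'
    · simp [h']
    have := key ((max x (t / 2) + t) / 2) (by grind) (by grind) x hx
    grind
  conv_lhs => rw [hid]
  conv_rhs => rw [hid]
  rw [← cfc_mul .., ← cfc_const_mul ..]
  exact cfc_congr hxt

end

section

variable {A B : Type*} [CStarAlgebra A] [PartialOrder A] [StarOrderedRing A]
  [CStarAlgebra B] [PartialOrder B] [StarOrderedRing B]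

/-- An order isomorphism between the positive cones of two unital C⋆-algebras which fixes the
nonnegative multiples of the unit. -/
structure IsScalarFixingOrderIso (ψ : A → B) : Prop where
  nonneg : ∀ a, 0 ≤ a → 0 ≤ ψ a
  surj : ∀ b, 0 ≤ b → ∃ a, 0 ≤ a ∧ ψ a = b
  le_iff : ∀ a b, 0 ≤ a → 0 ≤ b → (ψ a ≤ ψ b ↔ a ≤ b)
  map_smul_one : ∀ t : ℝ, 0 ≤ t → ψ (t • 1) = t • 1

namespace IsScalarFixingOrderIso

variable {ψ : A → B} (hψ : IsScalarFixingOrderIso ψ)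

include hψ

omit [StarOrderedRing B] in
lemma le_smul_one_iff {a : A} {t : ℝ} (ha : 0 ≤ a) (ht : 0 ≤ t) : ψ a ≤ t • 1 ↔ a ≤ t • 1 := by
  rw [← hψ.map_smul_one t ht, hψ.le_iff a _ ha (smul_nonneg ht zero_le_one)]

omit [StarOrderedRing B] in
lemma map_eq_zero_iff {a : A} (ha : 0 ≤ a) : ψ a = 0 ↔ a = 0 := by
  have h := hψ.le_smul_one_iff ha le_rfl
  rw [zero_smul, zero_smul] at h
  exact ⟨fun h0 => le_antisymm (h.1 h0.le) ha, fun h0 => le_antisymm (h.2 h0.le) (hψ.nonneg a ha)⟩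

lemma isStarProjection_inv_smul {P : A} (hP : IsStarProjection P) {t : ℝ} (ht : 0 < t) :
    IsStarProjection (t⁻¹ • ψ (t • P)) := by
  have hle : ∀ {E : A}, IsStarProjection E → ∀ s : ℝ, 0 ≤ s → s • E ≤ s • 1 := fun hE s hs =>
    smul_le_smul_of_nonneg_left hE.le_one hs
  have hnn : ∀ {E : A}, IsStarProjection E → ∀ s : ℝ, 0 ≤ s → 0 ≤ s • E := fun hE s hs =>
    smul_nonneg hs hE.nonneg
  have hq := hψ.nonneg _ (hnn hP t ht.le)
  have hsq : ψ (t • P) * ψ (t • P) = t • ψ (t • P) := by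
    refine mul_self_eq_smul_of_inf_of_compl (p := ψ (t • (1 - P))) ht hq
      ((hψ.le_smul_one_iff (hnn hP t ht.le) ht.le).2 (hle hP t ht.le))
      (hψ.nonneg _ (hnn hP.one_sub t ht.le))
      ((hψ.le_smul_one_iff (hnn hP.one_sub t ht.le) ht.le).2 (hle hP.one_sub t ht.le))
      ?_ ?_ ?_
    · intro r hr hrt
      refine ⟨ψ (r • P), hψ.nonneg _ (hnn hP r hr.le),
        (hψ.le_iff _ _ (hnn hP r hr.le) (hnn hP t ht.le)).2
          (smul_le_smul_of_nonneg_right hrt.le hP.nonneg),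
        (hψ.le_smul_one_iff (hnn hP r hr.le) hr.le).2 (hle hP r hr.le), fun n hn h1 h2 => ?_⟩
      obtain ⟨a, ha, rfl⟩ := hψ.surj n hn
      rw [hψ.le_iff _ _ ha (hnn hP t ht.le)] at h1
      rw [hψ.le_smul_one_iff ha hr.le] at h2
      rw [hψ.le_iff _ _ ha (hnn hP r hr.le)]
      exact le_smul_of_le_smul_of_le hP ht ha h1 h2
    · intro x hx h1 h2
      obtain ⟨a, ha, rfl⟩ := hψ.surj x hx
      rw [hψ.le_iff _ _ ha (hnn hP t ht.le)] at h1
      rw [hψ.le_iff _ _ ha (hnn hP.one_sub t ht.le)] at h2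
      rw [hψ.map_eq_zero_iff ha]
      exact eq_zero_of_le_smul_of_le_smul_one_sub hP ht ha h1 h2
    · intro y hyt h1 h2
      obtain ⟨a, ha, rfl⟩ := hψ.surj y (hq.trans h1)
      rw [hψ.le_smul_one_iff ha ht.le] at hyt
      rw [hψ.le_iff _ _ (hnn hP t ht.le) ha] at h1
      rw [hψ.le_iff _ _ (hnn hP.one_sub t ht.le) ha] at h2
      have h3 : t • 1 - a = 0 := by
        refine eq_zero_of_le_smul_of_le_smul_one_sub hP ht (sub_nonneg.2 hyt) ?_ ?_
        · rw [smul_sub] at h2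
          exact sub_le_comm.1 h2
        · rw [smul_sub]
          exact sub_le_sub_left h1 _
      rw [← sub_eq_zero.1 h3, hψ.map_smul_one t ht.le]
  refine ⟨?_, (IsSelfAdjoint.all _).smul hq.isSelfAdjoint⟩
  change t⁻¹ • ψ (t • P) * t⁻¹ • ψ (t • P) = _
  rw [smul_mul_smul_comm, hsq, smul_smul, mul_assoc, inv_mul_cancel₀ ht.ne', mul_one]

lemma map_smul {P : A} (hP : IsStarProjection P) {s : ℝ} (hs : 1 ≤ s) :
    ψ (s • P) = s • ψ P := by
  have hs0 : 0 < s := by linarith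
  have hE : IsStarProjection (ψ P) := by
    simpa using hψ.isStarProjection_inv_smul hP one_pos
  have hE' := hψ.isStarProjection_inv_smul hP hs0
  have hsP := smul_nonneg hs0.le hP.nonneg
  have hEs : ψ (s • P) = s • (s⁻¹ • ψ (s • P)) := by
    rw [smul_smul, mul_inv_cancel₀ hs0.ne', one_smul]
  set E' := s⁻¹ • ψ (s • P)
  have hone : ∀ {x : A}, 0 ≤ x → (ψ x ≤ 1 ↔ x ≤ (1 : ℝ) • 1) := fun hx => by
    have := hψ.le_smul_one_iff hx zero_le_one
    rwa [one_smul ℝ (1 : B)] at this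
  have h1 : ψ P ≤ E' := by
    have := le_smul_of_le_smul_of_le hE' hs0 hE.nonneg (t := 1) ?_ ?_
    · rwa [one_smul] at this
    · rw [← hEs, hψ.le_iff _ _ hP.nonneg hsP]
      have := smul_le_smul_of_nonneg_right hs hP.nonneg
      rwa [one_smul] at this
    · rw [one_smul]
      exact hE.le_one
  have h2 : E' ≤ ψ P := by
    obtain ⟨a, ha, hae⟩ := hψ.surj _ hE'.nonneg
    rw [← hae, hψ.le_iff _ _ ha hP.nonneg]
    have := le_smul_of_le_smul_of_le hP hs0 ha (t := 1) ?_ ?_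
    · rwa [one_smul] at this
    · rw [← hψ.le_iff _ _ ha hsP, hae, hEs]
      have := smul_le_smul_of_nonneg_right hs hE'.nonneg
      rwa [one_smul] at this
    · rw [← hone ha, hae]
      exact hE'.le_one
  rw [hEs, le_antisymm h1 h2]

end IsScalarFixingOrderIso

lemma nonneg_and_isUnit_of_smul_one_le {a : A} {t : ℝ} (ht : 0 < t) (h : t • 1 ≤ a) :
    0 ≤ a ∧ IsUnit a := by
  have h0 : (0 : A) ≤ t • 1 := smul_nonneg ht.le zero_le_one
  have hu : IsUnit (t • (1 : A)) := (isUnit_one).smul (Units.mk0 t ht.ne')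
  exact ⟨h0.trans h, CStarAlgebra.isUnit_of_le _ h (hu.isStrictlyPositive h0)⟩

end

/-- Let `φ : 𝒜⁺⁺ → ℬ⁺⁺` be a surjective norm preserving order isomorphism
between the positive definite cones of unital C*-algebras with `φ (t • 1) = t • 1` for all
`t > 0`.  Then for every projection `P ∈ 𝒜` and all `0 < ε₁ < ε₂` one has
`φ (P + ε₁ • 1) - ε₁ • 1 = φ (P + ε₂ • 1) - ε₂ • 1`; that is, the maps
`ψ_ε (a) = φ (a + ε • 1) - ε • 1` all agree on projections. -/
theorem stmt9 {A B : Type*} [CStarAlgebra A] [PartialOrder A] [StarOrderedRing A]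
    [CStarAlgebra B] [PartialOrder B] [StarOrderedRing B]
    (φ : A → B)
    (hmap : ∀ a : A, 0 ≤ a → IsUnit a → 0 ≤ φ a ∧ IsUnit (φ a))
    (hsurj : ∀ b : B, 0 ≤ b → IsUnit b → ∃ a : A, 0 ≤ a ∧ IsUnit a ∧ φ a = b)
    (hnorm : ∀ a : A, 0 ≤ a → IsUnit a → ‖φ a‖ = ‖a‖)
    (horder : ∀ a b : A, 0 ≤ a → IsUnit a → 0 ≤ b → IsUnit b → (a ≤ b ↔ φ a ≤ φ b))
    (hunit : ∀ t : ℝ, 0 < t → φ (t • (1 : A)) = t • (1 : B)) :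
    ∀ P : A, IsSelfAdjoint P → IsIdempotentElem P →
      ∀ ε₁ ε₂ : ℝ, 0 < ε₁ → ε₁ < ε₂ →
        φ (P + ε₁ • 1) - ε₁ • 1 = φ (P + ε₂ • 1) - ε₂ • 1 := by
  have hge : ∀ {a : A} {ε : ℝ}, 0 < ε → 0 ≤ a → 0 ≤ a + ε • 1 ∧ IsUnit (a + ε • 1) :=
    fun hε ha => nonneg_and_isUnit_of_smul_one_le hε (le_add_of_nonneg_left ha)
  have hiso : ∀ ε : ℝ, 0 < ε →
      IsScalarFixingOrderIso fun a : A => φ (a + ε • 1) - ε • 1 := by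
    intro ε hε
    have hunit' := nonneg_and_isUnit_of_smul_one_le (A := A) hε le_rfl
    refine ⟨fun a ha => ?_, fun b hb => ?_, fun a b ha hb => ?_, fun t ht => ?_⟩
    · rw [sub_nonneg, ← hunit ε hε,
        ← horder _ _ hunit'.1 hunit'.2 (hge hε ha).1 (hge hε ha).2]
      exact le_add_of_nonneg_left ha
    · obtain ⟨h1, h2⟩ := nonneg_and_isUnit_of_smul_one_le hε (le_add_of_nonneg_left hb)
      obtain ⟨a, ha, hau, hab⟩ := hsurj _ h1 h2
      refine ⟨a - ε • 1, ?_, ?_⟩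
      · rw [sub_nonneg, horder _ _ hunit'.1 hunit'.2 ha hau, hunit ε hε, hab]
        exact le_add_of_nonneg_left hb
      · simp [hab]
    · simp only [sub_le_sub_iff_right]
      rw [← horder _ _ (hge hε ha).1 (hge hε ha).2 (hge hε hb).1 (hge hε hb).2,
        add_le_add_iff_right]
    · rw [← add_smul, hunit _ (by linarith), add_smul, add_sub_cancel_right]
  intro P hPs hPi ε₁ ε₂ h1 h12
  have hP : IsStarProjection P := ⟨hPi, hPs⟩
  have h2 : 0 < ε₂ := h1.trans h12
  set s := 1 + ε₂ - ε₁ with hs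
  have hs1 : 1 ≤ s := by linarith
  have hs0 : 0 < s := by linarith
  set ψ₁ : A → B := fun a => φ (a + ε₁ • 1) - ε₁ • 1 with hψ₁
  set ψ₂ : A → B := fun a => φ (a + ε₂ • 1) - ε₂ • 1 with hψ₂
  have hi₁ : IsScalarFixingOrderIso ψ₁ := hiso ε₁ h1
  have hi₂ : IsScalarFixingOrderIso ψ₂ := hiso ε₂ h2
  have hE : IsStarProjection (ψ₁ P) := by
    simpa using hi₁.isStarProjection_inv_smul hP one_pos
  have hF : IsStarProjection (ψ₂ P) := by
    simpa using hi₂.isStarProjection_inv_smul hP one_pos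
  have hshift : ∀ a : A, ψ₂ a = ψ₁ (a + (s - 1) • 1) - (s - 1) • 1 := by
    intro a
    have h3 : a + (s - 1) • (1 : A) + ε₁ • 1 = a + ε₂ • 1 := by
      rw [add_assoc, ← add_smul]; congr 2; ring
    simp only [hψ₁, hψ₂, h3]
    rw [sub_sub, ← add_smul]; congr 2; ring
  have hsP := hi₁.map_smul hP hs1
  have hPδ : 0 ≤ P + (s - 1) • (1 : A) :=
    add_nonneg hP.nonneg (smul_nonneg (by linarith) zero_le_one)
  have hsPδ : s • P ≤ P + (s - 1) • 1 := by
    have := smul_nonneg (show 0 ≤ s - 1 by linarith) hP.one_sub_nonneg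
    rw [← sub_nonneg]
    convert this using 1
    module
  have hψPδ : ψ₁ (P + (s - 1) • 1) = ψ₂ P + (s - 1) • 1 := by rw [hshift]; abel
  change ψ₁ P = ψ₂ P
  refine le_antisymm ?_ ?_
  · have h3 : s • ψ₁ P ≤ ψ₂ P + (s - 1) • 1 := by
      rw [← hsP, ← hψPδ]
      exact (hi₁.le_iff _ _ (smul_nonneg hs0.le hP.nonneg) hPδ).2 hsPδ
    have h4 : 1 - ψ₂ P ≤ (1 : ℝ) • (1 - ψ₁ P) := by
      refine le_smul_of_le_smul_of_le hE.one_sub hs0 hF.one_sub_nonneg ?_ ?_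
      · rw [← sub_nonneg] at h3 ⊢
        convert h3 using 1
        module
      · rw [one_smul]
        exact hF.one_sub.le_one
    rw [one_smul] at h4
    exact (sub_le_sub_iff_left 1).1 h4
  · obtain ⟨x, hx, hxE⟩ := hi₁.surj (ψ₁ P + (s - 1) • 1)
      (add_nonneg hE.nonneg (smul_nonneg (by linarith) zero_le_one))
    have h3 : s • P ≤ x := by
      rw [← hi₁.le_iff _ _ (smul_nonneg hs0.le hP.nonneg) hx, hsP, hxE]
      have := smul_nonneg (show 0 ≤ s - 1 by linarith) hE.one_sub_nonneg
      rw [← sub_nonneg]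
      convert this using 1
      module
    have h4 : x ≤ s • 1 := by
      rw [← hi₁.le_smul_one_iff hx hs0.le, hxE]
      have := hE.one_sub_nonneg
      rw [← sub_nonneg]
      convert this using 1
      module
    have h5 : (s - 1) • 1 ≤ x := by
      rw [← hi₁.le_iff _ _ (smul_nonneg (by linarith) zero_le_one) hx,
        hi₁.map_smul_one _ (by linarith), hxE]
      exact le_add_of_nonneg_left hE.nonneg
    have h6 : s • 1 - x ≤ (1 : ℝ) • (1 - P) := by
      refine le_smul_of_le_smul_of_le hP.one_sub hs0 (sub_nonneg.2 h4) ?_ ?_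
      · rw [smul_sub]
        exact sub_le_sub_left h3 _
      · rw [← sub_nonneg] at h5 ⊢
        convert h5 using 1
        module
    have h7 : P + (s - 1) • 1 ≤ x := by
      rw [← sub_nonneg] at h6 ⊢
      convert h6 using 1
      module
    rw [← hi₁.le_iff _ _ hPδ hx, hxE, hψPδ] at h7
    exact (add_le_add_iff_right _).1 h7
end

section
/- Let 𝒜 and ℬ be unital C*-algebras. A map φ : 𝒜⁺⁺ → ℬ⁺⁺ is a surjective positive homogeneous order isomorphism (i.e. φ(tA) = tφ(A) for all A ∈ 𝒜⁺⁺ and t > 0) if and only if there exist C ∈ ℬ⁺⁺ and a Jordan *-isomorphism J : 𝒜 → ℬ such that φ(A) = C·J(A)·C for all A ∈ 𝒜⁺⁺. -/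
/-- The positive definite cone of an ordered algebra. -/
abbrev PosDefCone (A : Type*) [Monoid A] [Zero A] [LE A] := {a : A // IsStrictlyPositive a}

/-- A permutation preserving a multiplicative gauge `R` and fixing two points `a`, `b` also fixes
(up to the gauge) the centre `c` of any reflection `S` interchanging `a` and `b`. -/
lemma Equiv.Perm.rel_apply_center_of_reflection {X : Type*} {R : ℝ → X → X → Prop}
    (hmono : ∀ s t x y, s ≤ t → R s x y → R t x y)
    (htrans : ∀ s t x y z, 0 < s → 0 < t → R s x y → R t y z → R (s * t) x z)
    (hsymm : ∀ t x y, R t x y → R t y x)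
    {S : Equiv.Perm X} (hS : ∀ t x y, 0 < t → R t x y → R t (S x) (S y))
    (hSS : ∀ x, S (S x) = x) {a b c : X} (hSa : S a = b) (hSc : S c = c)
    (hSR : ∀ t x, 0 < t → R (t ^ 2) (S x) x → R t x c)
    {K : ℝ} (hK : 1 ≤ K) (hac : R K a c) {g : Equiv.Perm X}
    (hg : ∀ t x y, 0 < t → (R t (g x) (g y) ↔ R t x y)) (hga : g a = a) (hgb : g b = b)
    {t : ℝ} (ht : 1 < t) : R t (g c) c := by
  have hSb : S b = a := by rw [← hSa, hSS]
  have hK0 : 0 < K := by linarith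
  have key : ∀ n : ℕ, ∀ t : ℝ, 1 < t → K * K ≤ t ^ (2 ^ n) → ∀ g : Equiv.Perm X,
      (∀ t x y, 0 < t → (R t (g x) (g y) ↔ R t x y)) → g a = a → g b = b → R t (g c) c := by
    intro n
    induction n with
    | zero =>
      intro t ht hKt g hg hga hgb
      refine hmono (K * K) t _ _ (by simpa using hKt) ?_
      refine htrans _ _ _ a _ hK0 hK0 ?_ hac
      have := (hg K c a hK0).2 (hsymm _ _ _ hac)
      rwa [hga] at this
    | succ n ih =>
      intro t ht hKt g hg hga hgb
      have ht0 : 0 < t := by linarith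
      have hga' : g⁻¹ a = a := by rw [Equiv.Perm.inv_eq_iff_eq, hga]
      have hgb' : g⁻¹ b = b := by rw [Equiv.Perm.inv_eq_iff_eq, hgb]
      have hgi : ∀ t x y, 0 < t → (R t (g⁻¹ x) (g⁻¹ y) ↔ R t x y) := by
        intro t x y ht
        simpa using (hg t (g⁻¹ x) (g⁻¹ y) ht).symm
      have hSi : ∀ t x y, 0 < t → (R t (S x) (S y) ↔ R t x y) := fun t x y ht =>
        ⟨fun h => by simpa [hSS] using hS _ _ _ ht h, hS t x y ht⟩
      have h := ih (t ^ 2) (by nlinarith) (by rw [← pow_mul, ← pow_succ']; exact hKt)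
        (S * g⁻¹ * S * g)
        (by intro t x y ht; simp only [Equiv.Perm.mul_apply]
            rw [hSi _ _ _ ht, hgi _ _ _ ht, hSi _ _ _ ht, hg _ _ _ ht])
        (by rw [Equiv.Perm.mul_apply, Equiv.Perm.mul_apply, Equiv.Perm.mul_apply, hga, hSa, hgb',
              hSb])
        (by rw [Equiv.Perm.mul_apply, Equiv.Perm.mul_apply, Equiv.Perm.mul_apply, hgb, hSb, hga',
              hSa])
      have h1 := hS _ _ _ (by positivity) h
      simp only [Equiv.Perm.mul_apply, hSS, hSc] at h1
      have h2 := (hg _ _ _ (by positivity)).2 h1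
      rw [← Equiv.Perm.mul_apply g, mul_inv_cancel, Equiv.Perm.one_apply] at h2
      exact hSR _ _ ht0 h2
  obtain ⟨m, hm⟩ := pow_unbounded_of_one_lt (K * K) ht
  refine key m t ht (hm.le.trans ?_) g hg hga hgb
  exact pow_le_pow_right₀ ht.le Nat.lt_two_pow_self.le

lemma ringInverse_smul_of_pos {A : Type*} [Ring A] [Algebra ℝ A] {t : ℝ} (ht : 0 < t)
    {y : A} (hy : IsUnit y) :
    Ring.inverse (t • y) = t⁻¹ • Ring.inverse y := by
  lift y to Aˣ using hy
  have : t • (y : A) = ((Units.mk0 t ht.ne' • y : Aˣ) : A) := by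
    simp [Units.smul_def]
  rw [this, Ring.inverse_unit, Ring.inverse_unit]
  apply Units.inv_eq_of_mul_eq_one_right
  simp [Units.smul_def, ht.ne']

section Cone

variable {A B : Type*} [CStarAlgebra A] [PartialOrder A] [StarOrderedRing A]
  [CStarAlgebra B] [PartialOrder B] [StarOrderedRing B]

/-- The relation `x ≤ t y` and `y ≤ t x`, that is, the closed ball of radius `log t` for
the Thompson metric. -/
def ThompsonRel (t : ℝ) (x y : PosDefCone A) : Prop :=
  (x : A) ≤ t • (y : A) ∧ (y : A) ≤ t • (x : A)

namespace ThompsonRel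

omit [StarOrderedRing A] in
lemma symm {t : ℝ} {x y : PosDefCone A} (h : ThompsonRel t x y) : ThompsonRel t y x := ⟨h.2, h.1⟩

lemma mono {s t : ℝ} {x y : PosDefCone A} (hst : s ≤ t) (h : ThompsonRel s x y) :
    ThompsonRel t x y :=
  ⟨h.1.trans (smul_le_smul_of_nonneg_right hst y.2.nonneg),
    h.2.trans (smul_le_smul_of_nonneg_right hst x.2.nonneg)⟩

lemma trans {s t : ℝ} {x y z : PosDefCone A} (hs : 0 < s) (ht : 0 < t) (h : ThompsonRel s x y)
    (h' : ThompsonRel t y z) : ThompsonRel (s * t) x z := by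
  constructor
  · rw [mul_smul]
    exact h.1.trans (smul_le_smul_of_nonneg_left h'.1 hs.le)
  · rw [mul_comm, mul_smul]
    exact h'.2.trans (smul_le_smul_of_nonneg_left h.2 ht.le)

lemma eq_of_forall_one_lt {x y : PosDefCone A} (h : ∀ t : ℝ, 1 < t → ThompsonRel t x y) :
    x = y := by
  have aux : ∀ u v : A, (∀ t : ℝ, 1 < t → u ≤ t • v) → u ≤ v := by
    intro u v huv
    have hc : Filter.Tendsto (fun t : ℝ => t • v) (nhdsWithin 1 (Set.Ioi 1)) (nhds ((1 : ℝ) • v)) :=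
      ((continuous_id.smul continuous_const).tendsto 1).mono_left nhdsWithin_le_nhds
    rw [one_smul] at hc
    exact ge_of_tendsto hc (eventually_nhdsWithin_of_forall fun t ht => huv t ht)
  exact Subtype.ext (le_antisymm (aux _ _ fun t ht => (h t ht).1) (aux _ _ fun t ht => (h t ht).2))

end ThompsonRel

lemma IsStrictlyPositive.exists_le_smul {x y : A} (hx : IsStrictlyPositive x)
    (hy : IsStrictlyPositive y) : ∃ K : ℝ, 0 < K ∧ x ≤ K • y := by
  obtain ⟨r, hr, h⟩ : ∃ r : ℝ, 0 < r ∧ algebraMap ℝ A r ≤ y := by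
    by_cases! hA : Nontrivial A
    · obtain ⟨r, hr, h⟩ := (CFC.exists_pos_algebraMap_le_iff hy.isSelfAdjoint).2
        fun z hz => hy.spectrum_pos hz
      exact ⟨r, hr, h⟩
    · exact ⟨1, one_pos, (Subsingleton.elim _ _).le⟩
  refine ⟨(‖x‖ + 1) * r⁻¹, by positivity, ?_⟩
  calc x ≤ algebraMap ℝ A ‖x‖ := hx.isSelfAdjoint.le_algebraMap_norm_self
    _ ≤ algebraMap ℝ A (‖x‖ + 1) := by
      simp only [Algebra.algebraMap_eq_smul_one]
      exact smul_le_smul_of_nonneg_right (by linarith) zero_le_one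
    _ = ((‖x‖ + 1) * r⁻¹) • algebraMap ℝ A r := by
      simp only [Algebra.algebraMap_eq_smul_one, smul_smul]
      congr 1
      field_simp
    _ ≤ _ := smul_le_smul_of_nonneg_left h (by positivity)

lemma ThompsonRel.exists_bound (x y : PosDefCone A) : ∃ K : ℝ, 1 ≤ K ∧ ThompsonRel K x y := by
  obtain ⟨K₁, -, h₁⟩ := x.2.exists_le_smul y.2
  obtain ⟨K₂, -, h₂⟩ := y.2.exists_le_smul x.2
  exact ⟨max 1 (max K₁ K₂), le_max_left _ _,
    h₁.trans (smul_le_smul_of_nonneg_right (by simp) y.2.nonneg),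
    h₂.trans (smul_le_smul_of_nonneg_right (by simp) x.2.nonneg)⟩

namespace PosDefCone

/-- The inversion of the positive definite cone about the point `c`, that is
`x ↦ c * x⁻¹ * c`. -/
noncomputable def reflection (c : PosDefCone A) : Equiv.Perm (PosDefCone A) :=
  Function.Involutive.toPerm
    (fun x => ⟨c * Ring.inverse (x : A) * c,
      IsStrictlyPositive.conjugate_of_isUnit_of_isSelfAdjoint _ _ c.2.isUnit c.2.isSelfAdjoint
        x.2.ringInverse⟩) <| by
    rintro ⟨x, hx⟩
    obtain ⟨c, hc⟩ := c
    obtain ⟨c, rfl⟩ := hc.isUnit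
    obtain ⟨x, rfl⟩ := hx.isUnit
    ext
    simp only [Ring.inverse_unit, ← Units.val_mul, mul_inv_rev, inv_inv]
    simp [mul_assoc]

@[simp] lemma coe_reflection (c x : PosDefCone A) :
    (reflection c x : A) = c * Ring.inverse (x : A) * c := rfl

lemma reflection_reflection (c x : PosDefCone A) : reflection c (reflection c x) = x :=
  (reflection c).symm_apply_apply x

@[simp] lemma reflection_self (c : PosDefCone A) : reflection c c = c := by
  ext
  simp [Ring.mul_inverse_cancel _ c.2.isUnit]

lemma thompsonRel_reflection (c : PosDefCone A) {t : ℝ} (ht : 0 < t) {x y : PosDefCone A}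
    (h : ThompsonRel t x y) : ThompsonRel t (reflection c x) (reflection c y) := by
  have aux : ∀ x y : PosDefCone A, (x : A) ≤ t • (y : A) →
      (reflection c y : A) ≤ t • (reflection c x : A) := by
    intro x y hxy
    have h1 := CStarAlgebra.ringInverse_le_ringInverse hxy x.2
    rw [ringInverse_smul_of_pos ht y.2.isUnit] at h1
    have h2 := conjugate_le_conjugate_of_nonneg (smul_le_smul_of_nonneg_left h1 ht.le) c.2.nonneg
    simpa [smul_smul, ht.ne'] using h2
  exact ⟨aux _ _ h.2, aux _ _ h.1⟩

lemma thompsonRel_reflection_iff (c : PosDefCone A) {t : ℝ} (ht : 0 < t) {x y : PosDefCone A} :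
    ThompsonRel t (reflection c x) (reflection c y) ↔ ThompsonRel t x y := by
  refine ⟨fun h => ?_, thompsonRel_reflection c ht⟩
  simpa only [reflection_reflection] using thompsonRel_reflection c ht h

lemma thompsonRel_of_reflection (c : PosDefCone A) {t : ℝ} (ht : 0 < t) {x : PosDefCone A}
    (h : ThompsonRel (t ^ 2) (reflection c x) x) : ThompsonRel t x c := by
  obtain ⟨h1, h2⟩ := h
  obtain ⟨x, hx⟩ := x
  obtain ⟨c, hc⟩ := c
  simp only [coe_reflection] at h1 h2
  have hr : IsStrictlyPositive (CFC.sqrt x) := hx.sqrt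
  have hrr : CFC.sqrt x * CFC.sqrt x = x := CFC.sqrt_mul_sqrt_self x hx.nonneg
  obtain ⟨r, hru⟩ := hr.isUnit
  rw [← hru] at hr hrr
  have hxi : Ring.inverse x = (↑r⁻¹ : A) * ↑r⁻¹ := by
    rw [← hrr, ← Units.val_mul, Ring.inverse_unit, mul_inv_rev, Units.val_mul]
  have hri : 0 ≤ (↑r⁻¹ : A) := by
    have := hr.ringInverse.nonneg
    rwa [Ring.inverse_unit] at this
  have hz : 0 ≤ (↑r⁻¹ : A) * c * ↑r⁻¹ := conjugate_nonneg_of_nonneg hc.nonneg hri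
  have hone : (↑r⁻¹ : A) * x * ↑r⁻¹ = 1 := by rw [← hrr]; simp
  have hzz : (↑r⁻¹ : A) * (c * Ring.inverse x * c) * ↑r⁻¹
      = (↑r⁻¹ * c * ↑r⁻¹) * (↑r⁻¹ * c * ↑r⁻¹) := by
    rw [hxi]; simp [mul_assoc]
  have h1' := conjugate_le_conjugate_of_nonneg h1 hri
  have h2' := conjugate_le_conjugate_of_nonneg h2 hri
  simp only [mul_smul_comm, smul_mul_assoc, hone, hzz] at h1' h2'
  have back : ∀ u : A, (r : A) * (↑r⁻¹ * u * ↑r⁻¹) * r = u := fun u => by simp [mul_assoc]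
  generalize hzdef : (↑r⁻¹ : A) * c * ↑r⁻¹ = z at *
  have hs1 : z ≤ t • 1 := by
    have := CFC.sqrt_le_sqrt _ _ h1'
    rw [CFC.sqrt_mul_self z hz] at this
    have e : (t ^ 2) • (1 : A) = (t • 1) * (t • 1) := by simp [smul_smul, sq]
    rwa [e, CFC.sqrt_mul_self _ (smul_nonneg ht.le zero_le_one)] at this
  have hs2 : 1 ≤ t • z := by
    have := CFC.sqrt_le_sqrt _ _ h2'
    have e : (t ^ 2) • (z * z) = (t • z) * (t • z) := by simp [smul_smul, sq]
    rwa [e, CFC.sqrt_mul_self _ (smul_nonneg ht.le hz), CFC.sqrt_one] at this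
  have hzc : (r : A) * z * r = c := by rw [← hzdef, back]
  constructor
  · simpa [hrr, hzc] using conjugate_le_conjugate_of_nonneg hs2 hr.nonneg
  · simpa [hrr, hzc] using conjugate_le_conjugate_of_nonneg hs1 hr.nonneg

/-- A map between positive definite cones is positive homogeneous if it commutes with
multiplication by positive scalars. -/
def IsPosHomogeneous (f : PosDefCone A → PosDefCone B) : Prop :=
  ∀ (t : ℝ) (x y : PosDefCone A), 0 < t → (y : A) = t • (x : A) → (f y : B) = t • (f x : B)

omit [StarOrderedRing B] in
lemma IsPosHomogeneous.symm {Φ : PosDefCone A ≃o PosDefCone B} (hΦ : IsPosHomogeneous Φ) :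
    IsPosHomogeneous Φ.symm := by
  intro t x y ht hxy
  have h := hΦ t (Φ.symm x) ⟨t • (Φ.symm x : A), (Φ.symm x).2.smul ht⟩ ht rfl
  rw [Φ.apply_symm_apply, ← hxy] at h
  rw [← Subtype.ext h, Φ.symm_apply_apply]

omit [StarOrderedRing B] in
lemma IsPosHomogeneous.thompsonRel_iff {Φ : PosDefCone A ≃o PosDefCone B}
    (hΦ : IsPosHomogeneous Φ) {t : ℝ} (ht : 0 < t) (x y : PosDefCone A) :
    ThompsonRel t (Φ x) (Φ y) ↔ ThompsonRel t x y := by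
  have aux : ∀ x y : PosDefCone A, (Φ x : B) ≤ t • (Φ y : B) ↔ (x : A) ≤ t • (y : A) := by
    intro x y
    have h := hΦ t y ⟨t • (y : A), y.2.smul ht⟩ ht rfl
    rw [← h]
    exact Φ.le_iff_le (x := x) (y := ⟨t • (y : A), y.2.smul ht⟩)
  exact and_congr (aux x y) (aux y x)

/-- A unital positive homogeneous order isomorphism of positive definite cones preserves
squares. -/
theorem IsPosHomogeneous.map_mul_self {Φ : PosDefCone A ≃o PosDefCone B}
    (hΦ : IsPosHomogeneous Φ) (h1 : ∀ x : PosDefCone A, (x : A) = 1 → (Φ x : B) = 1)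
    (c d : PosDefCone A) (hd : (d : A) = c * c) : (Φ d : B) = Φ c * Φ c := by
  set e : PosDefCone A := ⟨1, isStrictlyPositive_one⟩ with he
  set e' : PosDefCone B := ⟨1, isStrictlyPositive_one⟩ with he'
  have hΦe : Φ e = e' := Subtype.ext (h1 e rfl)
  set c' : PosDefCone B := ⟨CFC.sqrt (Φ d : B), (Φ d).2.sqrt⟩ with hc'
  have hc'd : (c' : B) * c' = Φ d := CFC.sqrt_mul_sqrt_self _ (Φ d).2.nonneg
  have hSe : reflection c e = d := by ext; simp [he, hd]
  have hSe' : reflection c' e' = Φ d := by ext; simp [he', hc'd]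
  have hSd : reflection c d = e := by rw [← hSe, reflection_reflection]
  have hSd' : reflection c' (Φ d) = e' := by rw [← hSe', reflection_reflection]
  have hΦe' : Φ.symm e' = e := by rw [← hΦe, Φ.symm_apply_apply]
  obtain ⟨K, hK, hKec⟩ := ThompsonRel.exists_bound e c
  let g : Equiv.Perm (PosDefCone A) :=
    ((Φ.toEquiv.trans (reflection c')).trans Φ.symm.toEquiv).trans (reflection c)
  have hgapp : ∀ x, g x = reflection c (Φ.symm (reflection c' (Φ x))) := fun x => rfl
  have hgc : g c = c := ThompsonRel.eq_of_forall_one_lt fun t ht =>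
    Equiv.Perm.rel_apply_center_of_reflection (R := ThompsonRel)
      (fun _ _ _ _ h h' => h'.mono h) (fun _ _ _ _ _ hs ht h h' => h.trans hs ht h')
      (fun _ _ _ h => h.symm) (fun _ _ _ ht h => thompsonRel_reflection c ht h)
      (reflection_reflection c) hSe (reflection_self c)
      (fun _ _ ht h => thompsonRel_of_reflection c ht h) hK hKec
      (fun t x y ht => by
        rw [hgapp, hgapp, thompsonRel_reflection_iff c ht, hΦ.symm.thompsonRel_iff ht,
          thompsonRel_reflection_iff c' ht, hΦ.thompsonRel_iff ht])
      (by rw [hgapp, hΦe, hSe', Φ.symm_apply_apply, hSd])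
      (by rw [hgapp, hSd', hΦe', hSe]) ht
  have h3 : reflection c' (Φ c) = Φ c := by
    rw [hgapp] at hgc
    have := congrArg (reflection c) hgc
    rw [reflection_reflection, reflection_self] at this
    rw [Φ.symm_apply_eq] at this
    exact this
  have h4 : Φ c = c' := ThompsonRel.eq_of_forall_one_lt fun t ht => by
    refine thompsonRel_of_reflection c' (by linarith) ?_
    rw [h3]
    refine ThompsonRel.mono (s := 1) (by nlinarith) ?_
    exact ⟨by simp, by simp⟩
  rw [h4, hc'd]

end PosDefCone

end Cone

section Exponential

open Filter Topology

variable {A B : Type*} [CStarAlgebra A] [PartialOrder A] [StarOrderedRing A]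
  [CStarAlgebra B] [PartialOrder B] [StarOrderedRing B]

lemma IsSelfAdjoint.norm_le_of_neg_le_of_le {x : A} (hx : IsSelfAdjoint x) {r : ℝ} (hr : 0 ≤ r)
    (h₁ : -(r • (1 : A)) ≤ x) (h₂ : x ≤ r • (1 : A)) : ‖x‖ ≤ r := by
  rw [← Algebra.algebraMap_eq_smul_one] at h₁ h₂
  rw [← map_neg, algebraMap_le_iff_le_spectrum hx] at h₁
  rw [le_algebraMap_iff_spectrum_le] at h₂
  rw [← cfc_id ℝ x hx]
  exact norm_cfc_le hr fun t ht => abs_le.2 ⟨h₁ t ht, h₂ t ht⟩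

lemma IsSelfAdjoint.le_smul_one_of_norm_le {x : A} (hx : IsSelfAdjoint x) {r : ℝ}
    (hr : ‖x‖ ≤ r) : x ≤ r • (1 : A) := by
  have := hx.le_algebraMap_norm_self
  rw [Algebra.algebraMap_eq_smul_one] at this
  exact this.trans (smul_le_smul_of_nonneg_right hr zero_le_one)

lemma IsSelfAdjoint.neg_smul_one_le_of_norm_le {x : A} (hx : IsSelfAdjoint x) {r : ℝ}
    (hr : ‖x‖ ≤ r) : -(r • (1 : A)) ≤ x :=
  neg_le.1 (hx.neg.le_smul_one_of_norm_le (by rwa [norm_neg]))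

lemma isStrictlyPositive_iff_exists_smul_one_le {x : A} :
    IsStrictlyPositive x ↔ ∃ r : ℝ, 0 < r ∧ r • (1 : A) ≤ x := by
  constructor
  · intro h
    obtain ⟨K, hK, h⟩ := isStrictlyPositive_one.exists_le_smul h
    refine ⟨K⁻¹, by positivity, ?_⟩
    have := smul_le_smul_of_nonneg_left h (inv_nonneg.2 hK.le)
    rwa [smul_smul, inv_mul_cancel₀ hK.ne', one_smul] at this
  · rintro ⟨r, hr, h⟩
    exact (isStrictlyPositive_one.smul hr).of_le h

omit [PartialOrder A] [StarOrderedRing A] in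
lemma NormedSpace.tendsto_two_pow_smul_exp_sub_one (x : A) :
    Tendsto (fun n : ℕ => (2 : ℝ) ^ n • (NormedSpace.exp (((2 : ℝ) ^ n)⁻¹ • x) - 1)) atTop
      (𝓝 x) := by
  have h := hasDerivAt_exp_smul_const (𝕂 := ℝ) x 0
  rw [hasDerivAt_iff_tendsto_slope_zero] at h
  have h2 : Tendsto (fun n : ℕ => ((2 : ℝ) ^ n)⁻¹) atTop (𝓝[≠] 0) := by
    rw [tendsto_nhdsWithin_iff]
    refine ⟨?_, .of_forall fun n => by simp⟩
    exact (tendsto_pow_atTop_atTop_of_one_lt (by norm_num : (1 : ℝ) < 2)).inv_tendsto_atTop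
  have h3 := h.comp h2
  simpa [Function.comp_def] using h3

lemma NormedSpace.eventually_exp_le_exp {x y : A} (hx : IsSelfAdjoint x) (hy : IsSelfAdjoint y)
    {r : ℝ} (hr : 0 < r) (h : x + r • (1 : A) ≤ y) :
    ∀ᶠ n : ℕ in atTop,
      NormedSpace.exp (((2 : ℝ) ^ n)⁻¹ • x) ≤ NormedSpace.exp (((2 : ℝ) ^ n)⁻¹ • y) := by
  have hlim := (tendsto_two_pow_smul_exp_sub_one y).sub (tendsto_two_pow_smul_exp_sub_one x)
  filter_upwards [Metric.tendsto_nhds.1 hlim r hr] with n hn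
  rw [dist_eq_norm, ← smul_sub, sub_sub_sub_cancel_right] at hn
  have hs : ∀ z : A, IsSelfAdjoint z → IsSelfAdjoint (NormedSpace.exp (((2 : ℝ) ^ n)⁻¹ • z)) :=
    fun z hz => ((IsSelfAdjoint.all _).smul hz).exp
  have hsa : IsSelfAdjoint ((2 : ℝ) ^ n • (NormedSpace.exp (((2 : ℝ) ^ n)⁻¹ • y) -
      NormedSpace.exp (((2 : ℝ) ^ n)⁻¹ • x)) - (y - x)) :=
    ((IsSelfAdjoint.all _).smul ((hs y hy).sub (hs x hx))).sub (hy.sub hx)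
  have h1 := hsa.neg_smul_one_le_of_norm_le hn.le
  have h2 : 0 ≤ (2 : ℝ) ^ n • (NormedSpace.exp (((2 : ℝ) ^ n)⁻¹ • y) -
      NormedSpace.exp (((2 : ℝ) ^ n)⁻¹ • x)) := by
    rw [le_sub_iff_add_le] at h1
    refine le_trans ?_ h1
    rw [neg_add_eq_sub, sub_sub, sub_nonneg]
    exact h
  have h3 := smul_nonneg (show (0 : ℝ) ≤ ((2 : ℝ) ^ n)⁻¹ by positivity) h2
  rw [smul_smul, inv_mul_cancel₀ (by positivity), one_smul, sub_nonneg] at h3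
  exact h3

lemma NormedSpace.le_of_eventually_exp_le_exp {x y : A}
    (h : ∀ᶠ n : ℕ in atTop,
      NormedSpace.exp (((2 : ℝ) ^ n)⁻¹ • x) ≤ NormedSpace.exp (((2 : ℝ) ^ n)⁻¹ • y)) : x ≤ y := by
  refine le_of_tendsto_of_tendsto (tendsto_two_pow_smul_exp_sub_one x)
    (tendsto_two_pow_smul_exp_sub_one y) ?_
  filter_upwards [h] with n hn
  exact smul_le_smul_of_nonneg_left (sub_le_sub_right hn 1) (by positivity)

namespace PosDefCone

lemma isStrictlyPositive_exp {x : A} (hx : IsSelfAdjoint x) :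
    IsStrictlyPositive (NormedSpace.exp x) := by
  let _ : NormedAlgebra ℚ A := .restrictScalars ℚ ℝ A
  exact (NormedSpace.isUnit_exp x).isStrictlyPositive hx.exp_nonneg

/-- The exponential map as a bijection from the self-adjoint elements to the positive definite
cone. -/
noncomputable def expEquiv (A : Type*) [CStarAlgebra A] [PartialOrder A] [StarOrderedRing A] :
    selfAdjoint A ≃ PosDefCone A where
  toFun x := ⟨NormedSpace.exp (x : A), isStrictlyPositive_exp x.2⟩
  invFun a := ⟨CFC.log (a : A), IsSelfAdjoint.log⟩
  left_inv x := Subtype.ext (CFC.log_exp (x : A) x.2)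
  right_inv a := Subtype.ext (CFC.exp_log (a : A) a.2)

@[simp] lemma coe_expEquiv (x : selfAdjoint A) :
    (expEquiv A x : A) = NormedSpace.exp (x : A) := rfl

lemma expEquiv_add_smul_one (x : selfAdjoint A) (r : ℝ) :
    (expEquiv A (x + r • 1) : A) = Real.exp r • (expEquiv A x : A) := by
  let _ : NormedAlgebra ℚ A := .restrictScalars ℚ ℝ A
  have hc : NormedSpace.exp (r • (1 : A)) = Real.exp r • (1 : A) := by
    rw [← Algebra.algebraMap_eq_smul_one, ← NormedSpace.algebraMap_exp_comm,
      Real.exp_eq_exp_ℝ, Algebra.algebraMap_eq_smul_one]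
  simp only [coe_expEquiv, AddSubgroup.coe_add, selfAdjoint.val_smul, selfAdjoint.val_one]
  rw [NormedSpace.exp_add_of_commute ((Commute.one_right _).smul_right r), hc]
  simp

lemma coe_expEquiv_two_nsmul (x : selfAdjoint A) :
    (expEquiv A (2 • x) : A) = expEquiv A x * expEquiv A x := by
  let _ : NormedAlgebra ℚ A := .restrictScalars ℚ ℝ A
  rw [coe_expEquiv, AddSubgroup.coe_nsmul, NormedSpace.exp_nsmul, sq, coe_expEquiv]

/-- The map between self-adjoint parts obtained from a map between positive definite cones by
conjugating with the exponential maps. -/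
noncomputable def logConj (Φ : PosDefCone A ≃o PosDefCone B) : selfAdjoint A ≃ selfAdjoint B :=
  ((expEquiv A).trans Φ.toEquiv).trans (expEquiv B).symm

lemma expEquiv_logConj (Φ : PosDefCone A ≃o PosDefCone B) (x : selfAdjoint A) :
    expEquiv B (logConj Φ x) = Φ (expEquiv A x) := by
  simp [logConj]

lemma logConj_symm (Φ : PosDefCone A ≃o PosDefCone B) : (logConj Φ).symm = logConj Φ.symm := rfl

/-- A positive homogeneous order isomorphism of positive definite cones is unital if it maps
the unit to the unit. -/
def IsUnital (Φ : PosDefCone A ≃o PosDefCone B) : Prop :=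
  ∀ x : PosDefCone A, (x : A) = 1 → (Φ x : B) = 1

omit [StarOrderedRing B] in
lemma IsUnital.symm {Φ : PosDefCone A ≃o PosDefCone B} (h : IsUnital Φ) : IsUnital Φ.symm := by
  intro x hx
  have h1 := h ⟨1, isStrictlyPositive_one⟩ rfl
  have : x = Φ ⟨1, isStrictlyPositive_one⟩ := Subtype.ext (hx.trans h1.symm)
  rw [this, Φ.symm_apply_apply]

section

variable {Φ : PosDefCone A ≃o PosDefCone B} (hΦ : IsPosHomogeneous Φ) (h1 : IsUnital Φ)
include hΦ h1

lemma logConj_two_nsmul (x : selfAdjoint A) : logConj Φ (2 • x) = 2 • logConj Φ x := by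
  apply (expEquiv B).injective
  ext
  rw [expEquiv_logConj, hΦ.map_mul_self h1 _ _ (coe_expEquiv_two_nsmul x),
    coe_expEquiv_two_nsmul, expEquiv_logConj]

lemma logConj_two_pow_inv_smul (n : ℕ) (x : selfAdjoint A) :
    logConj Φ (((2 : ℝ) ^ n)⁻¹ • x) = ((2 : ℝ) ^ n)⁻¹ • logConj Φ x := by
  induction n generalizing x with
  | zero => simp
  | succ n ih =>
    have h := logConj_two_nsmul hΦ h1 (((2 : ℝ) ^ (n + 1))⁻¹ • x)
    have e : (2 : ℝ) * ((2 : ℝ) ^ (n + 1))⁻¹ = ((2 : ℝ) ^ n)⁻¹ := by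
      rw [pow_succ]
      field_simp
    rw [← ofNat_smul_eq_nsmul ℝ, ← ofNat_smul_eq_nsmul ℝ, smul_smul, e, ih] at h
    rw [← e, mul_smul] at h
    exact (smul_right_injective _ (two_ne_zero' ℝ) h).symm

omit h1 in
lemma logConj_add_smul_one (x : selfAdjoint A) (r : ℝ) :
    logConj Φ (x + r • 1) = logConj Φ x + r • 1 := by
  apply (expEquiv B).injective
  rw [expEquiv_logConj]
  ext
  rw [expEquiv_add_smul_one, expEquiv_logConj]
  exact hΦ _ _ _ (Real.exp_pos r) (expEquiv_add_smul_one x r)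

lemma logConj_mono {x y : selfAdjoint A} (h : x ≤ y) : logConj Φ x ≤ logConj Φ y := by
  have aux : ∀ {x y : selfAdjoint A} {r : ℝ}, 0 < r → x + r • 1 ≤ y →
      logConj Φ x ≤ logConj Φ y := by
    intro x y r hr h
    have h' : (x : A) + r • (1 : A) ≤ y := h
    refine NormedSpace.le_of_eventually_exp_le_exp (A := B) ?_
    filter_upwards [NormedSpace.eventually_exp_le_exp x.2 y.2 hr h'] with n hn
    have h2 : expEquiv A (((2 : ℝ) ^ n)⁻¹ • x) ≤ expEquiv A (((2 : ℝ) ^ n)⁻¹ • y) := hn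
    rw [← Φ.le_iff_le, ← expEquiv_logConj, ← expEquiv_logConj, logConj_two_pow_inv_smul hΦ h1,
      logConj_two_pow_inv_smul hΦ h1] at h2
    exact h2
  have h2 : ∀ r : ℝ, 0 < r → (logConj Φ x : B) ≤ logConj Φ y + r • (1 : B) := by
    intro r hr
    have h3 := aux hr (show x + r • 1 ≤ y + r • 1 from by gcongr)
    rw [logConj_add_smul_one hΦ] at h3
    exact h3
  have hc : Tendsto (fun r : ℝ => (logConj Φ y : B) + r • (1 : B)) (𝓝[>] 0)
      (𝓝 ((logConj Φ y : B) + (0 : ℝ) • (1 : B))) :=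
    ((continuous_const.add (continuous_id.smul continuous_const)).tendsto 0).mono_left
      nhdsWithin_le_nhds
  rw [zero_smul, add_zero] at hc
  exact ge_of_tendsto (a := (logConj Φ y : B)) hc
    (eventually_nhdsWithin_of_forall fun r hr => h2 r hr)

lemma norm_logConj_sub_le (x y : selfAdjoint A) :
    ‖logConj Φ x - logConj Φ y‖ ≤ ‖x - y‖ := by
  have aux : ∀ x y : selfAdjoint A, logConj Φ x ≤ logConj Φ y + ‖x - y‖ • 1 := by
    intro x y
    rw [← logConj_add_smul_one hΦ]
    refine logConj_mono hΦ h1 ?_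
    rw [← sub_le_iff_le_add']
    exact (x - y).2.le_smul_one_of_norm_le le_rfl
  refine (logConj Φ x - logConj Φ y).2.norm_le_of_neg_le_of_le (norm_nonneg _) ?_ ?_
  · have h := aux y x
    rw [norm_sub_rev] at h
    rw [neg_le]
    have h' : logConj Φ y - logConj Φ x ≤ ‖x - y‖ • 1 := by rwa [sub_le_iff_le_add']
    rw [← neg_sub] at h'
    exact h'
  · have h' : logConj Φ x - logConj Φ y ≤ ‖x - y‖ • 1 := by
      rw [sub_le_iff_le_add']; exact aux x y
    exact h'

lemma exists_linearIsometryEquiv_logConj :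
    ∃ L : selfAdjoint A ≃ₗᵢ[ℝ] selfAdjoint B, ⇑L = logConj Φ := by
  have hiso : Isometry (logConj Φ) := Isometry.of_dist_eq fun x y => by
    rw [dist_eq_norm, dist_eq_norm]
    refine le_antisymm (norm_logConj_sub_le hΦ h1 x y) ?_
    have h := norm_logConj_sub_le hΦ.symm h1.symm (logConj Φ x) (logConj Φ y)
    simpa only [← logConj_symm, Equiv.symm_apply_apply] using h
  have h0 : logConj Φ 0 = 0 := by
    have := logConj_two_nsmul hΦ h1 0
    rw [smul_zero, two_nsmul] at this
    simpa using this
  exact ⟨(IsometryEquiv.mk (logConj Φ) hiso).toRealLinearIsometryEquivOfMapZero h0, rfl⟩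

end

end PosDefCone

end Exponential

section Jordan

open Complex ComplexStarModule

section Complexification

variable {A B : Type*} [AddCommGroup A] [Module ℂ A] [StarAddMonoid A] [StarModule ℂ A]
  [AddCommGroup B] [Module ℂ B] [StarAddMonoid B] [StarModule ℂ B]

/-- The complex-linear extension of a real-linear map between self-adjoint parts. -/
noncomputable def selfAdjoint.complexify (L : selfAdjoint A →ₗ[ℝ] selfAdjoint B) : A →ₗ[ℂ] B where
  toFun a := (L (ℜ a) : B) + I • (L (ℑ a) : B)
  map_add' a b := by
    simp only [map_add, AddSubgroup.coe_add, smul_add]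
    abel
  map_smul' z a := by
    conv_rhs => rw [RingHom.id_apply, ← re_add_im z]
    simp only [realPart_smul, imaginaryPart_smul, map_add, map_sub, map_smul,
      AddSubgroup.coe_add, AddSubgroup.coe_sub, selfAdjoint.val_smul, smul_add, add_smul,
      mul_smul, Complex.coe_smul, smul_comm I (_ : ℝ)]
    rw [smul_smul I I, I_mul_I]
    simp only [neg_smul, one_smul, smul_neg]
    abel

namespace selfAdjoint

lemma complexify_apply (L : selfAdjoint A →ₗ[ℝ] selfAdjoint B) (a : A) :
    complexify L a = (L (ℜ a) : B) + I • (L (ℑ a) : B) := rfl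

@[simp] lemma complexify_coe (L : selfAdjoint A →ₗ[ℝ] selfAdjoint B) (x : selfAdjoint A) :
    complexify L x = L x := by
  rw [complexify_apply, realPart_coe, x.2.imaginaryPart]
  simp

lemma complexify_star (L : selfAdjoint A →ₗ[ℝ] selfAdjoint B) (a : A) :
    complexify L (star a) = star (complexify L a) := by
  conv_lhs => rw [← realPart_add_I_smul_imaginaryPart a]
  rw [star_add, star_smul, star_val_eq, star_val_eq, map_add, map_smul, complexify_coe,
    complexify_coe, complexify_apply, star_add, star_smul, star_val_eq, star_val_eq]

lemma complexify_leftInverse {L : selfAdjoint A →ₗ[ℝ] selfAdjoint B}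
    {M : selfAdjoint B →ₗ[ℝ] selfAdjoint A} (h : Function.LeftInverse M L) :
    Function.LeftInverse (complexify M) (complexify L) := by
  intro a
  rw [complexify_apply L, map_add, map_smul, complexify_coe, complexify_coe, h, h,
    realPart_add_I_smul_imaginaryPart]

lemma bijective_complexify (L : selfAdjoint A ≃ₗ[ℝ] selfAdjoint B) :
    Function.Bijective (complexify (L : selfAdjoint A →ₗ[ℝ] selfAdjoint B)) :=
  ⟨(complexify_leftInverse (M := (L.symm : selfAdjoint B →ₗ[ℝ] selfAdjoint A))
      L.symm_apply_apply).injective,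
    (complexify_leftInverse (L := (L.symm : selfAdjoint B →ₗ[ℝ] selfAdjoint A))
      L.apply_symm_apply).surjective⟩

end selfAdjoint

end Complexification

section Ring

variable {A B : Type*} [Ring A] [Ring B]

/-- Polarisation: an additive map which is multiplicative on the squares of `a`, `b` and `a + b`
preserves the Jordan product of `a` and `b`. -/
lemma AddMonoidHom.map_jordan_of_map_mul_self (J : A →+ B) {a b : A}
    (ha : J (a * a) = J a * J a) (hb : J (b * b) = J b * J b)
    (hab : J ((a + b) * (a + b)) = J (a + b) * J (a + b)) :
    J (a * b + b * a) = J a * J b + J b * J a := by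
  have e : (a + b) * (a + b) = a * a + (a * b + b * a) + b * b := by noncomm_ring
  rw [e, map_add, map_add, ha, hb, map_add J a b] at hab
  have e2 : (J a + J b) * (J a + J b) = J a * J a + (J a * J b + J b * J a) + J b * J b := by
    noncomm_ring
  rw [e2] at hab
  exact add_left_cancel (add_right_cancel hab)

/-- A surjective Jordan homomorphism is unital when the codomain is free of additive 2-torsion. -/
lemma AddMonoidHom.map_one_of_map_jordan [IsAddTorsionFree B] (J : A →+ B)
    (hs : Function.Surjective J)
    (hJ : ∀ a b, J (a * b + b * a) = J a * J b + J b * J a) : J 1 = 1 := by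
  obtain ⟨a, ha⟩ := hs 1
  have h := hJ a 1
  rw [mul_one, one_mul, ha, one_mul, mul_one, map_add, ha, ← two_nsmul, ← two_nsmul] at h
  exact (nsmul_right_injective two_ne_zero h).symm

lemma AddMonoidHom.map_pow_of_map_jordan [IsAddTorsionFree B] (J : A →+ B) (h1 : J 1 = 1)
    (hJ : ∀ a b, J (a * b + b * a) = J a * J b + J b * J a) (a : A) (n : ℕ) :
    J (a ^ n) = J a ^ n := by
  induction n with
  | zero => simpa using h1
  | succ n ih =>
    have h := hJ (a ^ n) a
    rw [← pow_succ, ← pow_succ', ih, ← pow_succ, ← pow_succ', ← two_nsmul, ← two_nsmul,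
      map_nsmul] at h
    exact nsmul_right_injective two_ne_zero h

end Ring

variable {A B : Type*} [CStarAlgebra A] [PartialOrder A] [StarOrderedRing A]
  [CStarAlgebra B] [PartialOrder B] [StarOrderedRing B]

omit [PartialOrder A] [StarOrderedRing A] [PartialOrder B] [StarOrderedRing B] in
lemma selfAdjoint.complexify_map_jordan {L : selfAdjoint A →ₗ[ℝ] selfAdjoint B}
    (hL : ∀ x y : selfAdjoint A, (y : A) = x * x → (L y : B) = L x * L x) (a b : A) :
    complexify L (a * b + b * a) =
      complexify L a * complexify L b + complexify L b * complexify L a := by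
  let J : A →+ B := (complexify L).toAddMonoidHom
  have hJ : ∀ a, complexify L a = J a := fun _ => rfl
  have hsa : ∀ x : selfAdjoint A, J (x * x) = J x * J x := by
    intro x
    have hx : IsSelfAdjoint ((x : A) * x) := by
      rw [isSelfAdjoint_iff, star_mul, star_val_eq]
    have := hL x ⟨_, hx⟩ rfl
    rw [← complexify_coe, ← complexify_coe] at this
    exact this
  have hsq : ∀ a : A, J (a * a) = J a * J a := by
    intro a
    have h := J.map_jordan_of_map_mul_self (hsa (ℜ a)) (hsa (ℑ a)) (hsa (ℜ a + ℑ a))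
    have e : a * a = (ℜ a : A) * ℜ a - (ℑ a : A) * ℑ a +
        I • ((ℜ a : A) * ℑ a + (ℑ a : A) * ℜ a) := by
      conv_lhs => rw [← realPart_add_I_smul_imaginaryPart a]
      simp only [mul_add, add_mul, smul_mul_assoc, mul_smul_comm, smul_add, smul_smul, I_mul_I,
        neg_smul, one_smul]
      abel
    have e2 : J a = J (ℜ a) + I • J (ℑ a) := by
      conv_lhs => rw [← realPart_add_I_smul_imaginaryPart a]
      rw [← hJ, map_add, map_smul]
      rfl
    have e3 : ∀ b, J (I • b) = I • J b := fun b => map_smul (complexify L) I b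
    rw [e, map_add, map_sub, hsa, hsa, e3, h, e2]
    simp only [mul_add, add_mul, smul_mul_assoc, mul_smul_comm, smul_add, smul_smul, I_mul_I,
      neg_smul, one_smul]
    abel
  exact J.map_jordan_of_map_mul_self (hsq a) (hsq b) (hsq (a + b))

omit [PartialOrder A] [StarOrderedRing A] [PartialOrder B] [StarOrderedRing B] in
lemma LinearMap.map_exp_of_map_jordan (J : A →ₗ[ℂ] B) (hc : Continuous J) (h1 : J 1 = 1)
    (hJ : ∀ a b, J (a * b + b * a) = J a * J b + J b * J a) (a : A) :
    J (NormedSpace.exp a) = NormedSpace.exp (J a) := by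
  let _ : Module ℚ B := Module.compHom B (algebraMap ℚ ℂ)
  have : IsAddTorsionFree B := IsAddTorsionFree.of_module_rat B
  have h := (NormedSpace.exp_series_hasSum_exp' (𝕂 := ℂ) a).mapL (⟨J, hc⟩ : A →L[ℂ] B)
  refine h.unique ?_
  convert NormedSpace.exp_series_hasSum_exp' (𝕂 := ℂ) (J a) using 2 with n
  have := J.toAddMonoidHom.map_pow_of_map_jordan h1 hJ a n
  change J _ = _
  rw [map_smul]
  exact congrArg _ this

omit [PartialOrder A] [StarOrderedRing A] [PartialOrder B] [StarOrderedRing B] in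
lemma selfAdjoint.continuous_complexify {L : selfAdjoint A →ₗ[ℝ] selfAdjoint B}
    (hL : Continuous L) : Continuous (complexify L) := by
  have hre : Continuous (fun a : A => ℜ a) :=
    AddMonoidHomClass.continuous_of_bound (realPart (A := A)) 1 fun a => by
      simpa using realPart.norm_le a
  have him : Continuous (fun a : A => ℑ a) :=
    AddMonoidHomClass.continuous_of_bound (imaginaryPart (A := A)) 1 fun a => by
      simpa using imaginaryPart.norm_le a
  exact (continuous_subtype_val.comp (hL.comp hre)).add
    ((continuous_subtype_val.comp (hL.comp him)).const_smul I)

namespace PosDefCone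

/-- A unital linear order isomorphism between self-adjoint parts restricts to an order isomorphism
of the positive definite cones. -/
noncomputable def ofSelfAdjoint (L : selfAdjoint A ≃ₗ[ℝ] selfAdjoint B) (h1 : L 1 = 1)
    (hL : ∀ x y, L x ≤ L y ↔ x ≤ y) : PosDefCone A ≃o PosDefCone B where
  toFun x := ⟨L ⟨x, x.2.isSelfAdjoint⟩, by
    obtain ⟨r, hr, h⟩ := isStrictlyPositive_iff_exists_smul_one_le.1 x.2
    refine isStrictlyPositive_iff_exists_smul_one_le.2 ⟨r, hr, ?_⟩
    have := (hL (r • 1) ⟨x, x.2.isSelfAdjoint⟩).2 h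
    rw [map_smul, h1] at this
    exact this⟩
  invFun y := ⟨L.symm ⟨y, y.2.isSelfAdjoint⟩, by
    obtain ⟨r, hr, h⟩ := isStrictlyPositive_iff_exists_smul_one_le.1 y.2
    refine isStrictlyPositive_iff_exists_smul_one_le.2 ⟨r, hr, ?_⟩
    have h2 : L (r • 1) ≤ L (L.symm ⟨y, y.2.isSelfAdjoint⟩) := by
      rw [map_smul, h1, L.apply_symm_apply]
      exact h
    exact (hL _ _).1 h2⟩
  left_inv x := Subtype.ext <|
    congrArg (Subtype.val : selfAdjoint A → A) (L.symm_apply_apply ⟨x, x.2.isSelfAdjoint⟩)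
  right_inv y := Subtype.ext <|
    congrArg (Subtype.val : selfAdjoint B → B) (L.apply_symm_apply ⟨y, y.2.isSelfAdjoint⟩)
  map_rel_iff' := @fun x y => hL ⟨x, x.2.isSelfAdjoint⟩ ⟨y, y.2.isSelfAdjoint⟩

lemma coe_ofSelfAdjoint (L : selfAdjoint A ≃ₗ[ℝ] selfAdjoint B) (h1 : L 1 = 1)
    (hL : ∀ x y, L x ≤ L y ↔ x ≤ y) {x : PosDefCone A} {x' : selfAdjoint A}
    (hx : (x' : A) = x) : (ofSelfAdjoint L h1 hL x : B) = L x' := by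
  have : x' = ⟨x, x.2.isSelfAdjoint⟩ := Subtype.ext hx
  rw [this]
  rfl

end PosDefCone

/-- A unital linear order isomorphism between self-adjoint parts preserves squares. -/
lemma selfAdjoint.map_mul_self_of_orderIso (L : selfAdjoint A ≃ₗ[ℝ] selfAdjoint B)
    (h1 : L 1 = 1) (hL : ∀ x y, L x ≤ L y ↔ x ≤ y) (x y : selfAdjoint A)
    (hy : (y : A) = x * x) : (L y : B) = L x * L x := by
  have hΨ : PosDefCone.IsPosHomogeneous (PosDefCone.ofSelfAdjoint L h1 hL) := by
    intro t u v _ huv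
    rw [PosDefCone.coe_ofSelfAdjoint L h1 hL
      (x' := t • ⟨u, u.2.isSelfAdjoint⟩) huv.symm, map_smul]
    rfl
  have h1' : ∀ u : PosDefCone A, (u : A) = 1 → (PosDefCone.ofSelfAdjoint L h1 hL u : B) = 1 := by
    intro u hu
    rw [PosDefCone.coe_ofSelfAdjoint L h1 hL (x' := 1) hu.symm, h1]
    rfl
  have key : ∀ x y : selfAdjoint A, IsStrictlyPositive (x : A) → (y : A) = x * x →
      (L y : B) = L x * L x := by
    intro x y hx hy
    have hy' : IsStrictlyPositive (y : A) := by
      rw [hy]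
      simpa using IsStrictlyPositive.conjugate_of_isUnit_of_isSelfAdjoint (1 : A) x hx.isUnit x.2
        isStrictlyPositive_one
    have := hΨ.map_mul_self h1' ⟨x, hx⟩ ⟨y, hy'⟩ hy
    rwa [PosDefCone.coe_ofSelfAdjoint L h1 hL rfl, PosDefCone.coe_ofSelfAdjoint L h1 hL rfl] at this
  set r : ℝ := ‖(x : A)‖ + 1 with hr
  have hpos : IsStrictlyPositive ((x + r • 1 : selfAdjoint A) : A) := by
    refine isStrictlyPositive_iff_exists_smul_one_le.2 ⟨1, one_pos, ?_⟩
    have := x.2.neg_smul_one_le_of_norm_le le_rfl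
    rw [AddSubgroup.coe_add, selfAdjoint.val_smul, selfAdjoint.val_one, hr, add_smul,
      ← add_assoc]
    exact le_add_of_nonneg_left (by rwa [neg_le_iff_add_nonneg] at this)
  have h := key (x + r • 1) (y + (2 * r) • x + (r * r) • 1) hpos (by
    simp only [AddSubgroup.coe_add, selfAdjoint.val_smul, selfAdjoint.val_one, hy, mul_add,
      add_mul, smul_mul_assoc, mul_smul_comm, mul_one, one_mul, two_mul, add_smul, mul_smul,
      smul_add]
    abel)
  simp only [map_add, map_smul, h1, AddSubgroup.coe_add, selfAdjoint.val_smul,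
    selfAdjoint.val_one, mul_add,
    add_mul, smul_mul_assoc, mul_smul_comm, mul_one, one_mul, two_mul, add_smul, mul_smul,
      smul_add] at h
  have e : ∀ p q s t : B, p + (q + q) + s = t + q + (q + s) → p = t := by
    intro p q s t h
    have : p + (q + (q + s)) = t + (q + (q + s)) := by
      rw [← add_assoc t, ← h]; abel
    exact add_right_cancel this
  exact e _ _ _ _ h

/-- A unital positive homogeneous order isomorphism of positive definite cones extends to a Jordan
*-isomorphism. -/
theorem PosDefCone.IsPosHomogeneous.exists_jordan {Φ : PosDefCone A ≃o PosDefCone B}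
    (hΦ : IsPosHomogeneous Φ) (h1 : IsUnital Φ) :
    ∃ J : A →ₗ[ℂ] B, Function.Bijective J ∧ (∀ a, J (star a) = star (J a)) ∧
      (∀ a b, J (a * b + b * a) = J a * J b + J b * J a) ∧ ∀ a : PosDefCone A, (Φ a : B) = J a := by
  obtain ⟨L, hL⟩ := exists_linearIsometryEquiv_logConj hΦ h1
  have hL1 : L 1 = 1 := by
    have h := logConj_add_smul_one hΦ 0 1
    rwa [← hL, map_zero, zero_add, zero_add, one_smul, one_smul] at h
  have hle : ∀ x y, L x ≤ L y ↔ x ≤ y := by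
    intro x y
    rw [hL]
    refine ⟨fun h => ?_, logConj_mono hΦ h1⟩
    have := logConj_mono hΦ.symm h1.symm h
    simpa only [← logConj_symm, Equiv.symm_apply_apply] using this
  have hsq := selfAdjoint.map_mul_self_of_orderIso L.toLinearEquiv hL1 hle
  have hJ := selfAdjoint.complexify_map_jordan
    (L := (L.toLinearEquiv : selfAdjoint A →ₗ[ℝ] selfAdjoint B)) hsq
  refine ⟨_, selfAdjoint.bijective_complexify L.toLinearEquiv, selfAdjoint.complexify_star _, hJ,
    fun a => ?_⟩
  obtain ⟨x, rfl⟩ := (expEquiv A).surjective a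
  rw [← expEquiv_logConj, ← hL, coe_expEquiv, coe_expEquiv,
    LinearMap.map_exp_of_map_jordan _ (selfAdjoint.continuous_complexify L.continuous) _ hJ,
    selfAdjoint.complexify_coe]
  · rfl
  · rw [← selfAdjoint.val_one, selfAdjoint.complexify_coe]
    exact congrArg Subtype.val hL1

namespace LinearMap

variable {J : A →ₗ[ℂ] B} (hs : ∀ a, J (star a) = star (J a))
  (hJ : ∀ a b, J (a * b + b * a) = J a * J b + J b * J a)
include hs hJ

/-- A Jordan *-homomorphism is positive. -/
lemma map_nonneg_of_map_jordan {a : A} (ha : 0 ≤ a) : 0 ≤ J a := by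
  have h := hJ (CFC.sqrt a) (CFC.sqrt a)
  rw [CFC.sqrt_mul_sqrt_self a ha, map_add, ← two_smul ℂ, ← two_smul ℂ] at h
  rw [smul_right_injective B (two_ne_zero' ℂ) h]
  have hsa : star (J (CFC.sqrt a)) = J (CFC.sqrt a) := by
    rw [← hs, (CFC.sqrt_nonneg a).isSelfAdjoint.star_eq]
  simpa only [hsa] using star_mul_self_nonneg (J (CFC.sqrt a))

lemma monotone_of_map_jordan : Monotone J := fun a b hab => by
  have := map_nonneg_of_map_jordan hs hJ (sub_nonneg.2 hab)
  rwa [map_sub, sub_nonneg] at this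

lemma isStrictlyPositive_of_map_jordan (h1 : J 1 = 1) {a : A} (ha : IsStrictlyPositive a) :
    IsStrictlyPositive (J a) := by
  obtain ⟨r, hr, h⟩ := isStrictlyPositive_iff_exists_smul_one_le.1 ha
  refine isStrictlyPositive_iff_exists_smul_one_le.2 ⟨r, hr, ?_⟩
  have := monotone_of_map_jordan hs hJ h
  rwa [LinearMap.map_smul_of_tower, h1] at this

end LinearMap

omit [PartialOrder A] [StarOrderedRing A] [PartialOrder B] [StarOrderedRing B] in
lemma LinearEquiv.symm_map_jordan {J : A ≃ₗ[ℂ] B}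
    (hJ : ∀ a b, J (a * b + b * a) = J a * J b + J b * J a) (a b : B) :
    J.symm (a * b + b * a) = J.symm a * J.symm b + J.symm b * J.symm a := by
  rw [J.symm_apply_eq, hJ]
  simp

omit [PartialOrder A] [StarOrderedRing A] [PartialOrder B] [StarOrderedRing B] in
lemma LinearEquiv.map_one_of_map_jordan {J : A ≃ₗ[ℂ] B}
    (hJ : ∀ a b, J (a * b + b * a) = J a * J b + J b * J a) : J 1 = 1 := by
  let _ : Module ℚ B := Module.compHom B (algebraMap ℚ ℂ)
  have : IsAddTorsionFree B := IsAddTorsionFree.of_module_rat B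
  exact (J : A →ₗ[ℂ] B).toAddMonoidHom.map_one_of_map_jordan J.surjective hJ

/-- A Jordan *-isomorphism restricts to an order isomorphism of the positive definite cones. -/
noncomputable def PosDefCone.ofJordan (J : A ≃ₗ[ℂ] B) (hs : ∀ a, J (star a) = star (J a))
    (hJ : ∀ a b, J (a * b + b * a) = J a * J b + J b * J a) : PosDefCone A ≃o PosDefCone B where
  toFun x := ⟨J x, LinearMap.isStrictlyPositive_of_map_jordan (J := (J : A →ₗ[ℂ] B)) hs hJ
    (J.map_one_of_map_jordan hJ) x.2⟩
  invFun y := ⟨J.symm y, LinearMap.isStrictlyPositive_of_map_jordan (J := (J.symm : B →ₗ[ℂ] A))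
    (fun b => by simp [J.symm_apply_eq, hs]) (J.symm_map_jordan hJ)
    (J.symm.map_one_of_map_jordan (J.symm_map_jordan hJ)) y.2⟩
  left_inv x := Subtype.ext (J.symm_apply_apply _)
  right_inv y := Subtype.ext (J.apply_symm_apply _)
  map_rel_iff' := @fun x y => by
    refine ⟨fun h => ?_, fun h => ?_⟩
    · have := LinearMap.monotone_of_map_jordan (J := (J.symm : B →ₗ[ℂ] A))
        (fun b => by simp [J.symm_apply_eq, hs]) (J.symm_map_jordan hJ) h
      simpa using this
    · exact LinearMap.monotone_of_map_jordan (J := (J : A →ₗ[ℂ] B)) hs hJ h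

/-- The congruence `x ↦ c * x * c` as an order automorphism of the positive definite cone. -/
noncomputable def PosDefCone.congruence (c : PosDefCone A) : PosDefCone A ≃o PosDefCone A where
  toFun x := ⟨c * x * c, IsStrictlyPositive.conjugate_of_isUnit_of_isSelfAdjoint _ _ c.2.isUnit
    c.2.isSelfAdjoint x.2⟩
  invFun x := ⟨Ring.inverse (c : A) * x * Ring.inverse (c : A),
    IsStrictlyPositive.conjugate_of_isUnit_of_isSelfAdjoint _ _ c.2.ringInverse.isUnit
      c.2.ringInverse.isSelfAdjoint x.2⟩
  left_inv x := by
    obtain ⟨c, hc⟩ := c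
    obtain ⟨c, rfl⟩ := hc.isUnit
    ext
    simp [mul_assoc]
  right_inv x := by
    obtain ⟨c, hc⟩ := c
    obtain ⟨c, rfl⟩ := hc.isUnit
    ext
    simp [mul_assoc]
  map_rel_iff' := @fun x y => by
    change (c : A) * x * c ≤ c * y * c ↔ (x : A) ≤ y
    refine ⟨fun h => ?_, fun h => conjugate_le_conjugate_of_nonneg h c.2.nonneg⟩
    have h' := conjugate_le_conjugate_of_nonneg h c.2.ringInverse.nonneg
    obtain ⟨c, hc⟩ := c
    obtain ⟨c, rfl⟩ := hc.isUnit
    simpa [mul_assoc] using h'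

lemma PosDefCone.coe_congruence (c x : PosDefCone A) : (congruence c x : A) = c * x * c := rfl

/-- A positive homogeneous order isomorphism of positive definite cones is a Jordan *-isomorphism
followed by a congruence. -/
theorem PosDefCone.IsPosHomogeneous.exists_jordan_congruence {Φ : PosDefCone A ≃o PosDefCone B}
    (hΦ : IsPosHomogeneous Φ) :
    ∃ (c : PosDefCone B) (J : A →ₗ[ℂ] B), Function.Bijective J ∧ (∀ a, J (star a) = star (J a)) ∧
      (∀ a b, J (a * b + b * a) = J a * J b + J b * J a) ∧
      ∀ a : PosDefCone A, (Φ a : B) = c * J a * c := by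
  set e : PosDefCone A := ⟨1, isStrictlyPositive_one⟩ with he
  set c : PosDefCone B := ⟨CFC.sqrt (Φ e : B), (Φ e).2.sqrt⟩ with hc
  have hcc : congruence c ⟨1, isStrictlyPositive_one⟩ = Φ e := by
    ext
    rw [coe_congruence, mul_one]
    exact CFC.sqrt_mul_sqrt_self _ (Φ e).2.nonneg
  have hcong : IsPosHomogeneous (congruence c) := by
    intro t x y _ hxy
    rw [coe_congruence, coe_congruence, hxy, mul_smul_comm, smul_mul_assoc]
  have hΨ : IsPosHomogeneous (Φ.trans (congruence c).symm) := by
    intro t x y ht hxy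
    exact hcong.symm t _ _ ht (hΦ t x y ht hxy)
  have h1 : IsUnital (Φ.trans (congruence c).symm) := by
    intro x hx
    have : x = e := Subtype.ext hx
    rw [OrderIso.trans_apply, this, ← hcc, OrderIso.symm_apply_apply]
  obtain ⟨J, hJb, hs, hJ, hΨJ⟩ := hΨ.exists_jordan h1
  refine ⟨c, J, hJb, hs, hJ, fun a => ?_⟩
  rw [← hΨJ, ← coe_congruence, OrderIso.trans_apply, OrderIso.apply_symm_apply]

end Jordan

/-- Let `𝒜` and `ℬ` be unital C*-algebras.  A map `φ : 𝒜⁺⁺ → ℬ⁺⁺` is a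
surjective positive homogeneous order isomorphism if and only if there exist `C ∈ ℬ⁺⁺` and a
Jordan *-isomorphism `J : 𝒜 → ℬ` such that `φ a = C * J a * C` for all `a ∈ 𝒜⁺⁺`. -/
theorem stmt11 {A B : Type*} [CStarAlgebra A] [PartialOrder A] [StarOrderedRing A]
    [CStarAlgebra B] [PartialOrder B] [StarOrderedRing B]
    (φ : A → B) (hmap : ∀ a : A, 0 ≤ a → IsUnit a → 0 ≤ φ a ∧ IsUnit (φ a)) :
    ((∀ b : B, 0 ≤ b → IsUnit b → ∃ a : A, 0 ≤ a ∧ IsUnit a ∧ φ a = b) ∧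
     (∀ a b : A, 0 ≤ a → IsUnit a → 0 ≤ b → IsUnit b → (a ≤ b ↔ φ a ≤ φ b)) ∧
     (∀ a : A, 0 ≤ a → IsUnit a → ∀ t : ℝ, 0 < t → φ (t • a) = t • φ a)) ↔
    (∃ C : B, 0 ≤ C ∧ IsUnit C ∧ ∃ J : A → B,
      Function.Bijective J ∧ IsLinearMap ℂ J ∧
      (∀ a : A, J (star a) = star (J a)) ∧
      (∀ a b : A, J (a * b + b * a) = J a * J b + J b * J a) ∧
      (∀ a : A, 0 ≤ a → IsUnit a → φ a = C * J a * C)) := by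
  constructor
  · rintro ⟨hsurj, hord, hhom⟩
    let f : PosDefCone A → PosDefCone B := fun a =>
      ⟨φ a, (hmap a a.2.nonneg a.2.isUnit).2.isStrictlyPositive (hmap a a.2.nonneg a.2.isUnit).1⟩
    have hf : ∀ {a b : PosDefCone A}, f a ≤ f b ↔ a ≤ b := @fun a b =>
      (hord a b a.2.nonneg a.2.isUnit b.2.nonneg b.2.isUnit).symm
    have hfs : Function.Surjective f := fun b => by
      obtain ⟨a, ha, hau, hab⟩ := hsurj b b.2.nonneg b.2.isUnit
      exact ⟨⟨a, hau.isStrictlyPositive ha⟩, Subtype.ext hab⟩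
    let Φ : PosDefCone A ≃o PosDefCone B :=
      RelIso.ofSurjective (OrderEmbedding.ofMapLEIff f fun _ _ => hf) hfs
    have hΦ : PosDefCone.IsPosHomogeneous Φ := fun t x y ht hxy => by
      change φ y = t • φ x
      rw [hxy, hhom x x.2.nonneg x.2.isUnit t ht]
    obtain ⟨c, J, hJb, hs, hJ, h⟩ := hΦ.exists_jordan_congruence
    exact ⟨c, c.2.nonneg, c.2.isUnit, J, hJb, J.isLinear, hs, hJ, fun a ha hau =>
      h ⟨a, hau.isStrictlyPositive ha⟩⟩
  · rintro ⟨C, hC, hCu, J, hJb, hJl, hs, hJ, hφ⟩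
    let c : PosDefCone B := ⟨C, hCu.isStrictlyPositive hC⟩
    let Φ : PosDefCone A ≃o PosDefCone B :=
      (PosDefCone.ofJordan (LinearEquiv.ofBijective (hJl.mk' J) hJb) hs hJ).trans
        (PosDefCone.congruence c)
    have hΦ : ∀ a : PosDefCone A, φ a = Φ a := fun a => hφ a a.2.nonneg a.2.isUnit
    refine ⟨fun b hb hbu => ?_, fun a b ha hau hb hbu => ?_, fun a ha hau t ht => ?_⟩
    · obtain ⟨a, h⟩ := Φ.surjective ⟨b, hbu.isStrictlyPositive hb⟩
      exact ⟨a, a.2.nonneg, a.2.isUnit, by rw [hΦ, h]⟩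
    · have h := Φ.le_iff_le (x := ⟨a, hau.isStrictlyPositive ha⟩)
        (y := ⟨b, hbu.isStrictlyPositive hb⟩)
      rw [← Subtype.coe_le_coe, ← hΦ, ← hΦ] at h
      exact h.symm
    · have hta := (hau.isStrictlyPositive ha).smul ht
      rw [hφ _ hta.nonneg hta.isUnit, hφ a ha hau, ← Complex.coe_smul, hJl.map_smul,
        Complex.coe_smul, mul_smul_comm, smul_mul_assoc]
end

section
/- Let 𝒜 be a unital C*-algebra, let ℬ be a C*-algebra, and let ψ : 𝒜⁺ → ℬ⁺ be a surjective order isomorphism that is norm preserving and orthogonality preserving (i.e. for A, B ∈ 𝒜⁺, AB = 0 implies ψ(A)ψ(B) = 0). Then there exists a Jordan *-isomorphism J : 𝒜 → ℬ such that J(A) = ψ(A) for all A ∈ 𝒜⁺. -/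
set_option linter.unusedSectionVars false

namespace ConeIso

section Algebra

theorem star_mul_swap {R : Type*} [Mul R] [StarMul R] {a b c : R} (ha : IsSelfAdjoint a)
    (hb : IsSelfAdjoint b) (hc : IsSelfAdjoint c) (h : a * b = c) : b * a = c := by
  have := congrArg star h
  rwa [star_mul, ha.star_eq, hb.star_eq, hc.star_eq] at this

variable {A : Type*} [CStarAlgebra A] [PartialOrder A] [StarOrderedRing A]

theorem mul_eq_zero_of_conj_nonpos {a x : A} (ha : 0 ≤ a) (h : star x * a * x ≤ 0) : a * x = 0 := by
  have h0 : star x * a * x = 0 := le_antisymm h (star_left_conjugate_nonneg ha x)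
  have hs : star (CFC.sqrt a * x) * (CFC.sqrt a * x) = 0 := by
    rw [star_mul, (CFC.sqrt_nonneg a).isSelfAdjoint.star_eq, ← h0, mul_assoc, mul_assoc,
      ← mul_assoc (CFC.sqrt a), CFC.sqrt_mul_sqrt_self a]
  have := CStarRing.star_mul_self_eq_zero_iff _ |>.1 hs
  rw [← CFC.sqrt_mul_sqrt_self a, mul_assoc, this, mul_zero]

theorem mul_eq_zero_of_le {d a x : A} (hd : 0 ≤ d) (hda : d ≤ a) (h : a * x = 0) : d * x = 0 := by
  refine mul_eq_zero_of_conj_nonpos hd ?_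
  calc star x * d * x ≤ star x * a * x := star_left_conjugate_le_conjugate hda x
    _ = 0 := by rw [mul_assoc, h, mul_zero]

theorem sq_le_self {e : A} (h0 : 0 ≤ e) (h1 : e ≤ 1) : e * e ≤ e := by
  have h := conjugate_le_conjugate_of_nonneg h1 (CFC.sqrt_nonneg e)
  have hs := CFC.sqrt_mul_sqrt_self e
  have hc : CFC.sqrt e * e * CFC.sqrt e = e * e := by
    conv_lhs => enter [1, 2]; rw [← hs]
    rw [← mul_assoc, hs, mul_assoc, hs]
  rwa [hc, mul_one, hs] at h

/-- If `e` acts as a unit on `d` and `0 ≤ d ≤ s`, then `d ≤ s e`. -/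
theorem le_smul_of_mul_eq {d e : A} {s : ℝ} (hs : 0 ≤ s) (hd : 0 ≤ d) (hds : d ≤ s • 1) (he : 0 ≤ e)
    (he1 : e ≤ 1) (h : e * d = d) : d ≤ s • e := by
  have h' := star_mul_swap he.isSelfAdjoint hd.isSelfAdjoint hd.isSelfAdjoint h
  calc d = e * d * e := by rw [h, h']
    _ ≤ e * (s • 1) * e := conjugate_le_conjugate_of_nonneg hds he
    _ = s • (e * e) := by simp
    _ ≤ s • e := smul_le_smul_of_nonneg_left (sq_le_self he he1) hs

theorem le_of_mul_eq {d e : A} (hd : 0 ≤ d) (hd1 : d ≤ 1) (he : 0 ≤ e)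
    (he1 : e ≤ 1) (h : e * d = d) : d ≤ e := by
  simpa using le_smul_of_mul_eq zero_le_one hd (by simpa using hd1) he he1 h

/-- If `e` acts as a unit on `c` and `0 ≤ d ≤ c`, then `e` acts as a unit on `d`. -/
theorem mul_eq_of_le {d c e : A} (hd : 0 ≤ d) (hdc : d ≤ c) (he : IsSelfAdjoint e) (h : e * c = c) :
    e * d = d := by
  have hc := (hd.trans hdc).isSelfAdjoint
  have h1 : c * (1 - e) = 0 := by
    rw [mul_sub, mul_one, star_mul_swap he hc hc h, sub_self]
  have h2 := mul_eq_zero_of_le hd hdc h1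
  rw [mul_sub, mul_one, sub_eq_zero] at h2
  exact star_mul_swap hd.isSelfAdjoint he hd.isSelfAdjoint h2.symm

/-- A positive element whose compressions to two complementary elements are small is small. -/
theorem le_of_conj_le {y k l : A} {δ : ℝ} (hy : 0 ≤ y) (hk : IsSelfAdjoint k) (hl : IsSelfAdjoint l)
    (hkl : k + l = 1) (h1 : k * y * k ≤ δ • 1) (h2 : l * y * l ≤ δ • 1) : y ≤ (4 * δ) • 1 := by
  have h3 : 0 ≤ (k - l) * y * (k - l) := (hk.sub hl).conjugate_nonneg hy
  have e : y = (k + l) * y * (k + l) := by rw [hkl]; simp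
  have e2 : (k + l) * y * (k + l) = k * y * k + k * y * k + (l * y * l + l * y * l)
      - (k - l) * y * (k - l) := by noncomm_ring
  have e3 : (4 * δ) • (1 : A) = δ • 1 + δ • 1 + (δ • 1 + δ • 1) := by
    rw [← add_smul, ← add_smul]; ring_nf
  calc y = k * y * k + k * y * k + (l * y * l + l * y * l) - (k - l) * y * (k - l) := e.trans e2
    _ ≤ k * y * k + k * y * k + (l * y * l + l * y * l) := sub_le_self _ h3
    _ ≤ _ := by rw [e3]; gcongr

theorem exists_inv_of_le {b : A} {c : ℝ} (hc : 0 < c) (hb : c • 1 ≤ b) :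
    ∃ x : A, 0 ≤ x ∧ b * x = 1 ∧ x * b = 1 := by
  have hb0 : 0 ≤ b := (smul_nonneg hc.le zero_le_one).trans hb
  have hu : IsUnit b := by
    refine CStarAlgebra.isUnit_of_le (c • (1 : A)) hb ?_
    rw [← Algebra.algebraMap_eq_smul_one]
    exact ⟨by rw [Algebra.algebraMap_eq_smul_one]; exact smul_nonneg hc.le zero_le_one,
      (IsUnit.mk0 c hc.ne').map _⟩
  obtain ⟨u, rfl⟩ := hu
  refine ⟨↑u⁻¹, ?_, by simp, by simp⟩
  exact CFC.inv_nonneg_of_nonneg u hb0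

theorem inv_antitone {a b x y : A} (ha : 0 ≤ a) (hab : a ≤ b) (hax : a * x = 1) (hxa : x * a = 1)
    (hby : b * y = 1) (hyb : y * b = 1) : y ≤ x :=
  CStarAlgebra.inv_le_inv (a := ⟨a, x, hax, hxa⟩) (b := ⟨b, y, hby, hyb⟩) ha hab

end Algebra

section Cover

variable {A : Type*} [CStarAlgebra A] [PartialOrder A] [StarOrderedRing A]

/-- If the supports of `1 - f` and `1 - g` are separated by `k`, then every upper bound of `f` and
`g` that is at most slightly larger than `1` is close to `1`. -/
theorem ge_of_cover {f g k d : A} {δ : ℝ} (hδ : 0 ≤ δ) (hk0 : 0 ≤ k) (hk1 : k ≤ 1)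
    (hf : k * (1 - f) = 0) (hg : (1 - k) * (1 - g) = 0) (hfd : f ≤ d) (hgd : g ≤ d)
    (hd : d ≤ (1 + δ) • 1) : (1 - 3 * δ) • 1 ≤ d := by
  have key : ∀ l u : A, 0 ≤ l → l ≤ 1 → l * (1 - u) = 0 → u ≤ d →
      l * ((1 + δ) • 1 - d) * l ≤ δ • 1 := by
    intro l u hl0 hl1 hlu hud
    calc l * ((1 + δ) • 1 - d) * l ≤ l * ((1 + δ) • 1 - u) * l :=
          conjugate_le_conjugate_of_nonneg (by gcongr) hl0
      _ = l * (1 - u) * l + δ • (l * l) := by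
          rw [add_smul, one_smul, add_sub_right_comm, mul_add, add_mul]; simp
      _ = δ • (l * l) := by rw [hlu, zero_mul, zero_add]
      _ ≤ δ • 1 := smul_le_smul_of_nonneg_left ((sq_le_self hl0 hl1).trans hl1) hδ
  have h := le_of_conj_le (sub_nonneg.2 hd) hk0.isSelfAdjoint (sub_nonneg.2 hk1).isSelfAdjoint
    (add_sub_cancel k 1) (key k f hk0 hk1 hf hfd)
    (key (1 - k) g (sub_nonneg.2 hk1) (sub_le_self _ hk0) hg hgd)
  rw [sub_le_comm, ← sub_smul] at h
  convert h using 2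
  ring

theorem norm_le_iff_le_smul_one {a : A} (ha : 0 ≤ a) {t : ℝ} (ht : 0 ≤ t) :
    ‖a‖ ≤ t ↔ a ≤ t • 1 := by
  rw [CStarAlgebra.norm_le_iff_le_algebraMap a ht ha, Algebra.algebraMap_eq_smul_one]

end Cover

/-- A surjective order isomorphism between positive cones that preserves norms and
orthogonality. -/
structure IsConeIso {A B : Type*} [CStarAlgebra A] [PartialOrder A] [CStarAlgebra B]
    [PartialOrder B] (ψ : A → B) : Prop where
  map_nonneg : ∀ a : A, 0 ≤ a → 0 ≤ ψ a
  surj : ∀ b : B, 0 ≤ b → ∃ a : A, 0 ≤ a ∧ ψ a = b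
  le_iff : ∀ a b : A, 0 ≤ a → 0 ≤ b → (a ≤ b ↔ ψ a ≤ ψ b)
  norm_map : ∀ a : A, 0 ≤ a → ‖ψ a‖ = ‖a‖
  orth : ∀ a b : A, 0 ≤ a → 0 ≤ b → a * b = 0 → ψ a * ψ b = 0

namespace IsConeIso

variable {A B : Type*} [CStarAlgebra A] [PartialOrder A] [StarOrderedRing A]
  [CStarAlgebra B] [PartialOrder B] [StarOrderedRing B] {ψ : A → B}

theorem map_le (h : IsConeIso ψ) {a b : A} (ha : 0 ≤ a) (hab : a ≤ b) : ψ a ≤ ψ b :=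
  (h.le_iff a b ha (ha.trans hab)).1 hab

theorem le_smul_one_iff (h : IsConeIso ψ) {a : A} (ha : 0 ≤ a) {t : ℝ} (ht : 0 ≤ t) :
    ψ a ≤ t • 1 ↔ a ≤ t • 1 := by
  rw [← norm_le_iff_le_smul_one ha ht, ← norm_le_iff_le_smul_one (h.map_nonneg a ha) ht,
    h.norm_map a ha]

theorem map_smul_one (h : IsConeIso ψ) {t : ℝ} (ht : 0 ≤ t) : ψ (t • 1) = t • 1 := by
  have hA : (0 : A) ≤ t • 1 := smul_nonneg ht zero_le_one
  have hB : (0 : B) ≤ t • 1 := smul_nonneg ht zero_le_one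
  refine le_antisymm ((h.le_smul_one_iff hA ht).2 le_rfl) ?_
  obtain ⟨d, hd, hdt⟩ := h.surj _ hB
  rw [← hdt]
  exact h.map_le hd ((h.le_smul_one_iff hd ht).1 hdt.le)

theorem smul_one_le_iff (h : IsConeIso ψ) {a : A} (ha : 0 ≤ a) {t : ℝ} (ht : 0 ≤ t) :
    t • 1 ≤ ψ a ↔ t • 1 ≤ a := by
  rw [h.le_iff _ a (smul_nonneg ht zero_le_one) ha, h.map_smul_one ht]

theorem map_zero (h : IsConeIso ψ) : ψ 0 = 0 := by
  simpa using h.map_smul_one le_rfl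

theorem map_one (h : IsConeIso ψ) : ψ 1 = 1 := by
  simpa using h.map_smul_one zero_le_one

theorem scale (h : IsConeIso ψ) {t : ℝ} (ht : 0 < t) :
    IsConeIso fun x => t⁻¹ • ψ (t • x) where
  map_nonneg a ha := smul_nonneg (inv_pos.2 ht).le (h.map_nonneg _ (smul_nonneg ht.le ha))
  surj b hb := by
    obtain ⟨a, ha, hab⟩ := h.surj (t • b) (smul_nonneg ht.le hb)
    exact ⟨t⁻¹ • a, smul_nonneg (inv_pos.2 ht).le ha, by simp [smul_smul, ht.ne', hab]⟩
  le_iff a b ha hb := by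
    rw [smul_le_smul_iff_of_pos_left (inv_pos.2 ht), ← h.le_iff _ _ (smul_nonneg ht.le ha)
      (smul_nonneg ht.le hb), smul_le_smul_iff_of_pos_left ht]
  norm_map a ha := by
    rw [norm_smul, h.norm_map _ (smul_nonneg ht.le ha), norm_smul, ← mul_assoc, ← norm_mul,
      inv_mul_cancel₀ ht.ne', norm_one, one_mul]
  orth a b ha hb hab := by
    rw [smul_mul_smul_comm, h.orth _ _ (smul_nonneg ht.le ha) (smul_nonneg ht.le hb)
      (by rw [smul_mul_smul_comm, hab, smul_zero]), smul_zero]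

/-- The images of two elements whose complements are separated jointly dominate a scalar. -/
theorem smul_one_le_add (h : IsConeIso ψ) {f g k : A} (hf0 : 0 ≤ f) (hf1 : f ≤ 1) (hg0 : 0 ≤ g)
    (hg1 : g ≤ 1) (hk0 : 0 ≤ k) (hk1 : k ≤ 1) (hf : k * (1 - f) = 0) (hg : (1 - k) * (1 - g) = 0) :
    (1 / 10 : ℝ) • 1 ≤ ψ f + ψ g := by
  set F := ψ f
  set G := ψ g
  have hF0 : 0 ≤ F := h.map_nonneg f hf0
  have hG0 : 0 ≤ G := h.map_nonneg g hg0
  have hF1 : F ≤ 1 := by rw [← h.map_one]; exact h.map_le hf0 hf1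
  have hG1 : G ≤ 1 := by rw [← h.map_one]; exact h.map_le hg0 hg1
  have one_nn : (0 : B) ≤ 1 := zero_le_one
  have hS : (1 / 100 : ℝ) • (1 : B) ≤ F + G + (1 / 100 : ℝ) • 1 :=
    le_add_of_nonneg_left (add_nonneg hF0 hG0)
  obtain ⟨X, hX0, hSX, hXS⟩ := exists_inv_of_le (by norm_num) hS
  have hM : (9 / 10 : ℝ) • (1 : B) ≤ (9 / 10 : ℝ) • 1 + (91 / 1000 : ℝ) • X :=
    le_add_of_nonneg_right (smul_nonneg (by norm_num) hX0)
  obtain ⟨w, hw0, hMw, hwM⟩ := exists_inv_of_le (by norm_num) hM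
  have key : ∀ P : B, 0 ≤ P → P ≤ 1 → P ≤ F + G → P ≤ w := by
    intro P hP0 hP1 hPS
    have hP : (1 / 100 : ℝ) • (1 : B) ≤ P + (1 / 100 : ℝ) • 1 := le_add_of_nonneg_left hP0
    obtain ⟨Y, hY0, hPY, hYP⟩ := exists_inv_of_le (by norm_num) hP
    have hP' : 0 ≤ P + (1 / 100 : ℝ) • (1 : B) := add_nonneg hP0 (smul_nonneg (by norm_num) one_nn)
    have h1 : X ≤ Y := inv_antitone hP' (by gcongr) hPY hYP hSX hXS
    have h2 : (100 / 101 : ℝ) • (1 : B) ≤ Y := by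
      refine inv_antitone (b := (101 / 100 : ℝ) • (1 : B)) hP' ?_ hPY hYP ?_ ?_
      · calc P + (1 / 100 : ℝ) • (1 : B) ≤ 1 + (1 / 100 : ℝ) • (1 : B) := by gcongr
          _ = (101 / 100 : ℝ) • (1 : B) := by
            nth_rw 1 [← one_smul ℝ (1 : B)]; rw [← add_smul]; norm_num
      · rw [smul_mul_smul_comm, one_mul]; norm_num
      · rw [smul_mul_smul_comm, one_mul]; norm_num
    have h3 : (9 / 10 : ℝ) • 1 + (91 / 1000 : ℝ) • X ≤ Y := by
      calc (9 / 10 : ℝ) • 1 + (91 / 1000 : ℝ) • X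
          = (909 / 1000 : ℝ) • (100 / 101 : ℝ) • 1 + (91 / 1000 : ℝ) • X := by
            rw [smul_smul]; norm_num
        _ ≤ (909 / 1000 : ℝ) • Y + (91 / 1000 : ℝ) • Y :=
            add_le_add (smul_le_smul_of_nonneg_left h2 (by norm_num))
              (smul_le_smul_of_nonneg_left h1 (by norm_num))
        _ = Y := by rw [← add_smul]; norm_num
    calc P ≤ P + (1 / 100 : ℝ) • (1 : B) :=
          le_add_of_nonneg_right (smul_nonneg (by norm_num) one_nn)
      _ ≤ w := inv_antitone ((smul_nonneg (by norm_num) one_nn).trans hM) h3 hMw hwM hYP hPY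
  have hwF := key F hF0 hF1 (le_add_of_nonneg_right hG0)
  have hwG := key G hG0 hG1 (le_add_of_nonneg_left hF0)
  have hw1 : w ≤ (1 + 1 / 9 : ℝ) • 1 := by
    refine inv_antitone (smul_nonneg (by norm_num) one_nn) hM ?_ ?_ hMw hwM
    · rw [smul_mul_smul_comm, one_mul]; norm_num
    · rw [smul_mul_smul_comm, one_mul]; norm_num
  obtain ⟨d, hd0, rfl⟩ := h.surj w hw0
  have hd := ge_of_cover (by norm_num) hk0 hk1 hf hg ((h.le_iff f d hf0 hd0).2 hwF)
    ((h.le_iff g d hg0 hd0).2 hwG) ((h.le_smul_one_iff hd0 (by norm_num)).1 hw1)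
  have hd' := (h.smul_one_le_iff hd0 (by norm_num)).2 hd
  have hM2 : (9 / 10 : ℝ) • 1 + (91 / 1000 : ℝ) • X ≤ (3 / 2 : ℝ) • 1 := by
    refine inv_antitone (smul_nonneg (by norm_num) one_nn) hd' ?_ ?_ hwM hMw
    · rw [smul_mul_smul_comm, one_mul]; norm_num
    · rw [smul_mul_smul_comm, one_mul]; norm_num
  have hX : X ≤ (600 / 91 : ℝ) • 1 := by
    rw [← le_sub_iff_add_le', ← sub_smul] at hM2
    calc X = (1000 / 91 : ℝ) • (91 / 1000 : ℝ) • X := by rw [smul_smul]; norm_num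
      _ ≤ (1000 / 91 : ℝ) • (3 / 2 - 9 / 10 : ℝ) • 1 :=
          smul_le_smul_of_nonneg_left hM2 (by norm_num)
      _ = _ := by rw [smul_smul]; norm_num
  have hS2 : (91 / 600 : ℝ) • 1 ≤ F + G + (1 / 100 : ℝ) • (1 : B) := by
    refine inv_antitone hX0 hX hXS hSX ?_ ?_
    · rw [smul_mul_smul_comm, one_mul]; norm_num
    · rw [smul_mul_smul_comm, one_mul]; norm_num
  rw [← sub_le_iff_le_add, ← sub_smul] at hS2
  exact (smul_le_smul_of_nonneg_right (by norm_num) one_nn).trans hS2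

/-- Scaled form of `smul_one_le_add`. -/
theorem smul_one_le_map_smul_add (h : IsConeIso ψ) {f g k : A} (hf0 : 0 ≤ f) (hf1 : f ≤ 1)
    (hg0 : 0 ≤ g) (hg1 : g ≤ 1) (hk0 : 0 ≤ k) (hk1 : k ≤ 1) (hf : k * (1 - f) = 0)
    (hg : (1 - k) * (1 - g) = 0) {t : ℝ} (ht : 0 < t) :
    (t / 10) • 1 ≤ ψ (t • f) + ψ (t • g) := by
  have h1 := smul_le_smul_of_nonneg_left
    ((h.scale ht).smul_one_le_add hf0 hf1 hg0 hg1 hk0 hk1 hf hg) ht.le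
  rw [← smul_add, smul_smul, smul_smul, mul_inv_cancel₀ ht.ne', one_smul] at h1
  rwa [div_eq_mul_one_div]

end IsConeIso

section Resolvent

variable {B : Type*} [CStarAlgebra B] [PartialOrder B] [StarOrderedRing B]

theorem nonpos_of_forall_le_smul {x y : B} (h : ∀ ε : ℝ, 0 < ε → x ≤ ε • y) : x ≤ 0 := by
  have ht : Filter.Tendsto (fun ε : ℝ => ε • y) (nhdsWithin 0 (Set.Ioi 0)) (nhds 0) := by
    have : Continuous fun ε : ℝ => ε • y := by fun_prop
    simpa using (this.tendsto 0).mono_left nhdsWithin_le_nhds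
  exact ge_of_tendsto ht (Filter.eventually_of_mem self_mem_nhdsWithin fun ε hε => h ε hε)

theorem sub_two_add_inv_nonneg {H T : B} (hH : 0 ≤ H) (hT : 0 ≤ T) (h1 : (1 + H) * T = 1)
    (h2 : T * (1 + H) = 1) : 1 - T ≤ H := by
  have h3 : 0 ≤ (1 - T) * (1 + H) * (1 - T) :=
    (((IsSelfAdjoint.one B).sub hT.isSelfAdjoint)).conjugate_nonneg
      (add_nonneg zero_le_one hH)
  have h4 : (1 - T) * (1 + H) * (1 - T) = H - (1 - T) := by
    rw [sub_mul, one_mul, h2, mul_sub, mul_one, sub_mul, h1]; noncomm_ring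
  rw [h4] at h3
  exact sub_nonneg.1 h3

theorem resolvent_le_one {H T : B} (hH : 0 ≤ H) (h1 : (1 + H) * T = 1)
    (h2 : T * (1 + H) = 1) : T ≤ 1 :=
  inv_antitone zero_le_one (le_add_of_nonneg_right hH) (mul_one 1) (mul_one 1) h1 h2

theorem exists_resolvent {H : B} (hH : 0 ≤ H) :
    ∃ T : B, 0 ≤ T ∧ (1 + H) * T = 1 ∧ T * (1 + H) = 1 :=
  exists_inv_of_le one_pos (by rw [one_smul]; exact le_add_of_nonneg_right hH)

theorem conj_le_resolvent_sub {H H' T T' : B} {t : ℝ} (ht : 0 ≤ t) (hH : 0 ≤ H) (hHH : H ≤ H')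
    (hH' : H' - H ≤ t • 1) (h1 : (1 + H) * T = 1) (h2 : T * (1 + H) = 1) (hT : 0 ≤ T)
    (h1' : (1 + H') * T' = 1) (h2' : T' * (1 + H') = 1) :
    T * (H' - H) * T ≤ (1 + t) • (T - T') := by
  set Δ := H' - H with hΔ
  have hΔ0 : 0 ≤ Δ := sub_nonneg.2 hHH
  obtain ⟨V, hV0, hV1, hV2⟩ := exists_resolvent hΔ0
  have hTV : T' ≤ V := by
    refine inv_antitone (add_nonneg zero_le_one hΔ0) ?_ hV1 hV2 h1' h2'
    gcongr; rw [hΔ]; exact sub_le_self _ hH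
  have hVt : (1 / (1 + t)) • (1 : B) ≤ V := by
    refine inv_antitone (b := (1 + t) • (1 : B)) (add_nonneg zero_le_one hΔ0) ?_ hV1 hV2 ?_ ?_
    · rw [add_smul, one_smul]; gcongr
    · rw [smul_mul_smul_comm, one_mul, mul_one_div_cancel (by positivity), one_smul]
    · rw [smul_mul_smul_comm, one_mul, one_div_mul_cancel (by positivity), one_smul]
  set r := CFC.sqrt Δ
  have hr0 : 0 ≤ r := CFC.sqrt_nonneg Δ
  have hrr : r * r = Δ := CFC.sqrt_mul_sqrt_self Δ
  have hrV : V * r = r * V := by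
    have e : r * (1 + Δ) = (1 + Δ) * r := by rw [← hrr]; noncomm_ring
    calc V * r = V * (r * (1 + Δ)) * V := by rw [mul_assoc, mul_assoc, hV1, mul_one]
      _ = r * V := by rw [e, ← mul_assoc, hV2, one_mul]
  have h3 : Δ * T' * Δ ≤ (1 - 1 / (1 + t)) • Δ := by
    calc Δ * T' * Δ ≤ Δ * V * Δ := conjugate_le_conjugate_of_nonneg hTV hΔ0
      _ = Δ * (V * (1 + Δ) - V) := by noncomm_ring
      _ = r * (1 - V) * r := by
        rw [hV2, ← hrr, mul_assoc, mul_assoc, mul_sub, sub_mul, hrV]; noncomm_ring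
      _ ≤ r * ((1 - 1 / (1 + t)) • 1) * r := by
        refine conjugate_le_conjugate_of_nonneg ?_ hr0
        rw [sub_smul, one_smul]; gcongr
      _ = _ := by simp only [mul_smul_comm, smul_mul_assoc, mul_one, hrr]
  have e1 : T * Δ * T' = T - T' := by
    have : Δ = (1 + H') - (1 + H) := by rw [hΔ]; abel
    rw [this, mul_sub, h2, sub_mul, mul_assoc, h1', mul_one, one_mul]
  have e2 : T' * Δ * T = T - T' := by
    have : Δ = (1 + H') - (1 + H) := by rw [hΔ]; abel
    rw [this, mul_sub, h2', sub_mul, mul_assoc, h1, mul_one, one_mul]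
  have e3 : T - T' = T * Δ * T - T * (Δ * T' * Δ) * T := by
    calc T - T' = T * Δ * (T - (T - T')) := by rw [sub_sub_cancel, e1]
      _ = _ := by rw [← e2]; noncomm_ring
  have h4 : T * (Δ * T' * Δ) * T ≤ (1 - 1 / (1 + t)) • (T * Δ * T) := by
    calc _ ≤ T * ((1 - 1 / (1 + t)) • Δ) * T := conjugate_le_conjugate_of_nonneg h3 hT
      _ = _ := by simp
  have h5 : (1 / (1 + t)) • (T * Δ * T) ≤ T - T' := by
    rw [sub_smul, one_smul] at h4
    rw [e3, le_sub_comm]; exact h4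
  have h6 := smul_le_smul_of_nonneg_left h5 (by positivity : 0 ≤ 1 + t)
  rwa [smul_smul, mul_one_div_cancel (by positivity), one_smul] at h6

theorem conj_resolvent_le {F G H H' T T' : B} {t c : ℝ} (ht : 0 ≤ t) (hc : 0 ≤ c)
    (hF : 0 ≤ F) (hGH : G * H = 0) (hGF : G * F = 0) (hHG : H * G = 0)
    (hH : 0 ≤ H) (hHH : H ≤ H') (hcov : c • 1 ≤ H' + G)
    (hH' : H' - H ≤ t • 1) (h1 : (1 + H) * T = 1) (h2 : T * (1 + H) = 1) (hT : 0 ≤ T)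
    (h1' : (1 + H') * T' = 1) (h2' : T' * (1 + H') = 1) :
    F * T * F ≤ (1 / (1 + c)) • (F * F) + (1 + t) • (F * (T - T') * F) := by
  have hGT : G * T = G := by
    have e : G * (1 + H) = G := by rw [mul_add, hGH, mul_one, add_zero]
    calc G * T = G * (1 + H) * T := by rw [e]
      _ = G := by rw [mul_assoc, h1, mul_one]
  have hTG : T * G = G := by
    have e : (1 + H) * G = G := by rw [add_mul, hHG, one_mul, add_zero]
    calc T * G = T * ((1 + H) * G) := by rw [e]
      _ = G := by rw [← mul_assoc, h2, one_mul]
  have h3 : (1 + c) • (T * T) ≤ T + T * (H' - H) * T + G := by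
    calc (1 + c) • (T * T) = T * ((1 + c) • 1) * T := by simp
      _ ≤ T * (1 + (H' + G)) * T := by
        refine conjugate_le_conjugate_of_nonneg ?_ hT
        rw [add_smul, one_smul]; gcongr
      _ = T * (1 + H) * T + T * (H' - H) * T + T * G * T := by noncomm_ring
      _ = _ := by rw [h2, one_mul, hTG, hGT]
  have h4 : (2 : ℝ) • T - (1 / (1 + c)) • 1 ≤ (1 + c) • (T * T) := by
    have hsa : IsSelfAdjoint ((1 + c) • T - 1) :=
      (smul_nonneg (by positivity) hT).isSelfAdjoint.sub (IsSelfAdjoint.one B)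
    have h := smul_nonneg (by positivity : 0 ≤ 1 / (1 + c)) hsa.mul_self_nonneg
    have e : (1 / (1 + c)) • (((1 + c) • T - 1) * ((1 + c) • T - 1)) =
        (1 + c) • (T * T) - ((2 : ℝ) • T - (1 / (1 + c)) • 1) := by
      have hc' : (1 + c) ≠ 0 := by positivity
      simp only [sub_mul, mul_sub, smul_mul_smul_comm, mul_one, one_mul, smul_sub, smul_smul]
      rw [show 1 / (1 + c) * ((1 + c) * (1 + c)) = 1 + c by field_simp,
        show 1 / (1 + c) * (1 + c) = 1 by field_simp, two_smul, one_smul]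
      abel
    rw [e] at h
    exact sub_nonneg.1 h
  have h5 : (2 : ℝ) • T - (1 / (1 + c)) • 1 ≤ T + (1 + t) • (T - T') + G :=
    (h4.trans h3).trans (add_le_add_left (add_le_add_right
      (conj_le_resolvent_sub ht hH hHH hH' h1 h2 hT h1' h2') T) G)
  have h6 := conjugate_le_conjugate_of_nonneg h5 hF
  rw [mul_sub, sub_mul, mul_add, add_mul, mul_add, add_mul, mul_assoc F G F, hGF, mul_zero,
    add_zero] at h6
  simp only [mul_smul_comm, smul_mul_assoc, mul_one] at h6
  rw [two_smul, sub_le_iff_le_add, add_assoc] at h6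
  have h7 := le_of_add_le_add_left h6
  rwa [add_comm] at h7

end Resolvent

/-- `f'` dominates `f` with arbitrarily many intermediate layers in between. -/
def Deep {A : Type*} [CStarAlgebra A] [PartialOrder A] (f f' : A) : Prop :=
  ∀ m : ℕ, ∃ c : ℕ → A, (∀ i, 0 ≤ c i) ∧ (∀ i, c i ≤ 1) ∧ (∀ i, c (i + 1) * c i = c i) ∧
    c 0 * f = f ∧ f' * c m = c m

namespace IsConeIso

variable {A B : Type*} [CStarAlgebra A] [PartialOrder A] [StarOrderedRing A]
  [CStarAlgebra B] [PartialOrder B] [StarOrderedRing B] {ψ : A → B}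

theorem conj_one_sub_le_of_deep (h : IsConeIso ψ) {f f' : A} (hf : 0 ≤ f) (hf'0 : 0 ≤ f')
    (hf'1 : f' ≤ 1) (hd : Deep f f') {t : ℝ} (ht : 0 < t) (n : ℕ) :
    (n : ℝ) • (ψ f * (1 - ψ f') * ψ f) ≤
      (n * (1 / (1 + t / 10)) + (1 + t)) • (ψ f * ψ f) := by
  obtain ⟨c, hc0, hc1, hcc, hcf, hfc⟩ := hd (3 * n)
  have hF : 0 ≤ ψ f := h.map_nonneg f hf
  have hcf' : ∀ i, c i * f = f := by
    intro i
    induction i with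
    | zero => exact hcf
    | succ i ih => rw [← ih, ← mul_assoc, hcc, ih]
  have hmono : Monotone c := monotone_nat_of_le_succ fun i =>
    le_of_mul_eq (hc0 i) (hc1 i) (hc0 _) (hc1 _) (hcc i)
  have htc : ∀ i, 0 ≤ t • c i := fun i => smul_nonneg ht.le (hc0 i)
  have htc' : ∀ i, 0 ≤ t • (1 - c i) := fun i => smul_nonneg ht.le (sub_nonneg.2 (hc1 i))
  have hH0 : ∀ i, 0 ≤ ψ (t • c i) := fun i => h.map_nonneg _ (htc i)
  choose T hT0 hT1 hT2 using fun i => exists_resolvent (hH0 (3 * i))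
  have horth : ∀ i (x : A), 0 ≤ x → c (i + 1) * x = x → ψ (t • (1 - c (i + 1))) * ψ x = 0 := by
    intro i x hx0 hx
    refine h.orth _ _ (htc' _) hx0 ?_
    rw [smul_mul_assoc, sub_mul, one_mul, hx, sub_self, smul_zero]
  have hstep : ∀ i, ψ f * T i * ψ f ≤ (1 / (1 + t / 10)) • (ψ f * ψ f)
      + (1 + t) • (ψ f * (T i - T (i + 1)) * ψ f) := by
    intro i
    have hGH := horth (3 * i) _ (htc (3 * i)) (by rw [mul_smul_comm, hcc])
    have hG0 := h.map_nonneg _ (htc' (3 * i + 1))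
    refine conj_resolvent_le (G := ψ (t • (1 - c (3 * i + 1)))) ht.le (by positivity) hF
      hGH (horth (3 * i) f hf (hcf' _))
      (star_mul_swap hG0.isSelfAdjoint (hH0 _).isSelfAdjoint (IsSelfAdjoint.zero B) hGH)
      (hH0 _) ?_ ?_ ?_ (hT1 i) (hT2 i) (hT0 i) (hT1 (i + 1)) (hT2 (i + 1))
    · exact h.map_le (htc _) (smul_le_smul_of_nonneg_left (hmono (by omega)) ht.le)
    · refine h.smul_one_le_map_smul_add (k := c (3 * i + 2)) (hc0 _) (hc1 _)
        (sub_nonneg.2 (hc1 _)) (sub_le_self _ (hc0 _)) (hc0 _) (hc1 _) ?_ ?_ ht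
      · have e : c (3 * i + 2) * c (3 * (i + 1)) = c (3 * i + 2) :=
          star_mul_swap (hc0 _).isSelfAdjoint (hc0 _).isSelfAdjoint (hc0 _).isSelfAdjoint
            (hcc (3 * i + 2))
        rw [mul_sub, mul_one, e, sub_self]
      · rw [sub_sub_cancel, sub_mul, one_mul, hcc, sub_self]
    · refine (sub_le_self _ (hH0 _)).trans ((h.le_smul_one_iff (htc _) ht.le).2 ?_)
      exact smul_le_smul_of_nonneg_left (hc1 _) ht.le
  have hlow : ∀ i, i ≤ n → ψ f * (1 - ψ f') * ψ f ≤ ψ f * T i * ψ f := by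
    intro i hi
    refine conjugate_le_conjugate_of_nonneg ?_ hF
    have hT' : 0 ≤ 1 - T i := sub_nonneg.2 (resolvent_le_one (hH0 _) (hT1 i) (hT2 i))
    obtain ⟨d, hd0, hdT⟩ := h.surj _ hT'
    have hd1 : d ≤ 1 := by
      have := (h.le_smul_one_iff hd0 zero_le_one).1
        (show ψ d ≤ (1 : ℝ) • 1 by rw [hdT, one_smul]; exact sub_le_self _ (hT0 i))
      rwa [one_smul] at this
    have hdc : d ≤ t • c (3 * i) := by
      rw [h.le_iff _ _ hd0 (htc _), hdT]
      exact sub_two_add_inv_nonneg (hH0 _) (hT0 i) (hT1 i) (hT2 i)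
    have hfci : f' * c (3 * i) = c (3 * i) :=
      mul_eq_of_le (hc0 _) (hmono (by omega)) hf'0.isSelfAdjoint hfc
    have hfd := mul_eq_of_le hd0 hdc hf'0.isSelfAdjoint (by rw [mul_smul_comm, hfci])
    have hle := h.map_le hd0 (le_of_mul_eq hd0 hd1 hf'0 hf'1 hfd)
    rw [hdT] at hle
    rwa [sub_le_comm]
  have hsum : ∀ k, k ≤ n → (k : ℝ) • (ψ f * (1 - ψ f') * ψ f) ≤
      (k * (1 / (1 + t / 10))) • (ψ f * ψ f) + (1 + t) • (ψ f * (T 0 - T k) * ψ f) := by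
    intro k hk
    induction k with
    | zero => simp
    | succ k ih =>
      have e : ((k + 1 : ℕ) : ℝ) • (ψ f * (1 - ψ f') * ψ f) =
          (k : ℝ) • (ψ f * (1 - ψ f') * ψ f) + ψ f * (1 - ψ f') * ψ f := by
        push_cast; rw [add_smul, one_smul]
      rw [e]
      refine (add_le_add (ih (by omega)) ((hlow k (by omega)).trans (hstep k))).trans_eq ?_
      have e2 : ψ f * (T 0 - T (k + 1)) * ψ f =
          ψ f * (T 0 - T k) * ψ f + ψ f * (T k - T (k + 1)) * ψ f := by noncomm_ring
      rw [e2]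
      push_cast
      rw [add_mul, one_mul, add_smul _ (1 / (1 + t / 10)) (ψ f * ψ f), smul_add]
      abel
  refine (hsum n le_rfl).trans ?_
  rw [add_smul (n * (1 / (1 + t / 10)))]
  have hle : ψ f * (T 0 - T n) * ψ f ≤ ψ f * ψ f := by
    calc _ ≤ ψ f * 1 * ψ f := by
          refine conjugate_le_conjugate_of_nonneg ?_ hF
          exact (sub_le_self _ (hT0 n)).trans (resolvent_le_one (hH0 _) (hT1 0) (hT2 0))
      _ = _ := by rw [mul_one]
  exact add_le_add le_rfl (smul_le_smul_of_nonneg_left hle (by positivity : (0 : ℝ) ≤ 1 + t))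

theorem map_mul_map_of_deep (h : IsConeIso ψ) {f f' : A} (hf : 0 ≤ f) (hf'0 : 0 ≤ f')
    (hf'1 : f' ≤ 1) (hd : Deep f f') : ψ f' * ψ f = ψ f := by
  have hF : 0 ≤ ψ f := h.map_nonneg f hf
  have hFF : 0 ≤ ψ f * ψ f := hF.isSelfAdjoint.mul_self_nonneg
  have hF1 : 0 ≤ 1 - ψ f' := sub_nonneg.2 (by rw [← h.map_one]; exact h.map_le hf'0 hf'1)
  have key : ψ f * (1 - ψ f') * ψ f ≤ 0 := by
    refine nonpos_of_forall_le_smul (y := ψ f * ψ f) fun ε hε => ?_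
    set t : ℝ := 20 / ε with htdef
    have ht : 0 < t := by positivity
    obtain ⟨n, hn⟩ := exists_nat_gt (2 * (1 + t) / ε)
    have hn0 : (0 : ℝ) < n := lt_trans (by positivity) hn
    have h1 := smul_le_smul_of_nonneg_left (h.conj_one_sub_le_of_deep hf hf'0 hf'1 hd ht n)
      (inv_pos.2 hn0).le
    rw [smul_smul, inv_mul_cancel₀ hn0.ne', one_smul, smul_smul] at h1
    refine h1.trans (smul_le_smul_of_nonneg_right ?_ hFF)
    rw [mul_add, ← mul_assoc, inv_mul_cancel₀ hn0.ne', one_mul]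
    have h2 : 1 / (1 + t / 10) ≤ ε / 2 := by
      rw [htdef, div_le_iff₀ (by positivity)]
      have : ε / 2 * (1 + 20 / ε / 10) = ε / 2 + 1 := by field_simp; ring
      linarith
    have h3 : (n : ℝ)⁻¹ * (1 + t) ≤ ε / 2 := by
      rw [inv_mul_le_iff₀ hn0]
      rw [div_lt_iff₀ hε] at hn
      linarith
    linarith
  have h0 := mul_eq_zero_of_conj_nonpos (x := ψ f) hF1 (by rwa [hF.isSelfAdjoint.star_eq])
  rw [sub_mul, one_mul, sub_eq_zero] at h0
  exact h0.symm

theorem map_smul_mul_map_of_deep (h : IsConeIso ψ) {f f' : A} (hf : 0 ≤ f) (hf'0 : 0 ≤ f')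
    (hf'1 : f' ≤ 1) (hd : Deep f f') {s : ℝ} (hs : 0 < s) : ψ (s • f') * ψ f = s • ψ f := by
  have hd' : Deep (s⁻¹ • f) f' := by
    intro m
    obtain ⟨c, hc0, hc1, hcc, hcf, hfc⟩ := hd m
    exact ⟨c, hc0, hc1, hcc, by rw [mul_smul_comm, hcf], hfc⟩
  have h1 := (h.scale hs).map_mul_map_of_deep (smul_nonneg (inv_pos.2 hs).le hf) hf'0 hf'1 hd'
  simp only [smul_smul, mul_inv_cancel₀ hs.ne', one_smul, smul_mul_smul_comm] at h1
  have h2 := congrArg (fun x => (s * s) • x) h1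
  simp only [smul_smul] at h2
  rwa [show s * s * (s⁻¹ * s⁻¹) = 1 by field_simp, one_smul,
    show s * s * s⁻¹ = s by field_simp] at h2

end IsConeIso

/-- Truncation of a real number to the unit interval. -/
def clamp (x : ℝ) : ℝ := max 0 (min 1 x)

@[fun_prop]
theorem continuous_clamp : Continuous clamp := by unfold clamp; fun_prop

theorem clamp_nonneg (x : ℝ) : 0 ≤ clamp x := le_max_left _ _

theorem clamp_le_one (x : ℝ) : clamp x ≤ 1 := max_le zero_le_one (min_le_left _ _)

theorem clamp_of_nonpos {x : ℝ} (hx : x ≤ 0) : clamp x = 0 :=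
  max_eq_left ((min_le_right _ _).trans hx)

theorem clamp_of_one_le {x : ℝ} (hx : 1 ≤ x) : clamp x = 1 := by
  simp [clamp, min_eq_left hx]

theorem clamp_mono : Monotone clamp := fun x y h => by
  unfold clamp; gcongr

section Clamp

variable {A : Type*} [CStarAlgebra A] [PartialOrder A] [StarOrderedRing A]

theorem cfc_mul_cfc_eq {a : A} {f g : ℝ → ℝ} (hf : Continuous f) (hg : Continuous g)
    (hfg : ∀ x, g x = 0 ∨ f x = 1) : cfc f a * cfc g a = cfc g a := by
  rw [← cfc_mul f g a]
  refine cfc_congr fun x _ => ?_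
  rcases hfg x with h | h <;> simp [h]

/-- The continuous spectral cut-off of `a` rising from `0` to `1` on `[r, r + 1]`. -/
noncomputable def cut (a : A) (r : ℝ) : A := cfc (fun x => clamp (x - r)) a

theorem cut_nonneg (a : A) (r : ℝ) : 0 ≤ cut a r := cfc_nonneg fun _ _ => clamp_nonneg _

theorem cut_le_one (a : A) (r : ℝ) : cut a r ≤ 1 := cfc_le_one _ _ fun _ _ => clamp_le_one _

theorem cut_mul_cut (a : A) {r s : ℝ} (h : r + 1 ≤ s) : cut a r * cut a s = cut a s := by
  refine cfc_mul_cfc_eq (by fun_prop) (by fun_prop) fun x => ?_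
  rcases le_total x s with hx | hx
  · exact Or.inl (clamp_of_nonpos (by linarith))
  · exact Or.inr (clamp_of_one_le (by linarith))

theorem cut_antitone (a : A) : Antitone (cut a) := fun r s h =>
  cfc_mono fun x _ => clamp_mono (by linarith)

theorem cut_eq_one {a : A} (ha : IsSelfAdjoint a) {r : ℝ} (h : (r + 1) • 1 ≤ a) :
    cut a r = 1 := by
  rw [← Algebra.algebraMap_eq_smul_one, algebraMap_le_iff_le_spectrum] at h
  rw [← cfc_const_one ℝ a]
  exact cfc_congr fun x hx => clamp_of_one_le (by linarith [h x hx])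

theorem cut_eq_zero {a : A} (ha : IsSelfAdjoint a) {r : ℝ} (h : a ≤ r • 1) : cut a r = 0 := by
  rw [← Algebra.algebraMap_eq_smul_one, le_algebraMap_iff_spectrum_le] at h
  rw [← cfc_const_zero ℝ a]
  exact cfc_congr fun x hx => clamp_of_nonpos (by linarith [h x hx])

theorem deep_cut (a : A) {r s : ℝ} (h : r + 2 ≤ s) : Deep (cut a s) (cut a r) := by
  intro m
  have hR : (0 : ℝ) < m + 1 := by positivity
  have hRi : ∀ i : ℕ, ((m : ℝ) + 1) * ((i + 1) / (m + 1)) = i + 1 := fun i => by field_simp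
  refine ⟨fun i => cfc (fun x => clamp ((m + 1) * (x - (s - (i + 1) / (m + 1))))) a,
    fun i => cfc_nonneg fun _ _ => clamp_nonneg _, fun i => cfc_le_one _ _ fun _ _ => clamp_le_one _,
    fun i => cfc_mul_cfc_eq (by fun_prop) (by fun_prop) fun x => ?_,
    cfc_mul_cfc_eq (by fun_prop) (by fun_prop) fun x => ?_,
    cfc_mul_cfc_eq (by fun_prop) (by fun_prop) fun x => ?_⟩
  · rcases le_total ((m + 1) * (x - (s - (i + 1) / (m + 1)))) 0 with hx | hx
    · exact Or.inl (clamp_of_nonpos hx)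
    · refine Or.inr (clamp_of_one_le ?_)
      have h1 := hRi i
      have h2 := hRi (i + 1)
      push_cast at h2 ⊢
      nlinarith
  · rcases le_total x s with hx | hx
    · exact Or.inl (clamp_of_nonpos (by linarith))
    · refine Or.inr (clamp_of_one_le ?_)
      have h1 := hRi 0
      push_cast at h1 ⊢
      nlinarith
  · rcases le_total x (r + 1) with hx | hx
    · refine Or.inl (clamp_of_nonpos (mul_nonpos_of_nonneg_of_nonpos hR.le ?_))
      rw [div_self hR.ne']
      linarith
    · exact Or.inr (clamp_of_one_le (by linarith))

end Clamp

namespace IsConeIso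

variable {A B : Type*} [CStarAlgebra A] [PartialOrder A] [StarOrderedRing A]
  [CStarAlgebra B] [PartialOrder B] [StarOrderedRing B] {ψ : A → B}

theorem map_cut_mul_map_cut (h : IsConeIso ψ) (a : A) {r s : ℝ} (hrs : r + 2 ≤ s) :
    ψ (cut a r) * ψ (cut a s) = ψ (cut a s) :=
  h.map_mul_map_of_deep (cut_nonneg a s) (cut_nonneg a r) (cut_le_one a r) (deep_cut a hrs)

theorem map_cut_mul_map_cut' (h : IsConeIso ψ) (a : A) {r s : ℝ} (hrs : r + 2 ≤ s) :
    ψ (cut a s) * ψ (cut a r) = ψ (cut a s) :=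
  have hs := fun r => (h.map_nonneg _ (cut_nonneg a r)).isSelfAdjoint
  star_mul_swap (hs r) (hs s) (hs s) (h.map_cut_mul_map_cut a hrs)

theorem map_nonneg_le_one (h : IsConeIso ψ) {x : A} (h0 : 0 ≤ x) (h1 : x ≤ 1) :
    0 ≤ ψ x ∧ ψ x ≤ 1 :=
  ⟨h.map_nonneg x h0, by rw [← h.map_one]; exact h.map_le h0 h1⟩

/-- An upper bound for the image of an element that is constant below a spectral cut. -/
theorem map_le_of_le_cut (h : IsConeIso ψ) {a y : A} {κ s : ℝ} (hκ0 : 0 < κ) (hκ1 : κ ≤ 1)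
    (hy0 : 0 ≤ y) (hy : y ≤ κ • 1 + (1 - κ) • cut a s) :
    ψ y ≤ κ • 1 + (1 - κ) • ψ (cut a (s - 1)) := by
  set E := ψ (cut a (s - 1)) with hE
  obtain ⟨hE0, hE1⟩ := h.map_nonneg_le_one (cut_nonneg a (s - 1)) (cut_le_one a (s - 1))
  have hτ : 0 ≤ 1 - κ := sub_nonneg.2 hκ1
  have e1 : κ • (1 : B) + (1 - κ) • 1 = 1 := by rw [← add_smul]; simp
  have hV0 : κ • 1 ≤ κ • 1 + (1 - κ) • E := le_add_of_nonneg_right (smul_nonneg hτ hE0)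
  have hV1 : κ • 1 + (1 - κ) • E ≤ (1 : ℝ) • 1 := by
    rw [one_smul]; nth_rw 2 [← e1]; gcongr
  have hVE : E ≤ κ • 1 + (1 - κ) • E := by
    calc E = κ • E + (1 - κ) • E := by rw [← add_smul]; simp
      _ ≤ _ := by gcongr
  obtain ⟨d, hd0, hdV⟩ := h.surj _ ((smul_nonneg hκ0.le zero_le_one).trans hV0)
  rw [← hdV] at hV0 hV1 hVE ⊢
  have hd1 := (h.le_smul_one_iff hd0 zero_le_one).1 hV1
  rw [one_smul] at hd1
  have hdκ := (h.smul_one_le_iff hd0 hκ0.le).1 hV0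
  have hdE := (h.le_iff _ _ (cut_nonneg a (s - 1)) hd0).2 hVE
  have hds : (1 - d) * cut a s = 0 := by
    refine mul_eq_zero_of_le (sub_nonneg.2 hd1) (sub_le_sub_left hdE 1) ?_
    rw [sub_mul, one_mul, cut_mul_cut a (by linarith), sub_self]
  have hds' := star_mul_swap (sub_nonneg.2 hd1).isSelfAdjoint (cut_nonneg a s).isSelfAdjoint
    (IsSelfAdjoint.zero A) hds
  have h1 : 1 - d ≤ (1 - κ) • (1 - cut a s) := by
    refine le_smul_of_mul_eq hτ (sub_nonneg.2 hd1) ?_ (sub_nonneg.2 (cut_le_one a s))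
      (sub_le_self _ (cut_nonneg a s)) ?_
    · rw [sub_smul, one_smul]; gcongr
    · rw [sub_mul, one_mul, hds', sub_zero]
  refine h.map_le hy0 (hy.trans ?_)
  rw [sub_le_comm] at h1
  refine le_trans (le_of_eq ?_) h1
  rw [smul_sub, sub_smul 1 κ 1, one_smul]
  abel

/-- On a spectral window where an element is constant, so is its image. -/
theorem map_mul_window (h : IsConeIso ψ) {a y : A} {κ r s p q : ℝ} (hκ0 : 0 < κ) (hκ1 : κ ≤ 1)
    (hy1 : κ • cut a r ≤ y) (hy2 : y ≤ κ • 1 + (1 - κ) • cut a s)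
    (hp : r + 2 ≤ p) (hp' : p ≤ s - 3) (hq : r + 2 ≤ q) (hq' : q ≤ s - 3) :
    ψ y * (ψ (cut a p) - ψ (cut a q)) = κ • (ψ (cut a p) - ψ (cut a q)) := by
  have hκr : 0 ≤ κ • cut a r := smul_nonneg hκ0.le (cut_nonneg a r)
  have hy0 := hκr.trans hy1
  set w := ψ (cut a p) - ψ (cut a q) with hw
  have hws : IsSelfAdjoint w := (h.map_nonneg _ (cut_nonneg a p)).isSelfAdjoint.sub
    (h.map_nonneg _ (cut_nonneg a q)).isSelfAdjoint
  have hEw : ψ (cut a (s - 1)) * w = 0 := by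
    rw [hw, mul_sub, h.map_cut_mul_map_cut' a (by linarith), h.map_cut_mul_map_cut' a (by linarith),
      sub_self]
  have hHw : ψ (κ • cut a r) * w = κ • w := by
    have key : ∀ p, r + 2 ≤ p → ψ (κ • cut a r) * ψ (cut a p) = κ • ψ (cut a p) := fun p hp =>
      h.map_smul_mul_map_of_deep (cut_nonneg a p) (cut_nonneg a r) (cut_le_one a r)
        (deep_cut a hp) hκ0
    rw [hw, mul_sub, key p hp, key q hq, smul_sub]
  set U := κ • 1 + (1 - κ) • ψ (cut a (s - 1)) with hU
  have hUw : U * w = κ • w := by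
    rw [hU, add_mul, smul_mul_assoc, smul_mul_assoc, hEw, smul_zero, add_zero, one_mul]
  have hyU : ψ y ≤ U := h.map_le_of_le_cut hκ0 hκ1 hy0 hy2
  have hZ : (U - ψ y) * w = 0 := by
    refine mul_eq_zero_of_conj_nonpos (sub_nonneg.2 hyU) ?_
    have h1 := star_left_conjugate_le_conjugate (h.map_le hκr hy1) w
    rw [mul_assoc, hHw] at h1
    rw [mul_sub (star w), sub_mul _ _ w, mul_assoc, hUw]
    exact sub_nonpos.2 h1
  rw [sub_mul, hUw, sub_eq_zero] at hZ
  exact hZ.symm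

end IsConeIso

/-- A staircase function with `n` unit steps located at `c, c + 10, c + 20, …`. -/
def stair (n : ℕ) (c x : ℝ) : ℝ := ∑ j ∈ Finset.range n, clamp (x - (10 * j + c))

@[fun_prop]
theorem continuous_stair (n : ℕ) (c : ℝ) : Continuous (stair n c) := by
  unfold stair; fun_prop

theorem stair_antitone (n : ℕ) {c d : ℝ} (h : c ≤ d) (x : ℝ) : stair n d x ≤ stair n c x :=
  Finset.sum_le_sum fun j _ => clamp_mono (by linarith)

theorem stair_le (n : ℕ) (c x : ℝ) : stair n c x ≤ n := by
  simpa [stair] using Finset.sum_le_card_nsmul (Finset.range n) (fun j => clamp (x - (10 * j + c))) 1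
    fun j _ => clamp_le_one _

theorem stair_nonneg (n : ℕ) (c x : ℝ) : 0 ≤ stair n c x :=
  Finset.sum_nonneg fun _ _ => clamp_nonneg _

theorem min_div_le_stair (n : ℕ) (x : ℝ) : min x (10 * n) / 10 ≤ stair n 0 x := by
  induction n with
  | zero =>
    have := min_le_right x 0
    simp only [stair, Nat.cast_zero, mul_zero, Finset.range_zero, Finset.sum_empty]
    linarith
  | succ n ih =>
    rw [stair, Finset.sum_range_succ, ← stair]
    push_cast
    rcases le_total x (10 * n) with hx | hx
    · rw [min_eq_left hx] at ih
      have := clamp_nonneg (x - (10 * n + 0))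
      have := min_le_left x (10 * (n + 1 : ℝ))
      linarith
    · rw [min_eq_right hx] at ih
      have h1 := min_le_right x (10 * (n + 1 : ℝ))
      have h2 := min_le_left x (10 * (n + 1 : ℝ))
      rcases le_total (x - (10 * n + 0)) 1 with h | h
      · have : x - (10 * n + 0) ≤ clamp (x - (10 * n + 0)) := by
          rw [clamp, min_eq_right h]; exact le_max_right _ _
        linarith
      · rw [clamp_of_one_le h]; linarith

theorem stair_le_div (n : ℕ) {x : ℝ} (hx0 : 0 ≤ x) : stair n 10 x ≤ x / 10 := by
  induction n with
  | zero => simp [stair]; positivity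
  | succ n ih =>
    rcases le_total x (10 * n + 10) with hx | hx
    · rw [stair, Finset.sum_range_succ, ← stair, clamp_of_nonpos (by linarith)]
      linarith
    · have := stair_le (n + 1) 10 x
      push_cast at this
      linarith

theorem stair_lower {n j : ℕ} (hj : j ≤ n) (c x : ℝ) :
    j * clamp (x - (10 * (j - 1) + c)) ≤ stair n c x := by
  have h1 : (Finset.range j).card • clamp (x - (10 * (j - 1) + c)) ≤
      ∑ i ∈ Finset.range j, clamp (x - (10 * i + c)) := by
    refine Finset.card_nsmul_le_sum _ _ _ fun i hi => clamp_mono ?_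
    have : (i : ℝ) + 1 ≤ j := by exact_mod_cast Finset.mem_range.1 hi
    linarith
  rw [Finset.card_range, nsmul_eq_mul] at h1
  exact h1.trans (Finset.sum_le_sum_of_subset_of_nonneg (Finset.range_mono hj)
    fun _ _ _ => clamp_nonneg _)

theorem stair_upper {n j : ℕ} (hj : j ≤ n) (c x : ℝ) :
    stair n c x ≤ j + (n - j) * clamp (x - (10 * j + c)) := by
  rw [stair, ← Finset.sum_range_add_sum_Ico _ hj]
  refine add_le_add (stair_le j c x) ?_
  have h1 : ∑ i ∈ Finset.Ico j n, clamp (x - (10 * i + c)) ≤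
      (Finset.Ico j n).card • clamp (x - (10 * j + c)) := by
    refine Finset.sum_le_card_nsmul _ _ _ fun i hi => clamp_mono ?_
    have : (j : ℝ) ≤ i := by exact_mod_cast (Finset.mem_Ico.1 hi).1
    linarith
  rwa [Nat.card_Ico, nsmul_eq_mul, Nat.cast_sub hj] at h1

section Steps

variable {A : Type*} [CStarAlgebra A] [PartialOrder A] [StarOrderedRing A]

/-- The staircase approximation of `m / N + a / (10 N)` with `n` steps and offset `c`. -/
noncomputable def steps (a : A) (n m N : ℕ) (c : ℝ) : A := cfc (fun x => (m + stair n c x) / N) a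

theorem steps_nonneg (a : A) (n m N : ℕ) (c : ℝ) : 0 ≤ steps a n m N c :=
  cfc_nonneg fun x _ => div_nonneg (add_nonneg m.cast_nonneg (stair_nonneg n c x)) N.cast_nonneg

theorem steps_antitone (a : A) (n m N : ℕ) {c d : ℝ} (h : c ≤ d) :
    steps a n m N d ≤ steps a n m N c :=
  cfc_mono fun x _ => div_le_div_of_nonneg_right (by gcongr; exact stair_antitone n h x)
    N.cast_nonneg

theorem cfc_affine {a : A} (ha : IsSelfAdjoint a) (m N : ℕ) :
    cfc (fun x : ℝ => (m + x / 10) / N) a = (m / N : ℝ) • 1 + (1 / (10 * N) : ℝ) • a := by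
  have e : (fun x : ℝ => ((m : ℝ) + x / 10) / N) = fun x => (m / N : ℝ) + (1 / (10 * N)) * x := by
    funext x; rw [add_div, div_div, div_mul_eq_mul_div, one_mul]
  rw [e, cfc_const_add _ _ a, cfc_const_mul_id _ a, Algebra.algebraMap_eq_smul_one]

theorem le_steps {a : A} (ha : IsSelfAdjoint a) {n : ℕ} (han : a ≤ (10 * n : ℝ) • 1) (m N : ℕ) :
    (m / N : ℝ) • 1 + (1 / (10 * N) : ℝ) • a ≤ steps a n m N 0 := by
  rw [← cfc_affine ha]
  rw [← Algebra.algebraMap_eq_smul_one, le_algebraMap_iff_spectrum_le] at han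
  refine cfc_mono fun x hx => div_le_div_of_nonneg_right ?_ N.cast_nonneg
  have := min_div_le_stair n x
  rw [min_eq_left (han x hx)] at this
  gcongr

theorem steps_le {a : A} (ha : 0 ≤ a) (n m N : ℕ) :
    steps a n m N 10 ≤ (m / N : ℝ) • 1 + (1 / (10 * N) : ℝ) • a := by
  rw [← cfc_affine ha.isSelfAdjoint]
  refine cfc_mono fun x hx => div_le_div_of_nonneg_right ?_ N.cast_nonneg
  gcongr
  exact stair_le_div n (spectrum_nonneg_of_nonneg ha hx)

theorem smul_cut_le_steps (a : A) {n j : ℕ} (hj : j ≤ n) (m N : ℕ) (c : ℝ) :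
    ((m + j : ℝ) / N) • cut a (10 * (j - 1) + c) ≤ steps a n m N c := by
  rw [cut, ← cfc_const_mul _ _ a]
  refine cfc_mono fun x _ => ?_
  rw [div_mul_eq_mul_div]
  refine div_le_div_of_nonneg_right ?_ N.cast_nonneg
  rw [add_mul]
  exact add_le_add (mul_le_of_le_one_right m.cast_nonneg (clamp_le_one _)) (stair_lower hj c x)

theorem steps_le_cut (a : A) (ha : IsSelfAdjoint a) {n j m N : ℕ} (hN : 0 < N) (hj : j ≤ n)
    (hnm : n + m ≤ N) (c : ℝ) :
    steps a n m N c ≤ ((m + j : ℝ) / N) • 1 + (1 - (m + j : ℝ) / N) • cut a (10 * j + c) := by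
  rw [cut, ← cfc_const_mul _ _ a, ← Algebra.algebraMap_eq_smul_one, ← cfc_const_add _ _ a]
  refine cfc_mono fun x _ => ?_
  have hN' : (0 : ℝ) < N := by exact_mod_cast hN
  have hnm' : (n : ℝ) + m ≤ N := by exact_mod_cast hnm
  have h1 := stair_upper hj c x
  have h2 := clamp_nonneg (x - (10 * j + c))
  rw [div_le_iff₀ hN', add_mul, div_mul_cancel₀ _ hN'.ne', mul_right_comm, sub_mul,
    div_mul_cancel₀ _ hN'.ne']
  nlinarith

end Steps

section Sandwich

variable {B : Type*} [CStarAlgebra B] [PartialOrder B] [StarOrderedRing B]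

theorem norm_sub_le_of_sandwich {l P Q : B} {ε : ℝ} (hε : 0 ≤ ε)
    (hP : l ≤ P) (hPu : P - l ≤ ε • 1) (hQ : l ≤ Q) (hQu : Q - l ≤ ε • 1) :
    ‖P - Q‖ ≤ 2 * ε := by
  have h1 := (norm_le_iff_le_smul_one (sub_nonneg.2 hP) hε).2 hPu
  have h2 := (norm_le_iff_le_smul_one (sub_nonneg.2 hQ) hε).2 hQu
  calc ‖P - Q‖ = ‖(P - l) - (Q - l)‖ := by rw [sub_sub_sub_cancel_right]
    _ ≤ ‖P - l‖ + ‖Q - l‖ := norm_sub_le _ _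
    _ ≤ 2 * ε := by linarith

end Sandwich

namespace IsConeIso

variable {A B : Type*} [CStarAlgebra A] [PartialOrder A] [StarOrderedRing A]
  [CStarAlgebra B] [PartialOrder B] [StarOrderedRing B] {ψ : A → B}

theorem map_steps_mul_window (h : IsConeIso ψ) {a : A} (ha : IsSelfAdjoint a) {n j m N : ℕ}
    (hN : 0 < N) (hj : j ≤ n) (hmj : 0 < m + j) (hnm : n + m ≤ N) {c p q : ℝ}
    (hp : 10 * (j - 1) + c + 2 ≤ p) (hp' : p ≤ 10 * j + c - 3)
    (hq : 10 * (j - 1) + c + 2 ≤ q) (hq' : q ≤ 10 * j + c - 3) :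
    ψ (steps a n m N c) * (ψ (cut a p) - ψ (cut a q)) =
      ((m + j : ℝ) / N) • (ψ (cut a p) - ψ (cut a q)) := by
  have hN' : (0 : ℝ) < N := by exact_mod_cast hN
  have hnm' : (n : ℝ) + m ≤ N := by exact_mod_cast hnm
  have hmj' : (0 : ℝ) < m + j := by exact_mod_cast hmj
  have hj' : (j : ℝ) ≤ n := by exact_mod_cast hj
  exact h.map_mul_window (by positivity) ((div_le_one hN').2 (by linarith))
    (smul_cut_le_steps a hj m N c) (steps_le_cut a ha hN hj hnm c) hp hp' hq hq'

/-- A sum of spectral windows of length `5`, spaced by `10`. -/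
noncomputable def comb (ψ : A → B) (a : A) (L : ℕ) (d : ℝ) : B :=
  ∑ i ∈ Finset.range L, (ψ (cut a (10 * i + d)) - ψ (cut a (10 * i + d + 5)))

theorem comb_nonneg (h : IsConeIso ψ) (a : A) (L : ℕ) (d : ℝ) : 0 ≤ comb ψ a L d :=
  Finset.sum_nonneg fun i _ => sub_nonneg.2 (h.map_le (cut_nonneg a _)
    (cut_antitone a (by linarith)))

theorem comb_add_comb (h : IsConeIso ψ) {a : A} {L : ℕ} (ha1 : (20 : ℝ) • 1 ≤ a)
    (ha2 : a ≤ (10 * L + 10 : ℝ) • 1) (ha : IsSelfAdjoint a) :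
    comb ψ a L 12 + comb ψ a L 17 = 1 := by
  have h1 : ∀ k : ℕ, comb ψ a k 12 + comb ψ a k 17 = ψ (cut a 12) - ψ (cut a (10 * k + 12)) := by
    intro k
    induction k with
    | zero => simp [comb]
    | succ k ih =>
      have e : comb ψ a (k + 1) 12 + comb ψ a (k + 1) 17 = comb ψ a k 12 + comb ψ a k 17
          + (ψ (cut a (10 * k + 12)) - ψ (cut a (10 * k + 12 + 5)))
          + (ψ (cut a (10 * k + 17)) - ψ (cut a (10 * k + 17 + 5))) := by
        simp only [comb, Finset.sum_range_succ]; abel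
      rw [e, ih]
      have e1 : (10 * k + 12 + 5 : ℝ) = 10 * k + 17 := by ring
      have e2 : (10 * ((k + 1 : ℕ) : ℝ) + 12) = 10 * k + 17 + 5 := by push_cast; ring
      rw [e1, e2]; abel
  rw [h1, cut_eq_one ha (le_trans ?_ ha1), cut_eq_zero ha (ha2.trans ?_), h.map_one, h.map_zero,
    sub_zero]
  · exact smul_le_smul_of_nonneg_right (by linarith) zero_le_one
  · exact smul_le_smul_of_nonneg_right (by norm_num) zero_le_one

theorem sub_mul_comb (h : IsConeIso ψ) {a : A} (ha : IsSelfAdjoint a) {L m m' N k k' : ℕ}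
    (hN : 0 < N) (hm : L + 3 + m ≤ N) (hm' : L + 3 + m' ≤ N) {c c' d : ℝ} (hk : k ≤ 3)
    (hk' : k' ≤ 3) (hk1 : 1 ≤ k) (hk1' : 1 ≤ k') (hc : c + 10 * k = d + 8)
    (hc' : c' + 10 * k' = d + 8) :
    (ψ (steps a (L + 3) m N c) - ψ (steps a (L + 3) m' N c')) * comb ψ a L d =
      (((m + k : ℝ) - (m' + k')) / N) • comb ψ a L d := by
  rw [comb, Finset.mul_sum, Finset.smul_sum]
  refine Finset.sum_congr rfl fun i hi => ?_
  have hi := Finset.mem_range.1 hi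
  have hi0 : (0 : ℝ) ≤ i := i.cast_nonneg
  rw [sub_mul, h.map_steps_mul_window (j := i + k) ha hN (by omega) (by omega) hm,
    h.map_steps_mul_window (j := i + k') ha hN (by omega) (by omega) hm', ← sub_smul]
  · congr 1
    push_cast
    ring
  all_goals (push_cast; linarith)

theorem sub_le_of_sandwich (h : IsConeIso ψ) {a : A} {L m N : ℕ} (ha1 : (20 : ℝ) • 1 ≤ a)
    (ha2 : a ≤ (10 * L + 10 : ℝ) • 1) (ha : IsSelfAdjoint a) (hN : 0 < N) (hm : L + 3 + m ≤ N)
    {P : B} (h1 : ψ (steps a (L + 3) m N 10) ≤ P) (h2 : P ≤ ψ (steps a (L + 3) m N 0))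
    (h3 : P ≤ ψ (steps a (L + 3) m N (-5))) :
    P - ψ (steps a (L + 3) m N 10) ≤ (8 / N : ℝ) • 1 := by
  have hN' : (0 : ℝ) < N := by exact_mod_cast hN
  have hsum := h.comb_add_comb ha1 ha2 ha
  have hT := h.comb_nonneg a L 12
  have hT' := h.comb_nonneg a L 17
  have hanti : ∀ {c d : ℝ}, c ≤ d → ψ (steps a (L + 3) m N d) ≤ ψ (steps a (L + 3) m N c) :=
    fun hcd => h.map_le (steps_nonneg _ _ _ _ _) (steps_antitone a _ m N hcd)
  have key : ∀ (T : B) (s : ℝ) (Z : B), 0 ≤ T → T ≤ 1 → 0 ≤ s → s ≤ 2 / N → Z * T = s • T →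
      P - ψ (steps a (L + 3) m N 10) ≤ Z →
      T * (P - ψ (steps a (L + 3) m N 10)) * T ≤ (2 / N : ℝ) • 1 := by
    intro T s Z hT0 hT1 hs0 hs hZ hle
    calc _ ≤ T * Z * T := conjugate_le_conjugate_of_nonneg hle hT0
      _ = s • (T * T) := by rw [mul_assoc, hZ, mul_smul_comm]
      _ ≤ s • 1 := smul_le_smul_of_nonneg_left ((sq_le_self hT0 hT1).trans hT1) hs0
      _ ≤ _ := smul_le_smul_of_nonneg_right hs zero_le_one
  have e1 := h.sub_mul_comb ha hN hm hm (k := 2) (k' := 1) (c := 0) (c' := 10) (d := 12)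
    (by norm_num) (by norm_num) (by norm_num) (by norm_num) (by norm_num) (by norm_num)
  have e2 := h.sub_mul_comb ha hN hm hm (k := 3) (k' := 1) (c := -5) (c' := 15) (d := 17)
    (by norm_num) (by norm_num) (by norm_num) (by norm_num) (by norm_num) (by norm_num)
  have := le_of_conj_le (sub_nonneg.2 h1) hT.isSelfAdjoint hT'.isSelfAdjoint hsum
    (key _ _ _ hT (hsum ▸ le_add_of_nonneg_right hT') ?_ ?_ e1 (sub_le_sub_right h2 _))
    (key _ _ _ hT' (hsum ▸ le_add_of_nonneg_left hT) ?_ ?_ e2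
      (sub_le_sub h3 (hanti (by norm_num))))
  · convert this using 2; ring
  all_goals
    first
    | exact div_nonneg (by norm_num) hN'.le
    | exact div_le_div_of_nonneg_right (by norm_num) hN'.le

/-- Up to `O(1 / N)`, the map is additive with respect to the scalar `m / N`. -/
theorem norm_map_add_sub_le (h : IsConeIso ψ) {a : A} {L m N : ℕ} (ha1 : (20 : ℝ) • 1 ≤ a)
    (ha2 : a ≤ (10 * L + 10 : ℝ) • 1) (hN : 0 < N) (hm : L + 3 + m ≤ N) :
    ‖ψ ((m / N : ℝ) • 1 + (1 / (10 * N) : ℝ) • a) - ψ ((1 / (10 * N) : ℝ) • a)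
      - (m / N : ℝ) • 1‖ ≤ 64 / N := by
  have ha0 : 0 ≤ a := (smul_nonneg (by norm_num) zero_le_one).trans ha1
  have ha := ha0.isSelfAdjoint
  have hN' : (0 : ℝ) < N := by exact_mod_cast hN
  have han : a ≤ (10 * ((L + 3 : ℕ) : ℝ)) • 1 := ha2.trans
    (smul_le_smul_of_nonneg_right (by push_cast; linarith) zero_le_one)
  have hsand : ∀ k : ℕ, L + 3 + k ≤ N → ∀ c : ℝ, (c = 0 ∨ c = 5) →
      ‖ψ ((k / N : ℝ) • 1 + (1 / (10 * N) : ℝ) • a) - ψ (steps a (L + 3) k N c)‖ ≤ 16 / N := by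
    intro k hk c hc
    have hanti : ∀ {c d : ℝ}, c ≤ d → ψ (steps a (L + 3) k N d) ≤ ψ (steps a (L + 3) k N c) :=
      fun hcd => h.map_le (steps_nonneg _ _ _ _ _) (steps_antitone a _ k N hcd)
    have hz0 : 0 ≤ (k / N : ℝ) • (1 : A) + (1 / (10 * N) : ℝ) • a :=
      add_nonneg (smul_nonneg (by positivity) zero_le_one) (smul_nonneg (by positivity) ha0)
    have hz1 := h.map_le (steps_nonneg _ _ _ _ _) (steps_le ha0 (L + 3) k N)
    have hz2 := h.map_le hz0 (le_steps ha han k N)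
    have hc0 : 0 ≤ c := by rcases hc with rfl | rfl <;> norm_num
    have hc10 : c ≤ 10 := by rcases hc with rfl | rfl <;> norm_num
    have hb1 := h.sub_le_of_sandwich ha1 ha2 ha hN hk hz1 hz2
      (hz2.trans (hanti (by norm_num)))
    have hb2 := h.sub_le_of_sandwich ha1 ha2 ha hN hk (hanti hc10) (hanti hc0)
      (hanti (by linarith))
    refine (norm_sub_le_of_sandwich (by positivity) hz1 hb1 (hanti hc10) hb2).trans_eq ?_
    ring
  have hsum := h.comb_add_comb ha1 ha2 ha
  have hT := h.comb_nonneg a L 12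
  have hT' := h.comb_nonneg a L 17
  set D := ψ ((m / N : ℝ) • 1 + (1 / (10 * N) : ℝ) • a) - ψ ((1 / (10 * N) : ℝ) • a)
      - (m / N : ℝ) • 1 with hD
  have key : ∀ (T : B) (c : ℝ), 0 ≤ T → T ≤ 1 → (c = 0 ∨ c = 5) →
      (ψ (steps a (L + 3) m N c) - ψ (steps a (L + 3) 0 N c)) * T = (m / N : ℝ) • T →
      ‖D * T‖ ≤ 32 / N := by
    intro T c hT0 hT1 hc hTc
    have h1 := hsand m hm c hc
    have h2 := hsand 0 (by omega) c hc
    rw [Nat.cast_zero, zero_div, zero_smul, zero_add] at h2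
    have hTn : ‖T‖ ≤ 1 := (CStarAlgebra.norm_le_one_iff_of_nonneg T hT0).2 hT1
    have e : D * T = ((ψ ((m / N : ℝ) • 1 + (1 / (10 * N) : ℝ) • a) - ψ (steps a (L + 3) m N c))
        - (ψ ((1 / (10 * N) : ℝ) • a) - ψ (steps a (L + 3) 0 N c))) * T := by
      have : D = ((ψ ((m / N : ℝ) • 1 + (1 / (10 * N) : ℝ) • a) - ψ (steps a (L + 3) m N c))
        - (ψ ((1 / (10 * N) : ℝ) • a) - ψ (steps a (L + 3) 0 N c)))
        + ((ψ (steps a (L + 3) m N c) - ψ (steps a (L + 3) 0 N c)) - (m / N : ℝ) • 1) := by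
        rw [hD]; abel
      rw [this, add_mul, sub_mul _ ((m / N : ℝ) • (1 : B)) T, hTc, smul_mul_assoc, one_mul,
        sub_self, add_zero]
    rw [e]
    calc ‖_‖ ≤ (16 / N + 16 / N : ℝ) * 1 := (norm_mul_le _ _).trans
          (mul_le_mul ((norm_sub_le _ _).trans (add_le_add h1 h2)) hTn (norm_nonneg _)
            (by positivity))
      _ = 32 / N := by ring
  have e1 := h.sub_mul_comb ha hN hm (by omega : L + 3 + 0 ≤ N) (k := 2) (k' := 2) (c := 0)
    (c' := 0) (d := 12) (by norm_num) (by norm_num) (by norm_num) (by norm_num) (by norm_num)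
    (by norm_num)
  have e2 := h.sub_mul_comb ha hN hm (by omega : L + 3 + 0 ≤ N) (k := 2) (k' := 2) (c := 5)
    (c' := 5) (d := 17) (by norm_num) (by norm_num) (by norm_num) (by norm_num) (by norm_num)
    (by norm_num)
  simp only [Nat.cast_zero, zero_add, add_sub_cancel_right] at e1 e2
  have f1 := key _ 0 hT (hsum ▸ le_add_of_nonneg_right hT') (Or.inl rfl) e1
  have f2 := key _ 5 hT' (hsum ▸ le_add_of_nonneg_left hT) (Or.inr rfl) e2
  calc ‖D‖ = ‖D * comb ψ a L 12 + D * comb ψ a L 17‖ := by rw [← mul_add, hsum, mul_one]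
    _ ≤ (32 / N + 32 / N : ℝ) := (norm_add_le _ _).trans (add_le_add f1 f2)
    _ = 64 / N := by ring

end IsConeIso

namespace IsConeIso

variable {A B : Type*} [CStarAlgebra A] [PartialOrder A] [StarOrderedRing A]
  [CStarAlgebra B] [PartialOrder B] [StarOrderedRing B] {ψ : A → B}

theorem map_add_inv_smul_one (h : IsConeIso ψ) {a : A} {u : ℝ} {q : ℕ} (hu : 0 < u) (hq : 2 ≤ q)
    (ha : u • 1 ≤ a) (ha' : a ≤ (1 - u - 1 / q) • 1) :
    ψ ((1 / q : ℝ) • 1 + a) = ψ a + (1 / q : ℝ) • 1 := by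
  rw [← sub_eq_zero, ← sub_sub, ← norm_eq_zero]
  by_contra hne
  have hpos := lt_of_le_of_ne (norm_nonneg _) (Ne.symm hne)
  set d := ‖ψ ((1 / q : ℝ) • 1 + a) - ψ a - (1 / q : ℝ) • 1‖
  obtain ⟨k, hk⟩ := exists_nat_gt (64 / d + 2 / u + 3)
  have h64 : 0 < 64 / d := by positivity
  have h2u : 0 < 2 / u := by positivity
  have hk64 : 64 / d < k := by linarith
  have hk2 : 2 / u < k := by linarith
  have hk3 : 3 < k := by
    have : (3 : ℝ) < k := by linarith
    exact_mod_cast this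
  obtain ⟨r, rfl⟩ := Nat.exists_eq_add_of_le' hq
  have hk0 : (0 : ℝ) < k := by linarith
  have hq0 : (0 : ℝ) < ((r + 2 : ℕ) : ℝ) := by positivity
  have hNr : (((r + 2) * k : ℕ) : ℝ) = ((r + 2 : ℕ) : ℝ) * k := by push_cast; ring
  have hN0 : (0 : ℝ) < (((r + 2) * k : ℕ) : ℝ) := by rw [hNr]; positivity
  have hLN : (((r * k + k - 3 : ℕ) : ℕ) : ℝ) = (((r + 2) * k : ℕ) : ℝ) - k - 3 := by
    rw [Nat.cast_sub (by nlinarith)]; push_cast; ring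
  have hNk : (k : ℝ) ≤ (((r + 2) * k : ℕ) : ℝ) := by
    exact_mod_cast Nat.le_mul_of_pos_left k (by omega)
  have hNu : 2 ≤ (((r + 2) * k : ℕ) : ℝ) * u := by
    rw [div_lt_iff₀ hu] at hk2
    nlinarith
  have hmN : (k / (((r + 2) * k : ℕ) : ℝ)) = 1 / ((r + 2 : ℕ) : ℝ) := by
    rw [hNr]; field_simp
  have key := h.norm_map_add_sub_le (a := (10 * (((r + 2) * k : ℕ) : ℝ)) • a) (L := r * k + k - 3)
    (m := k) (N := (r + 2) * k) ?_ ?_ (by positivity) ?_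
  · rw [smul_smul, one_div_mul_cancel (by positivity), one_smul, hmN] at key
    have : 64 / (((r + 2) * k : ℕ) : ℝ) < d := by
      rw [div_lt_iff₀ hN0]
      rw [div_lt_iff₀ hpos] at hk64
      nlinarith
    exact absurd key (not_le.2 this)
  · refine le_trans ?_ (smul_le_smul_of_nonneg_left ha (by positivity))
    rw [smul_smul]
    exact smul_le_smul_of_nonneg_right (by linarith) zero_le_one
  · refine (smul_le_smul_of_nonneg_left ha' (by positivity)).trans ?_
    rw [smul_smul]
    refine smul_le_smul_of_nonneg_right ?_ zero_le_one
    have e : 10 * (((r + 2) * k : ℕ) : ℝ) * (1 - u - 1 / ((r + 2 : ℕ) : ℝ)) =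
        10 * (((r + 2) * k : ℕ) : ℝ) - 10 * ((((r + 2) * k : ℕ) : ℝ) * u) - 10 * k := by
      rw [hNr]; field_simp
    rw [e, hLN]
    linarith
  · have : (r + 2) * k = r * k + 2 * k := by ring
    omega

/-- The map commutes with adding positive scalars, away from `0`. -/
theorem map_add_smul_one (h : IsConeIso ψ) {a : A} {u s : ℝ} (hu : 0 < u) (hs : 0 < s)
    (ha : u • 1 ≤ a) : ψ (a + s • 1) = ψ a + s • 1 := by
  obtain ⟨q, hq⟩ := exists_nat_gt (2 * (‖a‖ / s + 1))
  have hns : 0 ≤ ‖a‖ / s := by positivity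
  have hq2 : 2 ≤ q := by
    have : (2 : ℝ) < q := by linarith
    exact_mod_cast this.le
  have hq0 : (0 : ℝ) < q := by positivity
  have hM : 0 < q * s := by positivity
  have h1 := (h.scale hM).map_add_inv_smul_one (a := (q * s)⁻¹ • a) (q := q)
    (u := min (u / (q * s)) (1 / 2)) (by positivity) hq2 ?_ ?_
  · simp only [smul_add, smul_smul, mul_inv_cancel₀ hM.ne', one_smul] at h1
    have h2 := congrArg (fun x => (q * s) • x) h1
    simp only [smul_add, smul_smul, mul_inv_cancel₀ hM.ne', one_smul] at h2
    rw [show q * s * (1 / q) = s by field_simp] at h2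
    rw [add_comm, h2]
  · refine le_trans ?_ (smul_le_smul_of_nonneg_left ha (inv_pos.2 hM).le)
    rw [smul_smul]
    refine smul_le_smul_of_nonneg_right ((min_le_left _ _).trans_eq ?_) zero_le_one
    field_simp
  · have ha0 : 0 ≤ a := (smul_nonneg hu.le zero_le_one).trans ha
    have han := (norm_le_iff_le_smul_one ha0 (norm_nonneg a)).1 le_rfl
    refine (smul_le_smul_of_nonneg_left han (inv_pos.2 hM).le).trans ?_
    rw [smul_smul]
    refine smul_le_smul_of_nonneg_right ?_ zero_le_one
    have hm := min_le_right (u / (q * s)) (1 / 2)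
    have e : (q * s)⁻¹ * ‖a‖ + 1 / q = (‖a‖ / s + 1) / q := by field_simp
    have : (‖a‖ / s + 1) / q ≤ 1 / 2 := by
      rw [div_le_iff₀ hq0]; linarith
    linarith

end IsConeIso

section Norm

variable {A : Type*} [CStarAlgebra A] [PartialOrder A] [StarOrderedRing A]

theorem le_norm_smul_one {a : A} (ha : IsSelfAdjoint a) : a ≤ ‖a‖ • 1 := by
  rw [← Algebra.algebraMap_eq_smul_one]; exact ha.le_algebraMap_norm_self

theorem one_le_add_smul_one {a : A} (ha : IsSelfAdjoint a) {s : ℝ} (hs : ‖a‖ + 1 ≤ s) :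
    (1 : ℝ) • 1 ≤ a + s • 1 := by
  have h1 := ha.neg_algebraMap_norm_le_self
  rw [Algebra.algebraMap_eq_smul_one, neg_le_iff_add_nonneg] at h1
  have h2 : (‖a‖ + 1) • (1 : A) ≤ s • 1 := smul_le_smul_of_nonneg_right hs zero_le_one
  calc (1 : ℝ) • (1 : A) ≤ (a + ‖a‖ • 1) + (1 : ℝ) • 1 := le_add_of_nonneg_left h1
    _ = a + (‖a‖ + 1) • 1 := by rw [add_smul, add_assoc]
    _ ≤ a + s • 1 := by gcongr

theorem norm_sub_le_iff {a b : A} (ha : IsSelfAdjoint a) (hb : IsSelfAdjoint b) {r : ℝ}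
    (hr : 0 ≤ r) : ‖a - b‖ ≤ r ↔ a ≤ b + r • 1 ∧ b ≤ a + r • 1 := by
  have hab := ha.sub hb
  constructor
  · intro h
    have h0 : ‖a - b‖ • (1 : A) ≤ r • 1 := smul_le_smul_of_nonneg_right h zero_le_one
    have h1 := (le_norm_smul_one hab).trans h0
    have h2 := (le_norm_smul_one hab.neg).trans ((norm_neg (a - b)).symm ▸ h0)
    rw [neg_sub] at h2
    exact ⟨sub_le_iff_le_add'.1 h1, sub_le_iff_le_add'.1 h2⟩
  · rintro ⟨h1, h2⟩
    have h3 : a - b ≤ algebraMap ℝ A r := by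
      rw [Algebra.algebraMap_eq_smul_one]; exact sub_le_iff_le_add'.2 h1
    have h4 : algebraMap ℝ A (-r) ≤ a - b := by
      rw [Algebra.algebraMap_eq_smul_one, neg_smul, neg_le, neg_sub]
      exact sub_le_iff_le_add'.2 h2
    rw [le_algebraMap_iff_spectrum_le] at h3
    rw [algebraMap_le_iff_le_spectrum] at h4
    rw [← cfc_id ℝ (a - b)]
    exact norm_cfc_le hr fun x hx => abs_le.2 ⟨h4 x hx, h3 x hx⟩

theorem le_of_forall_le_add_smul_one {a b : A} (h : ∀ ε : ℝ, 0 < ε → a ≤ b + ε • 1) : a ≤ b :=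
  sub_nonpos.1 <| nonpos_of_forall_le_smul (y := (1 : A)) fun ε hε =>
    sub_le_iff_le_add'.2 (h ε hε)

end Norm

namespace IsConeIso

variable {A B : Type*} [CStarAlgebra A] [PartialOrder A] [StarOrderedRing A]
  [CStarAlgebra B] [PartialOrder B] [StarOrderedRing B] {ψ : A → B}

/-- The extension of a map on the positive cone to self-adjoint elements by translation. -/
noncomputable def ext (ψ : A → B) (a : A) : B := ψ (a + (‖a‖ + 1) • 1) - (‖a‖ + 1) • 1

theorem map_sub_smul_one_eq (h : IsConeIso ψ) {a : A} {u s s' : ℝ} (hu : 0 < u) (hs : s ≤ s')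
    (has : u • 1 ≤ a + s • 1) : ψ (a + s' • 1) - s' • 1 = ψ (a + s • 1) - s • 1 := by
  rcases hs.eq_or_lt with rfl | hs
  · rfl
  · have h1 := h.map_add_smul_one hu (sub_pos.2 hs) has
    rw [add_assoc, ← add_smul, add_sub_cancel] at h1
    rw [h1, sub_smul]
    abel

theorem ext_eq (h : IsConeIso ψ) {a : A} (ha : IsSelfAdjoint a) {u s : ℝ} (hu : 0 < u)
    (has : u • 1 ≤ a + s • 1) : ext ψ a = ψ (a + s • 1) - s • 1 := by
  rw [ext]
  rcases le_total s (‖a‖ + 1) with hs | hs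
  · exact h.map_sub_smul_one_eq hu hs has
  · exact (h.map_sub_smul_one_eq one_pos hs (one_le_add_smul_one ha le_rfl)).symm

theorem ext_eq_of_le (h : IsConeIso ψ) {a : A} (ha : IsSelfAdjoint a) {s : ℝ} (hs : ‖a‖ + 1 ≤ s) :
    0 ≤ a + s • 1 ∧ ext ψ a = ψ (a + s • 1) - s • 1 :=
  ⟨(smul_nonneg zero_le_one zero_le_one).trans (one_le_add_smul_one ha hs),
    h.ext_eq ha one_pos (one_le_add_smul_one ha hs)⟩

theorem ext_isSelfAdjoint (h : IsConeIso ψ) {a : A} (ha : IsSelfAdjoint a) :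
    IsSelfAdjoint (ext ψ a) :=
  (h.map_nonneg _ (h.ext_eq_of_le ha le_rfl).1).isSelfAdjoint.sub
    ((IsSelfAdjoint.all _).smul (IsSelfAdjoint.one B))

theorem ext_le_ext_iff (h : IsConeIso ψ) {a b : A} (ha : IsSelfAdjoint a) (hb : IsSelfAdjoint b) :
    ext ψ a ≤ ext ψ b ↔ a ≤ b := by
  obtain ⟨ha0, ha1⟩ := h.ext_eq_of_le ha (le_max_left (‖a‖ + 1) (‖b‖ + 1))
  obtain ⟨hb0, hb1⟩ := h.ext_eq_of_le hb (le_max_right (‖a‖ + 1) (‖b‖ + 1))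
  rw [ha1, hb1, sub_le_sub_iff_right, ← h.le_iff _ _ ha0 hb0, add_le_add_iff_right]

theorem ext_add_smul_one (h : IsConeIso ψ) {a : A} (ha : IsSelfAdjoint a) (t : ℝ) :
    ext ψ (a + t • 1) = ext ψ a + t • 1 := by
  have hat : IsSelfAdjoint (a + t • 1) := ha.add ((IsSelfAdjoint.all _).smul (IsSelfAdjoint.one A))
  obtain ⟨s, hs1, hs2⟩ : ∃ s, ‖a‖ + 1 - t ≤ s ∧ ‖a + t • 1‖ + 1 ≤ s :=
    ⟨_, le_max_left _ _, le_max_right _ _⟩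
  rw [(h.ext_eq_of_le ha (sub_le_iff_le_add'.1 hs1)).2, (h.ext_eq_of_le hat hs2).2, add_assoc,
    ← add_smul, add_smul t s (1 : B)]
  abel

theorem norm_ext_sub_ext (h : IsConeIso ψ) {a b : A} (ha : IsSelfAdjoint a)
    (hb : IsSelfAdjoint b) : ‖ext ψ a - ext ψ b‖ = ‖a - b‖ := by
  have key : ∀ r : ℝ, 0 ≤ r → (‖ext ψ a - ext ψ b‖ ≤ r ↔ ‖a - b‖ ≤ r) := by
    intro r hr
    have hr' : IsSelfAdjoint (r • (1 : A)) := (IsSelfAdjoint.all _).smul (IsSelfAdjoint.one A)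
    rw [norm_sub_le_iff (h.ext_isSelfAdjoint ha) (h.ext_isSelfAdjoint hb) hr,
      norm_sub_le_iff ha hb hr, ← h.ext_add_smul_one ha, ← h.ext_add_smul_one hb,
      h.ext_le_ext_iff ha (hb.add hr'), h.ext_le_ext_iff hb (ha.add hr')]
  exact le_antisymm ((key _ (norm_nonneg _)).2 le_rfl) ((key _ (norm_nonneg _)).1 le_rfl)

theorem exists_ext_eq (h : IsConeIso ψ) {b : B} (hb : IsSelfAdjoint b) :
    ∃ a : A, IsSelfAdjoint a ∧ ext ψ a = b := by
  have hb1 := one_le_add_smul_one hb le_rfl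
  obtain ⟨d, hd0, hd⟩ := h.surj _ ((smul_nonneg zero_le_one zero_le_one).trans hb1)
  rw [← hd, h.smul_one_le_iff hd0 zero_le_one] at hb1
  have hs : IsSelfAdjoint (d - (‖b‖ + 1) • 1) :=
    hd0.isSelfAdjoint.sub ((IsSelfAdjoint.all _).smul (IsSelfAdjoint.one A))
  refine ⟨_, hs, ?_⟩
  rw [h.ext_eq hs (s := ‖b‖ + 1) one_pos (by rwa [sub_add_cancel]), sub_add_cancel, hd,
    add_sub_cancel_right]

theorem ext_eq_map (h : IsConeIso ψ) {a : A} (ha : 0 ≤ a) : ext ψ a = ψ a := by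
  have hε : ∀ ε : ℝ, 0 < ε → ψ (a + ε • 1) = ext ψ a + ε • 1 := by
    intro ε hε
    rw [h.ext_eq ha.isSelfAdjoint hε (le_add_of_nonneg_left ha), sub_add_cancel]
  have h1 : ψ a ≤ ext ψ a := by
    refine le_of_forall_le_add_smul_one fun ε hε' => ?_
    rw [← hε ε hε']
    exact h.map_le ha (le_add_of_nonneg_right (smul_nonneg hε'.le zero_le_one))
  refine le_antisymm ?_ h1
  obtain ⟨b, hb0, hb⟩ := h.surj _ ((h.map_nonneg a ha).trans h1)
  rw [← hb]
  refine h.map_le hb0 (le_of_forall_le_add_smul_one fun ε hε' => ?_)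
  rw [h.le_iff _ _ hb0 (add_nonneg ha (smul_nonneg hε'.le zero_le_one)), hb, hε ε hε']
  exact le_add_of_nonneg_right (smul_nonneg hε'.le zero_le_one)

/-- By the Mazur–Ulam theorem the map extends to a real-linear isometry of the self-adjoint
parts. -/
theorem exists_linearIsometryEquiv (h : IsConeIso ψ) :
    ∃ T : selfAdjoint A ≃ₗᵢ[ℝ] selfAdjoint B,
      ∀ a : selfAdjoint A, 0 ≤ (a : A) → (T a : B) = ψ a := by
  let f : selfAdjoint A → selfAdjoint B := fun a => ⟨ext ψ a, h.ext_isSelfAdjoint a.2⟩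
  have hf : Isometry f := Isometry.of_dist_eq fun a b => by
    rw [dist_eq_norm, dist_eq_norm]
    exact h.norm_ext_sub_ext a.2 b.2
  have hsurj : Function.Surjective f := fun b => by
    obtain ⟨a, ha, hab⟩ := h.exists_ext_eq b.2
    exact ⟨⟨a, ha⟩, Subtype.ext hab⟩
  let e : selfAdjoint A ≃ᵢ selfAdjoint B :=
    ⟨Equiv.ofBijective f ⟨hf.injective, hsurj⟩, hf⟩
  have h0 : e 0 = 0 := Subtype.ext ((h.ext_eq_map le_rfl).trans h.map_zero)
  exact ⟨e.toRealLinearIsometryEquivOfMapZero h0, fun a ha => h.ext_eq_map ha⟩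

end IsConeIso

section SquareApprox

theorem sum_max_sub_of_le {N : ℕ} {y : ℝ} (hy : (N : ℝ) ≤ y) :
    2 * ∑ j ∈ Finset.range N, max (y - j) 0 = 2 * N * y - N * (N - 1) := by
  induction N with
  | zero => simp
  | succ N ih =>
    push_cast at hy ⊢
    rw [Finset.sum_range_succ, mul_add, ih (by linarith), max_eq_left (by linarith)]
    ring

theorem sum_max_sub_bounds {N : ℕ} {y : ℝ} (hy0 : 0 ≤ y) (hy : y ≤ N) :
    |y ^ 2 - 2 * ∑ j ∈ Finset.range N, max (y - j) 0| ≤ y + 1 := by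
  induction N with
  | zero =>
    obtain rfl : y = 0 := le_antisymm (by simpa using hy) hy0
    simp
  | succ N ih =>
    rcases le_total y N with h | h
    · simpa [Finset.sum_range_succ, max_eq_right (sub_nonpos.2 h)] using ih h
    · push_cast at hy
      rw [Finset.sum_range_succ, mul_add, sum_max_sub_of_le h, max_eq_left (by linarith), abs_le]
      constructor <;> nlinarith

/-- A piecewise linear approximation of the square on `[0, 1]`. -/
noncomputable def sqApprox (N : ℕ) (x : ℝ) : ℝ :=
  ∑ j ∈ Finset.range N, 2 / N * max (x - j / N) 0

theorem abs_sq_sub_sqApprox_le {N : ℕ} (hN : 0 < N) {x : ℝ} (hx0 : 0 ≤ x) (hx1 : x ≤ 1) :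
    |x * x - sqApprox N x| ≤ 2 / N := by
  have hN' : (0 : ℝ) < N := by exact_mod_cast hN
  have hN1 : (1 : ℝ) ≤ N := by exact_mod_cast hN
  have key := sum_max_sub_bounds (N := N) (mul_nonneg hN'.le hx0) (mul_le_of_le_one_right hN'.le hx1)
  have hs : sqApprox N x = (2 * ∑ j ∈ Finset.range N, max (N * x - j) 0) / (N : ℝ) ^ 2 := by
    rw [sqApprox, Finset.mul_sum, Finset.sum_div]
    refine Finset.sum_congr rfl fun j _ => ?_
    have : max ((N : ℝ) * x - j) 0 = N * max (x - j / N) 0 := by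
      rw [mul_max_of_nonneg _ _ hN'.le, mul_zero, mul_sub, mul_div_cancel₀ _ hN'.ne']
    rw [this]
    field_simp
  have hd : x * x - sqApprox N x
      = ((N * x) ^ 2 - 2 * ∑ j ∈ Finset.range N, max (N * x - j) 0) / (N : ℝ) ^ 2 := by
    rw [hs]
    field_simp
  rw [hd, abs_div, abs_of_pos (pow_pos hN' 2), div_le_div_iff₀ (pow_pos hN' 2) hN']
  nlinarith [mul_le_mul_of_nonneg_right key hN'.le]

variable {A : Type*} [CStarAlgebra A] [PartialOrder A] [StarOrderedRing A]

theorem cfc_max_sub {a : A} (ha : IsSelfAdjoint a) (t : ℝ) :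
    cfc (fun x : ℝ => max (x - t) 0) a = (a - t • 1)⁺ ∧
      cfc (fun x : ℝ => max (t - x) 0) a = (a - t • 1)⁻ := by
  have h := CFC.posPart_negPart_unique (a := a - t • 1) (b := cfc (fun x : ℝ => max (x - t) 0) a)
    (c := cfc (fun x : ℝ => max (t - x) 0) a) ?_ ?_ (cfc_nonneg fun _ _ => le_max_right _ _)
    (cfc_nonneg fun _ _ => le_max_right _ _)
  · exact ⟨h.1.symm, h.2.symm⟩
  · have hat : a - t • 1 = cfc (fun x : ℝ => x - t) a := by
      rw [cfc_sub .., cfc_id' .., cfc_const .., Algebra.algebraMap_eq_smul_one]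
    rw [hat, ← cfc_sub ..]
    refine cfc_congr fun x _ => ?_
    rcases le_total x t with h | h
    · rw [max_eq_right (by linarith), max_eq_left (by linarith)]; ring
    · rw [max_eq_left (by linarith), max_eq_right (by linarith)]; ring
  · rw [← cfc_mul .., ← cfc_const_zero ℝ a]
    refine cfc_congr fun x _ => ?_
    rcases le_total x t with h | h
    · simp [max_eq_right (sub_nonpos.2 h)]
    · simp [max_eq_right (sub_nonpos.2 h)]

theorem norm_mul_self_sub_cfc_sqApprox_le {a : A} (ha0 : 0 ≤ a) (ha1 : a ≤ 1) {N : ℕ}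
    (hN : 0 < N) : ‖a * a - cfc (sqApprox N) a‖ ≤ 2 / N := by
  have hc : Continuous (sqApprox N) := by unfold sqApprox; fun_prop
  have h : a * a - cfc (sqApprox N) a = cfc (fun x => x * x - sqApprox N x) a := by
    rw [cfc_sub .., cfc_mul .., cfc_id' ..]
  rw [h]
  have h1 : a ≤ algebraMap ℝ A 1 := by simpa using ha1
  rw [le_algebraMap_iff_spectrum_le] at h1
  exact norm_cfc_le (by positivity) fun x hx =>
    abs_sq_sub_sqApprox_le hN (spectrum_nonneg_of_nonneg ha0 hx) (h1 x hx)

theorem cfc_sqApprox (a : A) (N : ℕ) :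
    cfc (sqApprox N) a
      = ∑ j ∈ Finset.range N, (2 / N : ℝ) • cfc (fun x : ℝ => max (x - j / N) 0) a := by
  have : sqApprox N = ∑ j ∈ Finset.range N, fun x : ℝ => (2 / N : ℝ) • max (x - j / N) 0 := by
    ext x
    simp [sqApprox]
  rw [this, cfc_sum ..]
  exact Finset.sum_congr rfl fun j _ => cfc_smul ..

end SquareApprox

section Jordan

variable {A B : Type*} [CStarAlgebra A] [PartialOrder A] [StarOrderedRing A]
  [CStarAlgebra B] [PartialOrder B] [StarOrderedRing B] {J : A →ₗ[ℂ] B}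

theorem map_real_smul (J : A →ₗ[ℂ] B) (t : ℝ) (a : A) : J (t • a) = t • J a := by
  rw [← Complex.coe_smul, map_smul, Complex.coe_smul]

theorem map_cfc_max_sub (h1 : J 1 = 1) (hstar : ∀ a, J (star a) = star (J a))
    (hpos : ∀ a, 0 ≤ a → 0 ≤ J a) (horth : ∀ a b, 0 ≤ a → 0 ≤ b → a * b = 0 → J a * J b = 0)
    {a : A} (ha : IsSelfAdjoint a) (t : ℝ) :
    J (cfc (fun x : ℝ => max (x - t) 0) a) = cfc (fun x : ℝ => max (x - t) 0) (J a) := by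
  have hJa : IsSelfAdjoint (J a) := by rw [IsSelfAdjoint, ← hstar, ha.star_eq]
  rw [(cfc_max_sub ha t).1, (cfc_max_sub hJa t).1]
  refine (CFC.posPart_negPart_unique ?_ ?_ (hpos _ (CFC.posPart_nonneg _))
    (hpos _ (CFC.negPart_nonneg (a - t • 1)))).1.symm
  · rw [← map_sub, CFC.posPart_sub_negPart _
      (ha.sub ((IsSelfAdjoint.all _).smul (IsSelfAdjoint.one A))), map_sub, map_real_smul, h1]
  · exact horth _ _ (CFC.posPart_nonneg _) (CFC.negPart_nonneg _) (CFC.posPart_mul_negPart _)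

theorem map_mul_self (h1 : J 1 = 1) (hstar : ∀ a, J (star a) = star (J a))
    (hpos : ∀ a, 0 ≤ a → 0 ≤ J a) (horth : ∀ a b, 0 ≤ a → 0 ≤ b → a * b = 0 → J a * J b = 0)
    (hnorm : ∀ a, IsSelfAdjoint a → ‖J a‖ ≤ ‖a‖) {a : A} (ha : IsSelfAdjoint a) :
    J (a * a) = J a * J a := by
  have unit : ∀ b : A, 0 ≤ b → b ≤ 1 → J (b * b) = J b * J b := by
    intro b hb0 hb1
    have hb := hb0.isSelfAdjoint
    have hJb1 : J b ≤ 1 := by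
      rw [← h1, ← sub_nonneg, ← map_sub]
      exact hpos _ (sub_nonneg.2 hb1)
    have bound : ∀ N : ℕ, 0 < N → ‖J (b * b) - J b * J b‖ ≤ 4 / N := by
      intro N hN
      have hJ : J (cfc (sqApprox N) b) = cfc (sqApprox N) (J b) := by
        rw [cfc_sqApprox b, cfc_sqApprox (J b), map_sum]
        refine Finset.sum_congr rfl fun j _ => ?_
        rw [map_real_smul, map_cfc_max_sub h1 hstar hpos horth hb]
      have hbb : IsSelfAdjoint (b * b) := by simpa [hb.star_eq] using IsSelfAdjoint.mul_star_self b
      calc ‖J (b * b) - J b * J b‖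
          = ‖J (b * b - cfc (sqApprox N) b) - (J b * J b - cfc (sqApprox N) (J b))‖ := by
            rw [map_sub, hJ, sub_sub_sub_cancel_right]
        _ ≤ ‖J (b * b - cfc (sqApprox N) b)‖ + ‖J b * J b - cfc (sqApprox N) (J b)‖ :=
            norm_sub_le _ _
        _ ≤ 2 / N + 2 / N := add_le_add
            ((hnorm _ (hbb.sub (cfc_predicate _ _))).trans
              (norm_mul_self_sub_cfc_sqApprox_le hb0 hb1 hN))
            (norm_mul_self_sub_cfc_sqApprox_le (hpos b hb0) hJb1 hN)
        _ = 4 / N := by ring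
    refine sub_eq_zero.1 (norm_le_zero_iff.1 (ge_of_tendsto
      (tendsto_const_div_atTop_nhds_zero_nat (4 : ℝ)) ?_))
    filter_upwards [Filter.eventually_gt_atTop 0] with N hN using bound N hN
  set s := ‖a‖ + 1
  have hs : 0 < s := by positivity
  have hb0 : 0 ≤ a + s • 1 :=
    (smul_nonneg zero_le_one zero_le_one).trans (one_le_add_smul_one ha le_rfl)
  have hb1 : a + s • 1 ≤ (2 * s) • 1 := by
    rw [two_mul, add_smul s s (1 : A)]
    exact add_le_add ((le_norm_smul_one ha).trans
      (smul_le_smul_of_nonneg_right (le_add_of_nonneg_right zero_le_one) zero_le_one)) le_rfl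
  have hc0 : (0 : ℝ) < (2 * s)⁻¹ := by positivity
  have hb2 := smul_le_smul_of_nonneg_left hb1 hc0.le
  rw [smul_smul, inv_mul_cancel₀ (by positivity), one_smul] at hb2
  have key := unit ((2 * s)⁻¹ • (a + s • 1)) (smul_nonneg hc0.le hb0) hb2
  simp only [smul_mul_smul_comm, map_real_smul] at key
  have key2 := smul_right_injective B (mul_pos hc0 hc0).ne' key
  simp only [add_mul, mul_add, map_add, map_real_smul, h1, smul_mul_assoc, mul_smul_comm, one_mul,
    mul_one] at key2
  simpa using key2

theorem map_jordan (h1 : J 1 = 1) (hstar : ∀ a, J (star a) = star (J a))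
    (hpos : ∀ a, 0 ≤ a → 0 ≤ J a) (horth : ∀ a b, 0 ≤ a → 0 ≤ b → a * b = 0 → J a * J b = 0)
    (hnorm : ∀ a, IsSelfAdjoint a → ‖J a‖ ≤ ‖a‖) (a b : A) :
    J (a * b + b * a) = J a * J b + J b * J a := by
  have sq : ∀ {x : A}, IsSelfAdjoint x → J (x * x) = J x * J x :=
    fun hx => map_mul_self h1 hstar hpos horth hnorm hx
  have sa : ∀ x y : selfAdjoint A, J (x * y + y * x) = J x * J y + J y * J x := by
    intro x y
    have h := sq (x.2.add y.2)
    simp only [add_mul, mul_add, map_add, sq x.2, sq y.2] at h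
    rw [map_add]
    rw [← sub_eq_zero] at h ⊢
    rw [← h]
    abel
  rw [← realPart_add_I_smul_imaginaryPart a, ← realPart_add_I_smul_imaginaryPart b]
  have h := sa (realPart a) (realPart b)
  have h2 := sa (realPart a) (imaginaryPart b)
  have h3 := sa (imaginaryPart a) (realPart b)
  have h4 := sa (imaginaryPart a) (imaginaryPart b)
  simp only [map_add] at h h2 h3 h4
  simp only [add_mul, mul_add, map_add, map_smul, smul_mul_assoc, mul_smul_comm]
  linear_combination (norm := module) h + Complex.I • h2 + Complex.I • h3
    + (Complex.I * Complex.I) • h4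

end Jordan

section Complexification

variable {E F : Type*} [AddCommGroup E] [Module ℂ E] [StarAddMonoid E] [StarModule ℂ E]
  [AddCommGroup F] [Module ℂ F] [StarAddMonoid F] [StarModule ℂ F]

/-- The complex-linear extension of a real-linear map between self-adjoint parts. -/
noncomputable def complexify (T : selfAdjoint E →ₗ[ℝ] selfAdjoint F) : E →ₗ[ℂ] F where
  toFun z := T (realPart z) + Complex.I • (T (imaginaryPart z) : F)
  map_add' x y := by
    simp only [map_add, AddSubgroup.coe_add, smul_add]
    abel
  map_smul' c x := by
    rw [realPart_smul, imaginaryPart_smul, map_sub, map_add, map_smul, map_smul, map_smul,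
      map_smul]
    simp only [AddSubgroup.coe_sub, AddSubgroup.coe_add, selfAdjoint.val_smul, RingHom.id_apply,
      ← Complex.coe_smul (E := F)]
    conv_rhs => rw [← Complex.re_add_im c]
    match_scalars <;> ring_nf <;> simp

theorem complexify_apply (T : selfAdjoint E →ₗ[ℝ] selfAdjoint F) (z : E) :
    complexify T z = T (realPart z) + Complex.I • (T (imaginaryPart z) : F) := rfl

theorem complexify_coe (T : selfAdjoint E →ₗ[ℝ] selfAdjoint F) (a : selfAdjoint E) :
    complexify T a = T a := by
  have : realPart (a : E) = a := Subtype.ext a.2.coe_realPart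
  simp [complexify_apply, this, a.2.imaginaryPart]

theorem complexify_star (T : selfAdjoint E →ₗ[ℝ] selfAdjoint F) (z : E) :
    complexify T (star z) = star (complexify T z) := by
  have hr : realPart (star z) = realPart z := by
    ext; simp [realPart_apply_coe, add_comm]
  have hi : imaginaryPart (star z) = -imaginaryPart z := by
    ext; simp [imaginaryPart_apply_coe]; rw [← smul_neg, ← smul_neg, neg_sub]
  simp [complexify_apply, hr, hi, (T _).2.star_eq]

theorem complexify_symm_complexify (T : selfAdjoint E ≃ₗ[ℝ] selfAdjoint F) (z : E) :
    complexify (T.symm : selfAdjoint F →ₗ[ℝ] selfAdjoint E)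
      (complexify (T : selfAdjoint E →ₗ[ℝ] selfAdjoint F) z) = z := by
  rw [complexify_apply (T : selfAdjoint E →ₗ[ℝ] selfAdjoint F), map_add, map_smul,
    complexify_coe, complexify_coe]
  simp [realPart_add_I_smul_imaginaryPart]

theorem complexify_bijective (T : selfAdjoint E ≃ₗ[ℝ] selfAdjoint F) :
    Function.Bijective (complexify (T : selfAdjoint E →ₗ[ℝ] selfAdjoint F)) :=
  Function.bijective_iff_has_inverse.2
    ⟨_, complexify_symm_complexify T, complexify_symm_complexify T.symm⟩

end Complexification

/-- The case of a unital codomain. -/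
theorem IsConeIso.exists_jordan {A B : Type*} [CStarAlgebra A] [PartialOrder A] [StarOrderedRing A]
    [CStarAlgebra B] [PartialOrder B] [StarOrderedRing B] {ψ : A → B} (h : IsConeIso ψ) :
    ∃ J : A →ₗ[ℂ] B, Function.Bijective J ∧ (∀ a : A, J (star a) = star (J a)) ∧
      (∀ a b : A, J (a * b + b * a) = J a * J b + J b * J a) ∧ ∀ a : A, 0 ≤ a → J a = ψ a := by
  obtain ⟨T, hT⟩ := h.exists_linearIsometryEquiv
  set J := complexify (T.toLinearEquiv : selfAdjoint A →ₗ[ℝ] selfAdjoint B)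
  have hψ : ∀ a : A, 0 ≤ a → J a = ψ a := fun a ha =>
    (complexify_coe _ ⟨a, ha.isSelfAdjoint⟩).trans (hT _ ha)
  have hstar : ∀ a : A, J (star a) = star (J a) := complexify_star _
  refine ⟨J, complexify_bijective T.toLinearEquiv, hstar, ?_, hψ⟩
  refine map_jordan ((hψ 1 zero_le_one).trans h.map_one) hstar ?_ ?_ ?_
  · intro a ha
    rw [hψ a ha]
    exact h.map_nonneg a ha
  · intro a b ha hb hab
    rw [hψ a ha, hψ b hb]
    exact h.orth a b ha hb hab
  · intro a ha
    have : J a = T ⟨a, ha⟩ := complexify_coe _ ⟨a, ha⟩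
    rw [this]
    exact (T.norm_map ⟨a, ha⟩).le

section UnitalCodomain

variable {B : Type*} [NonUnitalCStarAlgebra B]

/-- An element that dominates the open unit ball of the positive cone is a unit. -/
theorem mul_eq_self_of_dominates [PartialOrder B] [StarOrderedRing B] {e : B} (he : ‖e‖ ≤ 1)
    (hle : ∀ b : B, 0 ≤ b → ‖b‖ < 1 → b ≤ e) (b : B) : e * b = b ∧ b * e = b := by
  have hpure : pure e ≤ CStarAlgebra.approximateUnit B :=
    (CStarAlgebra.hasBasis_approximateUnit B).ge_iff.2 fun a ha =>
      Filter.mem_pure.2 ⟨hle a ha.1 ha.2, mem_closedBall_zero_iff.2 he⟩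
  have hu := CStarAlgebra.increasingApproximateUnit B
  exact ⟨tendsto_nhds_unique (tendsto_pure_nhds (· * b) e)
      ((hu.tendsto_mul_right b).mono_left hpure),
    tendsto_nhds_unique (tendsto_pure_nhds (b * ·) e) ((hu.tendsto_mul_left b).mono_left hpure)⟩

/-- A non-unital C*-algebra that has a unit is a unital C*-algebra. -/
@[reducible]
noncomputable def cstarAlgebraOfUnit (e : B) (he : ∀ b : B, e * b = b ∧ b * e = b) :
    CStarAlgebra B :=
  letI : NormedRing B :=
    { (inferInstance : NonUnitalNormedRing B) with
      one := e
      one_mul := fun b => (he b).1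
      mul_one := fun b => (he b).2 }
  letI : Algebra ℂ B := Algebra.ofModule smul_mul_assoc mul_smul_comm
  letI : NormedAlgebra ℂ B := { norm_smul_le := norm_smul_le }
  { }

end UnitalCodomain

end ConeIso

/-- Let `𝒜` be a unital C*-algebra, `ℬ` a C*-algebra, and `ψ : 𝒜⁺ → ℬ⁺` a
surjective order isomorphism that is norm preserving and orthogonality preserving
(`a * b = 0` implies `ψ a * ψ b = 0`).  Then there exists a Jordan *-isomorphism
`J : 𝒜 → ℬ` with `J a = ψ a` for all `a ∈ 𝒜⁺`. -/
theorem stmt12 {A B : Type*} [CStarAlgebra A] [PartialOrder A] [StarOrderedRing A]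
    [NonUnitalCStarAlgebra B] [PartialOrder B] [StarOrderedRing B]
    (ψ : A → B)
    (hmap : ∀ a : A, 0 ≤ a → 0 ≤ ψ a)
    (hsurj : ∀ b : B, 0 ≤ b → ∃ a : A, 0 ≤ a ∧ ψ a = b)
    (horder : ∀ a b : A, 0 ≤ a → 0 ≤ b → (a ≤ b ↔ ψ a ≤ ψ b))
    (hnorm : ∀ a : A, 0 ≤ a → ‖ψ a‖ = ‖a‖)
    (horth : ∀ a b : A, 0 ≤ a → 0 ≤ b → a * b = 0 → ψ a * ψ b = 0) :
    ∃ J : A → B, Function.Bijective J ∧ IsLinearMap ℂ J ∧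
      (∀ a : A, J (star a) = star (J a)) ∧
      (∀ a b : A, J (a * b + b * a) = J a * J b + J b * J a) ∧
      (∀ a : A, 0 ≤ a → J a = ψ a) := by
  have hone : ‖ψ 1‖ ≤ 1 := by
    rw [hnorm 1 zero_le_one, ConeIso.norm_le_iff_le_smul_one zero_le_one zero_le_one, one_smul]
  have hunit := ConeIso.mul_eq_self_of_dominates hone fun b hb0 hb1 => by
    obtain ⟨a, ha, rfl⟩ := hsurj b hb0
    rw [hnorm a ha] at hb1
    refine (horder a 1 ha zero_le_one).1 ?_
    simpa using (ConeIso.norm_le_iff_le_smul_one ha zero_le_one).1 hb1.le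
  let _ := ConeIso.cstarAlgebraOfUnit (ψ 1) hunit
  have h : ConeIso.IsConeIso ψ := ⟨hmap, hsurj, horder, hnorm, horth⟩
  have : StarOrderedRing B := ‹StarOrderedRing B›
  obtain ⟨J, hbij, hstar, hjordan, hψ⟩ := h.exists_jordan
  exact ⟨J, hbij, J.isLinear, hstar, hjordan, hψ⟩
end
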